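/- Let 1 ≤ c ≤ d, let Δ^d = {z ∈ ℂ^d : |z_i| < 1 for all i} be the open unit polydisc, and let U := {z ∈ Δ^d : z_k ≠ 0 for k = 1, …, c}. Let A_1, …, A_p : U → ℝ be log-real-analytic functions, i.e., each A_i is a polynomial in log|z_1|, …, log|z_c| whose coefficients are real analytic functions on Δ^d (viewing Δ^d ⊆ ℝ^{2d}). Let X⁻ := {z ∈ U : A_i(z) = 0 for i = 1, …, p}. Then either (i) there exists r ∈ (0, 1) such that X⁻ contains no point z with max_i |z_i| < r, or (ii) there exists a continuous injective map γ : [0, 1) → Δ^d with γ(0) = 0, γ real analytic on (0, 1), and γ((0, 1)) ⊆ X⁻. -/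

import Mathlib

set_option linter.unusedSectionVars false
set_option linter.unusedSimpArgs false

namespace LRA
open Filter Topology Set

section Hadamard
variable {E : Type*} [NormedAddCommGroup E] [NormedSpace ℝ E]

/-- The formal series of the Hadamard quotient. -/
noncomputable def hadSeries (p : FormalMultilinearSeries ℝ E ℝ) (π : E →L[ℝ] E) (e : E) :
    FormalMultilinearSeries ℝ E ℝ := fun n =>
  ∑ j : Fin (n+1), ((p (n+1)).curryMid j e).compContinuousLinearMap
    (fun i : Fin n => if (j.succAbove i) < j then ContinuousLinearMap.id ℝ E else π)

lemma hadSeries_apply (p : FormalMultilinearSeries ℝ E ℝ) (π : E →L[ℝ] E) (e : E) (ℓ : E →L[ℝ] ℝ)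
    (h : ∀ x, x - π x = ℓ x • e) (n : ℕ) (x : E) :
    ℓ x * (hadSeries p π e n fun _ => x) = p (n+1) (fun _ => x) - p (n+1) (fun _ => π x) := by
  have key : ∀ j : Fin (n+1), ℓ x * (((p (n+1)).curryMid j e).compContinuousLinearMap
    (fun i : Fin n => if (j.succAbove i) < j then ContinuousLinearMap.id ℝ E else π) fun _ => x)
     = p (n+1) (fun i => if (i:ℕ) < (j:ℕ)+1 then x else π x)
       - p (n+1) (fun i => if (i:ℕ) < (j:ℕ) then x else π x) := by
    intro j
    set m : Fin (n+1) → E := fun i => if (i:ℕ) < (j:ℕ) then x else π x with hm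
    have e1 : (fun i : Fin (n+1) => if (i:ℕ) < (j:ℕ)+1 then x else π x) = Function.update m j x := by
      ext1 i
      by_cases hij : i = j
      · subst hij; simp
      · have : (i:ℕ) ≠ j := fun h => hij (Fin.ext h)
        simp only [Function.update_of_ne hij, hm]
        by_cases h2 : (i:ℕ) < j
        · simp [h2, Nat.lt_succ_of_lt h2]
        · have : ¬ (i:ℕ) < j + 1 := by omega
          simp [h2, this]
    have e2 : m = Function.update m j (π x) := by
      ext1 i
      by_cases hij : i = j
      · subst hij; simp [hm]
      · simp [Function.update_of_ne hij]
    rw [e1]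
    conv_rhs => arg 2; rw [e2]
    rw [← ContinuousMultilinearMap.map_update_sub, h, ContinuousMultilinearMap.map_update_smul,
      smul_eq_mul]
    congr 1
    simp only [ContinuousMultilinearMap.compContinuousLinearMap_apply,
      ContinuousMultilinearMap.curryMid_apply]
    congr 1
    ext1 i
    refine Fin.succAboveCases j ?_ (fun i => ?_) i
    · simp
    · simp only [Fin.insertNth_apply_succAbove, Function.update_of_ne (Fin.succAbove_ne j i), hm,
        Fin.lt_def]
      split_ifs <;> simp
  simp only [hadSeries, sum_apply, Finset.mul_sum]
  rw [Finset.sum_congr rfl (fun j _ => key j)]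
  rw [Fin.sum_univ_eq_sum_range (fun j => p (n+1) (fun i => if (i:ℕ) < j+1 then x else π x)
       - p (n+1) (fun i => if (i:ℕ) < j then x else π x)) (n+1),
    Finset.sum_range_sub (fun j => p (n+1) (fun i => if (i:ℕ) < j then x else π x))]
  congr 2
  ext i; simp; intro hi; omega

lemma hadSeries_norm (p : FormalMultilinearSeries ℝ E ℝ) (π : E →L[ℝ] E) (e : E) (n : ℕ) :
    ‖hadSeries p π e n‖ ≤ (n+1) * (‖p (n+1)‖ * ‖e‖ * (max 1 ‖π‖)^n) := by
  unfold hadSeries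
  refine (norm_sum_le _ _).trans ?_
  have : ∀ j ∈ (Finset.univ : Finset (Fin (n+1))), ‖((p (n+1)).curryMid j e).compContinuousLinearMap
    (fun i : Fin n => if (j.succAbove i) < j then ContinuousLinearMap.id ℝ E else π)‖ ≤
     ‖p (n+1)‖ * ‖e‖ * (max 1 ‖π‖)^n := by
    intro j _
    refine (ContinuousMultilinearMap.norm_compContinuousLinearMap_le _ _).trans ?_
    gcongr
    · refine (ContinuousLinearMap.le_opNorm _ _).trans ?_
      rw [ContinuousMultilinearMap.norm_curryMid]
    · refine (Finset.prod_le_prod (fun _ _ => norm_nonneg _) (g := fun _ => max 1 ‖π‖) ?_).trans ?_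
      · intro i _
        split_ifs
        · exact ContinuousLinearMap.norm_id_le.trans (le_max_left _ _)
        · exact le_max_right _ _
      · simp
  refine (Finset.sum_le_sum this).trans ?_
  simp

lemma hadSeries_radius (p : FormalMultilinearSeries ℝ E ℝ) (π : E →L[ℝ] E) (e : E)
    (hp : 0 < p.radius) : 0 < (hadSeries p π e).radius := by
  obtain ⟨C, a, hC, ha, hb⟩ := p.le_mul_pow_of_radius_pos hp
  set M : ℝ := max 1 ‖π‖
  have hM : 0 < M := lt_of_lt_of_le one_pos (le_max_left _ _)
  set ρ : ℝ := (2 * a * M)⁻¹ with hρ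
  have hρ0 : 0 < ρ := by positivity
  obtain ⟨ρ', hρ'⟩ : ∃ ρ' : NNReal, (ρ' : ℝ) = ρ := ⟨⟨ρ, hρ0.le⟩, rfl⟩
  have : (ρ' : ENNReal) ≤ (hadSeries p π e).radius := by
    refine FormalMultilinearSeries.le_radius_of_bound _ (C * a * ‖e‖) fun n => ?_
    rw [hρ']
    have h1 := hadSeries_norm p π e n
    have h2 : ((n:ℝ)+1) ≤ 2^n := by
      have : n + 1 ≤ 2^n := Nat.lt_two_pow_self
      exact_mod_cast this
    calc ‖hadSeries p π e n‖ * ρ^n ≤ (2^n * ((C * a^(n+1)) * ‖e‖ * M^n)) * ρ^n := by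
          gcongr
          refine h1.trans ?_
          gcongr
          exact hb _
      _ = (C * a * ‖e‖) * ((2 * a * M) * ρ)^n := by rw [pow_succ, mul_pow, mul_pow, mul_pow]; ring
      _ = C * a * ‖e‖ := by rw [hρ, mul_inv_cancel₀ (by positivity)]; simp
  refine lt_of_lt_of_le ?_ this
  rw [← hρ'] at hρ0
  exact_mod_cast hρ0

/-- Hadamard division. -/
theorem hadamard {f : E → ℝ} (hf : AnalyticAt ℝ f 0) (π : E →L[ℝ] E) (e : E) (ℓ : E →L[ℝ] ℝ)
    (h : ∀ x, x - π x = ℓ x • e) :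
    ∃ g : E → ℝ, AnalyticAt ℝ g 0 ∧ ∀ᶠ x in 𝓝 0, f x = f (π x) + ℓ x * g x := by
  obtain ⟨p, r, hp⟩ := hf
  have hpr : 0 < p.radius := lt_of_lt_of_le hp.r_pos hp.r_le
  have hq := (hadSeries p π e).hasFPowerSeriesOnBall (hadSeries_radius p π e hpr)
  refine ⟨(hadSeries p π e).sum, hq.analyticAt, ?_⟩
  have n1 : ∀ᶠ x in 𝓝 (0:E), x ∈ Metric.eball (0:E) r := Metric.eball_mem_nhds _ hp.r_pos
  have n2 : ∀ᶠ x in 𝓝 (0:E), π x ∈ Metric.eball (0:E) r := by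
    have : Tendsto π (𝓝 0) (𝓝 0) := by simpa using π.continuous.tendsto 0
    exact this.eventually n1
  have n3 : ∀ᶠ x in 𝓝 (0:E), x ∈ Metric.eball (0:E) (hadSeries p π e).radius :=
    Metric.eball_mem_nhds _ hq.r_pos
  filter_upwards [n1, n2, n3] with x h1 h2 h3
  have s1 := hp.hasSum h1
  have s2 := hp.hasSum h2
  have s3 := (hq.hasSum h3).mul_left (ℓ x)
  simp only [zero_add] at s1 s2 s3
  have s4 := s1.sub s2
  have z : p 0 (fun _ => x) - p 0 (fun _ => π x) = 0 := by
    rw [sub_eq_zero]; congr 1; ext i; exact i.elim0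
  have s5 := (hasSum_nat_add_iff' 1).2 s4
  simp only [Finset.range_one, Finset.sum_singleton, z, sub_zero] at s5
  have := s5.unique (by simpa only [hadSeries_apply p π e ℓ h] using s3)
  linarith

end Hadamard

lemma germ_mul_eq_zero {E : Type*} [NormedAddCommGroup E] [NormedSpace ℝ E] {g h : E → ℝ}
    (hg : AnalyticAt ℝ g 0) (hh : AnalyticAt ℝ h 0) (H : ∀ᶠ x in 𝓝 0, g x * h x = 0) :
    (∀ᶠ x in 𝓝 0, g x = 0) ∨ (∀ᶠ x in 𝓝 0, h x = 0) := by
  have ev := hg.eventually_analyticAt.and (hh.eventually_analyticAt.and H)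
  obtain ⟨ε, hε, hB⟩ := Metric.eventually_nhds_iff_ball.1 ev
  by_cases hz : ∀ x ∈ Metric.ball (0:E) ε, g x = 0
  · left
    exact Metric.eventually_nhds_iff_ball.2 ⟨ε, hε, hz⟩
  · right
    push Not at hz
    obtain ⟨x, hx, hgx⟩ := hz
    have han : AnalyticOnNhd ℝ h (Metric.ball 0 ε) := fun y hy => (hB y hy).2.1
    have h0 : h =ᶠ[𝓝 x] 0 := by
      have c : ∀ᶠ y in 𝓝 x, g y ≠ 0 := (hB x hx).1.continuousAt.eventually_ne hgx
      filter_upwards [c, Metric.isOpen_ball.mem_nhds hx] with y hy hyB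
      have := (hB y hyB).2.2
      simpa [hy] using this
    have := han.eqOn_zero_of_preconnected_of_eventuallyEq_zero
      (convex_ball (0:E) ε).isPreconnected hx h0
    exact Metric.eventually_nhds_iff_ball.2 ⟨ε, hε, this⟩

lemma germ_prod_eq_zero {E : Type*} [NormedAddCommGroup E] [NormedSpace ℝ E] {J : Type*}
    (s : Finset J) (g : J → E → ℝ)
    (hg : ∀ j ∈ s, AnalyticAt ℝ (g j) 0) (H : ∀ᶠ x in 𝓝 0, ∏ j ∈ s, g j x = 0) :
    ∃ j ∈ s, ∀ᶠ x in 𝓝 0, g j x = 0 := by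
  classical
  induction s using Finset.induction_on with
  | empty => simpa using H.exists
  | insert a s ha ih =>
    simp only [Finset.prod_insert ha] at H
    rcases germ_mul_eq_zero (hg a (by simp))
      (Finset.analyticAt_fun_prod s (fun j hj => hg j (by simp [hj]))) H with h | h
    · exact ⟨a, by simp, h⟩
    · obtain ⟨j, hj, h⟩ := ih (fun j hj => hg j (by simp [hj])) h
      exact ⟨j, by simp [hj], h⟩

section NC
variable {κ κ' : Type} [Fintype κ] [Fintype κ']

def FP (κ : Type) [Fintype κ] : Filter (κ → ℝ) := 𝓝[{v | ∀ i, 0 < v i}] 0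

lemma FP_le : FP κ ≤ 𝓝 0 := nhdsWithin_le_nhds

lemma FP_pos : ∀ᶠ v in FP κ, ∀ i, 0 < v i := eventually_mem_nhdsWithin

lemma tendsto_FP {J : Type*} {l : Filter J} {f : J → κ → ℝ} :
    Tendsto f l (FP κ) ↔ Tendsto f l (𝓝 0) ∧ ∀ᶠ t in l, ∀ i, 0 < f t i :=
  tendsto_nhdsWithin_iff

instance FP_neBot : (FP κ).NeBot := by
  have h1 : Tendsto (fun t : ℝ => fun _ : κ => t) (𝓝[>] 0) (FP κ) := by
    refine tendsto_FP.2 ⟨tendsto_pi_nhds.2 fun i => ?_, ?_⟩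
    · exact tendsto_nhdsWithin_of_tendsto_nhds tendsto_id
    · filter_upwards [self_mem_nhdsWithin] with t ht i using ht
  exact h1.neBot

/-- Monomial. -/
def mono (α : κ → ℕ) (v : κ → ℝ) : ℝ := ∏ i, v i ^ α i

lemma mono_pos (α : κ → ℕ) {v : κ → ℝ} (h : ∀ i, 0 < v i) : 0 < mono α v :=
  Finset.prod_pos fun i _ => pow_pos (h i) _

lemma mono_add (α β : κ → ℕ) (v : κ → ℝ) : mono (α + β) v = mono α v * mono β v := by
  simp [mono, pow_add, Finset.prod_mul_distrib]

@[simp] lemma mono_zero (v : κ → ℝ) : mono 0 v = 1 := by simp [mono]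

lemma mono_single [DecidableEq κ] (i : κ) (v : κ → ℝ) : mono (Pi.single i 1) v = v i := by
  simp [mono, Pi.single_apply]

lemma mono_smul (n : ℕ) (α : κ → ℕ) (v : κ → ℝ) : mono (n • α) v = mono α v ^ n := by
  simp [mono, ← Finset.prod_pow, ← pow_mul, mul_comm]

lemma analyticAt_coord (i : κ) (x : κ → ℝ) : AnalyticAt ℝ (fun v : κ → ℝ => v i) x :=
  (ContinuousLinearMap.proj (R := ℝ) (φ := fun _ : κ => ℝ) i).analyticAt x

lemma analyticAt_mono (α : κ → ℕ) (x : κ → ℝ) : AnalyticAt ℝ (mono α) x := by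
  unfold mono
  exact Finset.analyticAt_fun_prod _ fun i _ => (analyticAt_coord i x).pow _

/-- normal crossing with explicit exponent -/
def NN (α : κ → ℕ) (f : (κ → ℝ) → ℝ) : Prop :=
  ∃ u : (κ → ℝ) → ℝ, AnalyticAt ℝ u 0 ∧ u 0 ≠ 0 ∧ ∀ᶠ v in 𝓝 0, f v = mono α v * u v

/-- positive normal crossing with explicit exponent -/
def PN (α : κ → ℕ) (f : (κ → ℝ) → ℝ) : Prop :=
  ∃ u : (κ → ℝ) → ℝ, AnalyticAt ℝ u 0 ∧ 0 < u 0 ∧ ∀ᶠ v in 𝓝 0, f v = mono α v * u v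

def NC (f : (κ → ℝ) → ℝ) : Prop := ∃ α, NN α f

def NC0 (f : (κ → ℝ) → ℝ) : Prop := (∀ᶠ v in 𝓝 0, f v = 0) ∨ NC f

lemma PN.NN {α : κ → ℕ} {f : (κ → ℝ) → ℝ} (h : PN α f) : NN α f := by
  obtain ⟨u, h1, h2, h3⟩ := h; exact ⟨u, h1, h2.ne', h3⟩

lemma NN.congr {α : κ → ℕ} {f g : (κ → ℝ) → ℝ} (h : NN α f) (e : ∀ᶠ v in 𝓝 0, g v = f v) :
    NN α g := by
  obtain ⟨u, h1, h2, h3⟩ := h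
  exact ⟨u, h1, h2, by filter_upwards [h3, e] with v a b; rw [b, a]⟩

lemma PN.congr {α : κ → ℕ} {f g : (κ → ℝ) → ℝ} (h : PN α f) (e : ∀ᶠ v in 𝓝 0, g v = f v) :
    PN α g := by
  obtain ⟨u, h1, h2, h3⟩ := h
  exact ⟨u, h1, h2, by filter_upwards [h3, e] with v a b; rw [b, a]⟩

lemma NC.congr {f g : (κ → ℝ) → ℝ} (h : NC f) (e : ∀ᶠ v in 𝓝 0, g v = f v) : NC g := by
  obtain ⟨α, h⟩ := h; exact ⟨α, h.congr e⟩

lemma NC0.congr {f g : (κ → ℝ) → ℝ} (h : NC0 f) (e : ∀ᶠ v in 𝓝 0, g v = f v) : NC0 g := by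
  rcases h with h | h
  · left; filter_upwards [h, e] with v a b; rw [b, a]
  · right; exact h.congr e

lemma NN.analyticAt {α : κ → ℕ} {f : (κ → ℝ) → ℝ} (h : NN α f) : AnalyticAt ℝ f 0 := by
  obtain ⟨u, h1, h2, h3⟩ := h
  exact ((analyticAt_mono α 0).mul h1).congr (by filter_upwards [h3] with v a; rw [a]; rfl)

lemma NN.mul {α β : κ → ℕ} {f g : (κ → ℝ) → ℝ} (h : NN α f) (h' : NN β g) :
    NN (α + β) (fun v => f v * g v) := by
  obtain ⟨u, h1, h2, h3⟩ := h
  obtain ⟨u', h1', h2', h3'⟩ := h'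
  refine ⟨fun v => u v * u' v, h1.mul h1', mul_ne_zero h2 h2', ?_⟩
  filter_upwards [h3, h3'] with v a b
  rw [a, b, mono_add]; ring

lemma PN.mul {α β : κ → ℕ} {f g : (κ → ℝ) → ℝ} (h : PN α f) (h' : PN β g) :
    PN (α + β) (fun v => f v * g v) := by
  obtain ⟨u, h1, h2, h3⟩ := h
  obtain ⟨u', h1', h2', h3'⟩ := h'
  refine ⟨fun v => u v * u' v, h1.mul h1', mul_pos h2 h2', ?_⟩
  filter_upwards [h3, h3'] with v a b
  rw [a, b, mono_add]; ring

lemma PN.pow {α : κ → ℕ} {f : (κ → ℝ) → ℝ} (h : PN α f) (n : ℕ) :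
    PN (n • α) (fun v => f v ^ n) := by
  obtain ⟨u, h1, h2, h3⟩ := h
  refine ⟨fun v => u v ^ n, h1.pow n, pow_pos h2 n, ?_⟩
  filter_upwards [h3] with v a
  rw [a, mono_smul]; ring

lemma PN.prod {J : Type*} (s : Finset J) {α : J → κ → ℕ} {f : J → (κ → ℝ) → ℝ}
    (h : ∀ j ∈ s, PN (α j) (f j)) : PN (∑ j ∈ s, α j) (fun v => ∏ j ∈ s, f j v) := by
  classical
  induction s using Finset.induction_on with
  | empty => exact ⟨fun _ => 1, analyticAt_const, one_pos, by simp⟩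
  | insert a s ha ih =>
    simp only [Finset.sum_insert ha, Finset.prod_insert ha]
    exact (h a (by simp)).mul (ih fun j hj => h j (by simp [hj]))

lemma PN_unit {u : (κ → ℝ) → ℝ} (h : AnalyticAt ℝ u 0) (h0 : 0 < u 0) : PN 0 u :=
  ⟨u, h, h0, by simp⟩

lemma NN_unit {u : (κ → ℝ) → ℝ} (h : AnalyticAt ℝ u 0) (h0 : u 0 ≠ 0) : NN 0 u :=
  ⟨u, h, h0, by simp⟩

lemma PN_mono (α : κ → ℕ) : PN α (mono α) :=
  ⟨fun _ => 1, analyticAt_const, one_pos, by simp⟩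

lemma PN_coord [DecidableEq κ] (i : κ) : PN (Pi.single i 1) (fun v : κ → ℝ => v i) :=
  ⟨fun _ => 1, analyticAt_const, one_pos, by simp [mono_single]⟩

lemma PN.pos {α : κ → ℕ} {f : (κ → ℝ) → ℝ} (h : PN α f) : ∀ᶠ v in FP κ, 0 < f v := by
  obtain ⟨u, h1, h2, h3⟩ := h
  have : ∀ᶠ v in 𝓝 (0 : κ → ℝ), 0 < u v := h1.continuousAt.eventually (lt_mem_nhds h2)
  filter_upwards [FP_le h3, FP_le this, FP_pos] with v a b c
  rw [a]; exact mul_pos (mono_pos _ c) b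

lemma NN.ne {α : κ → ℕ} {f : (κ → ℝ) → ℝ} (h : NN α f) : ∀ᶠ v in FP κ, f v ≠ 0 := by
  obtain ⟨u, h1, h2, h3⟩ := h
  have : ∀ᶠ v in 𝓝 (0 : κ → ℝ), u v ≠ 0 := h1.continuousAt.eventually_ne h2
  filter_upwards [FP_le h3, FP_le this, FP_pos] with v a b c
  rw [a]; exact mul_ne_zero (mono_pos _ c).ne' b

lemma NN.PN_or {α : κ → ℕ} {f : (κ → ℝ) → ℝ} (h : NN α f) : PN α f ∨ PN α (fun v => - f v) := by
  obtain ⟨u, h1, h2, h3⟩ := h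
  rcases lt_or_gt_of_ne h2 with h | h
  · right
    exact ⟨fun v => - u v, h1.neg, by simpa using h, by filter_upwards [h3] with v a; rw [a]; ring⟩
  · left; exact ⟨u, h1, h, h3⟩

lemma NN.PN_of_pos {α : κ → ℕ} {f : (κ → ℝ) → ℝ} (h : NN α f)
    (hf : ∃ᶠ v in FP κ, 0 < f v) : PN α f := by
  rcases h.PN_or with h | h
  · exact h
  · exfalso
    obtain ⟨v, h1, h2⟩ := (hf.and_eventually h.pos).exists
    linarith

/-- maps with positive normal crossing coordinates -/
def MonoMap (N : κ → κ' → ℕ) (Ψ : (κ' → ℝ) → κ → ℝ) : Prop := ∀ i, PN (N i) (fun v => Ψ v i)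

lemma MonoMap.analyticAt {N : κ → κ' → ℕ} {Ψ : (κ' → ℝ) → κ → ℝ} (h : MonoMap N Ψ) :
    AnalyticAt ℝ Ψ 0 := by
  rw [analyticAt_pi_iff]
  exact fun i => (h i).NN.analyticAt

lemma MonoMap.tendsto {N : κ → κ' → ℕ} {Ψ : (κ' → ℝ) → κ → ℝ} (h : MonoMap N Ψ) (h0 : Ψ 0 = 0) :
    Tendsto Ψ (FP κ') (FP κ) := by
  refine tendsto_FP.2 ⟨?_, ?_⟩
  · have := h.analyticAt.continuousAt.tendsto
    rw [h0] at this
    exact this.mono_left FP_le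
  · exact eventually_all.2 fun i => (h i).pos

/-- exponent transformation -/
def expo (N : κ → κ' → ℕ) (α : κ → ℕ) : κ' → ℕ := ∑ i, α i • N i

lemma PN_mono_comp {N : κ → κ' → ℕ} {Ψ : (κ' → ℝ) → κ → ℝ} (h : MonoMap N Ψ) (α : κ → ℕ) :
    PN (expo N α) (fun v => mono α (Ψ v)) :=
  PN.prod Finset.univ fun i _ => (h i).pow (α i)

lemma MonoMap.tendsto_nhds {N : κ → κ' → ℕ} {Ψ : (κ' → ℝ) → κ → ℝ} (h : MonoMap N Ψ)
    (h0 : Ψ 0 = 0) : Tendsto Ψ (𝓝 0) (𝓝 0) := by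
  have := h.analyticAt.continuousAt.tendsto
  rwa [h0] at this

lemma analyticAt_comp0 {E F : Type*} [NormedAddCommGroup E] [NormedSpace ℝ E]
    [NormedAddCommGroup F] [NormedSpace ℝ F] {G : Type*} [NormedAddCommGroup G] [NormedSpace ℝ G]
    {f : F → G} {g : E → F} (hf : AnalyticAt ℝ f 0)
    (hg : AnalyticAt ℝ g 0) (h0 : g 0 = 0) : AnalyticAt ℝ (fun x => f (g x)) 0 := by
  rw [← h0] at hf
  exact hf.comp hg

lemma PN.comp {N : κ → κ' → ℕ} {Ψ : (κ' → ℝ) → κ → ℝ} {α : κ → ℕ} {f : (κ → ℝ) → ℝ}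
    (hf : PN α f) (h : MonoMap N Ψ) (h0 : Ψ 0 = 0) : PN (expo N α) (fun v => f (Ψ v)) := by
  obtain ⟨u, h1, h2, h3⟩ := hf
  have := (PN_mono_comp h α).mul (PN_unit (u := fun v => u (Ψ v))
    (analyticAt_comp0 h1 h.analyticAt h0) (by simpa [h0] using h2))
  rw [add_zero] at this
  exact this.congr ((h.tendsto_nhds h0).eventually h3)

lemma NN.comp {N : κ → κ' → ℕ} {Ψ : (κ' → ℝ) → κ → ℝ} {α : κ → ℕ} {f : (κ → ℝ) → ℝ}
    (hf : NN α f) (h : MonoMap N Ψ) (h0 : Ψ 0 = 0) : NN (expo N α) (fun v => f (Ψ v)) := by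
  obtain ⟨u, h1, h2, h3⟩ := hf
  have := (PN_mono_comp h α).NN.mul (NN_unit (u := fun v => u (Ψ v))
    (analyticAt_comp0 h1 h.analyticAt h0) (by simpa [h0] using h2))
  rw [add_zero] at this
  exact this.congr ((h.tendsto_nhds h0).eventually h3)

lemma NC.comp {N : κ → κ' → ℕ} {Ψ : (κ' → ℝ) → κ → ℝ} {f : (κ → ℝ) → ℝ}
    (hf : NC f) (h : MonoMap N Ψ) (h0 : Ψ 0 = 0) : NC (fun v => f (Ψ v)) := by
  obtain ⟨α, hf⟩ := hf
  exact ⟨_, hf.comp h h0⟩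

lemma NC0.comp {N : κ → κ' → ℕ} {Ψ : (κ' → ℝ) → κ → ℝ} {f : (κ → ℝ) → ℝ}
    (hf : NC0 f) (h : MonoMap N Ψ) (h0 : Ψ 0 = 0) : NC0 (fun v => f (Ψ v)) := by
  rcases hf with hf | hf
  · exact Or.inl ((h.tendsto_nhds h0).eventually hf)
  · exact Or.inr (hf.comp h h0)

lemma MonoMap.comp {κ'' : Type} [Fintype κ''] {N : κ → κ' → ℕ} {Ψ : (κ' → ℝ) → κ → ℝ}
    {N' : κ' → κ'' → ℕ} {Ψ' : (κ'' → ℝ) → κ' → ℝ} (h : MonoMap N Ψ) (h' : MonoMap N' Ψ')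
    (h0' : Ψ' 0 = 0) : MonoMap (fun i => expo N' (N i)) (fun v => Ψ (Ψ' v)) :=
  fun i => (h i).comp h' h0'

lemma coord_not_zero (i : κ) : ¬ ∀ᶠ v in 𝓝 (0 : κ → ℝ), v i = 0 := by
  intro h
  obtain ⟨v, h1, h2⟩ := ((h.filter_mono FP_le).and (FP_pos (κ := κ))).exists
  exact (h2 i).ne' h1

lemma factor_aux (n : ℕ) : ∀ (α : κ → ℕ), (∑ i, α i) = n → ∀ (g h u : (κ → ℝ) → ℝ),
    AnalyticAt ℝ g 0 → AnalyticAt ℝ h 0 → AnalyticAt ℝ u 0 → u 0 ≠ 0 →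
    (∀ᶠ v in 𝓝 0, g v * h v = mono α v * u v) → NC g := by
  classical
  induction n with
  | zero =>
    intro α hα g h u hg hh hu hu0 H
    have hα0 : α = 0 := by
      ext i
      simpa using (Finset.sum_eq_zero_iff.1 hα) i (Finset.mem_univ _)
    subst hα0
    have := H.self_of_nhds
    rw [mono_zero, one_mul] at this
    refine ⟨0, NN_unit hg ?_⟩
    intro h0
    rw [h0, zero_mul] at this
    exact hu0 this.symm
  | succ n ih =>
    intro α hα g h u hg hh hu hu0 H
    obtain ⟨i, hi⟩ : ∃ i, α i ≠ 0 := by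
      by_contra hcon
      push Not at hcon
      simp [hcon] at hα
    obtain ⟨β, hβ⟩ : ∃ β : κ → ℕ, α = Pi.single i 1 + β := by
      refine ⟨α - Pi.single i 1, ?_⟩
      ext j
      by_cases hj : j = i
      · subst hj; simp; omega
      · simp [hj]
    have hβn : ∑ j, β j = n := by
      rw [hβ] at hα
      simp [Finset.sum_add_distrib] at hα
      omega
    let π : (κ → ℝ) →L[ℝ] (κ → ℝ) := ContinuousLinearMap.id ℝ _ -
      (ContinuousLinearMap.proj (R := ℝ) (φ := fun _ : κ => ℝ) i).smulRight (Pi.single i 1)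
    have hπi : ∀ x, π x i = 0 := by intro x; simp [π]
    have hπ : ∀ x, x - π x = (ContinuousLinearMap.proj (R := ℝ) (φ := fun _ : κ => ℝ) i) x •
      (Pi.single i 1 : κ → ℝ) := by intro x; simp [π]
    have hπt : Tendsto π (𝓝 0) (𝓝 0) := by simpa using π.continuous.tendsto 0
    have h0 : ∀ᶠ v in 𝓝 0, g (π v) * h (π v) = 0 := by
      filter_upwards [hπt.eventually H] with v hv
      rw [hv, hβ, mono_add, mono_single, hπi]; ring
    have dg := hadamard hg π _ _ hπ
    have dh := hadamard hh π _ _ hπ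
    have cancel : ∀ F G : (κ → ℝ) → ℝ, AnalyticAt ℝ F 0 → AnalyticAt ℝ G 0 →
        (∀ᶠ v in 𝓝 0, v i * F v = v i * G v) → ∀ᶠ v in 𝓝 0, F v = G v := by
      intro F G hF hG hFG
      have : ∀ᶠ v in 𝓝 (0 : κ → ℝ), v i * (F v - G v) = 0 := by
        filter_upwards [hFG] with v hv
        rw [mul_sub, hv, sub_self]
      rcases germ_mul_eq_zero (analyticAt_coord i 0) (hF.sub hG) this with h | h
      · exact absurd h (coord_not_zero i)
      · filter_upwards [h] with v hv
        simpa [sub_eq_zero] using hv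
    rcases germ_mul_eq_zero (analyticAt_comp0 hg (π.analyticAt 0) (map_zero π))
      (analyticAt_comp0 hh (π.analyticAt 0) (map_zero π)) h0 with hz | hz
    · obtain ⟨g1, hg1, e1⟩ := dg
      have e2 : ∀ᶠ v in 𝓝 0, g1 v * h v = mono β v * u v := by
        refine cancel _ _ (hg1.mul hh) ((analyticAt_mono β 0).mul hu) ?_
        filter_upwards [e1, hz, H] with v a b c
        rw [a, b, zero_add, hβ, mono_add, mono_single] at c
        simp only [ContinuousLinearMap.proj_apply] at c
        rw [← mul_assoc, c]; ring
      obtain ⟨γ, hγ⟩ := ih β hβn g1 h u hg1 hh hu hu0 e2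
      refine ⟨_, ((PN_coord i).NN.mul hγ).congr ?_⟩
      filter_upwards [e1, hz] with v a b
      rw [a, b, zero_add]; rfl
    · obtain ⟨h1, hh1, e1⟩ := dh
      have e2 : ∀ᶠ v in 𝓝 0, g v * h1 v = mono β v * u v := by
        refine cancel _ _ (hg.mul hh1) ((analyticAt_mono β 0).mul hu) ?_
        filter_upwards [e1, hz, H] with v a b c
        rw [a, b, zero_add, hβ, mono_add, mono_single] at c
        simp only [ContinuousLinearMap.proj_apply] at c
        linarith
      exact ih β hβn g h1 u hg hh1 hu hu0 e2

theorem NC_factor {g h : (κ → ℝ) → ℝ} (hg : AnalyticAt ℝ g 0) (hh : AnalyticAt ℝ h 0)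
    (H : NC (fun v => g v * h v)) : NC g := by
  obtain ⟨α, u, h1, h2, h3⟩ := H
  exact factor_aux _ α rfl g h u hg hh h1 h2 h3

end NC

section DD
variable {E : Type*} [NormedAddCommGroup E] [NormedSpace ℝ E]

/-- derivative in the last variable -/
noncomputable def D (f : E × ℝ → ℝ) : E × ℝ → ℝ := fun p => fderiv ℝ f p (0, 1)

lemma D_an {f : E × ℝ → ℝ} {p : E × ℝ} (h : AnalyticAt ℝ f p) : AnalyticAt ℝ (D f) p :=
  (ContinuousLinearMap.analyticAt (ContinuousLinearMap.apply ℝ ℝ ((0, 1) : E × ℝ)) _).comp h.fderiv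

lemma Dit_an {f : E × ℝ → ℝ} {p : E × ℝ} (h : AnalyticAt ℝ f p) (j : ℕ) :
    AnalyticAt ℝ (D^[j] f) p := by
  induction j with
  | zero => simpa using h
  | succ j ih => rw [Function.iterate_succ_apply']; exact D_an ih

lemma D_congr {f g : E × ℝ → ℝ} {p : E × ℝ} (h : f =ᶠ[𝓝 p] g) : D f =ᶠ[𝓝 p] D g := by
  filter_upwards [h.fderiv (𝕜 := ℝ)] with q hq
  simp [D, hq]

lemma Dit_congr {f g : E × ℝ → ℝ} {p : E × ℝ} (h : f =ᶠ[𝓝 p] g) (j : ℕ) :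
    D^[j] f =ᶠ[𝓝 p] D^[j] g := by
  induction j with
  | zero => simpa using h
  | succ j ih => rw [Function.iterate_succ_apply', Function.iterate_succ_apply']; exact D_congr ih

lemma ev_diff {F G : Type*} [NormedAddCommGroup F] [NormedSpace ℝ F] [NormedAddCommGroup G]
    [NormedSpace ℝ G] [CompleteSpace G] {f : F → G} {p : F} (h : AnalyticAt ℝ f p) :
    ∀ᶠ q in 𝓝 p, DifferentiableAt ℝ f q :=
  h.eventually_analyticAt.mono fun _ hq => hq.differentiableAt

lemma D_fst_add {g : E × ℝ → ℝ} {a : E → ℝ} (ha : AnalyticAt ℝ a 0) (hg : AnalyticAt ℝ g 0) :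
    D (fun p => a p.1 + g p) =ᶠ[𝓝 0] D g := by
  have t : Tendsto (fun p : E × ℝ => p.1) (𝓝 0) (𝓝 0) := continuous_fst.tendsto 0
  filter_upwards [t.eventually (ev_diff ha), ev_diff hg] with p h1 h2
  have h3 : HasFDerivAt (fun p : E × ℝ => a p.1)
      ((fderiv ℝ a p.1).comp (ContinuousLinearMap.fst ℝ E ℝ)) p :=
    h1.hasFDerivAt.comp p hasFDerivAt_fst
  have h4 := (h3.add h2.hasFDerivAt).fderiv
  unfold D
  change fderiv ℝ ((fun p : E × ℝ => a p.1) + g) p (0,1) = _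
  rw [h4]
  simp

lemma D_mul {g : E × ℝ → ℝ} (hg : AnalyticAt ℝ g 0) :
    D (fun p => p.2 * g p) =ᶠ[𝓝 0] fun p => p.2 * D g p + g p := by
  filter_upwards [ev_diff hg] with p h2
  have h3 : HasFDerivAt (fun p : E × ℝ => p.2) (ContinuousLinearMap.snd ℝ E ℝ) p := hasFDerivAt_snd
  have h4 := (h3.mul h2.hasFDerivAt).fderiv
  unfold D
  change fderiv ℝ ((fun p : E × ℝ => p.2) * g) p (0,1) = _
  rw [h4]
  simp

lemma D_add_smul {f g : E × ℝ → ℝ} (hf : AnalyticAt ℝ f 0) (hg : AnalyticAt ℝ g 0) (c : ℝ) :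
    D (fun p => f p + c * g p) =ᶠ[𝓝 0] fun p => D f p + c * D g p := by
  filter_upwards [ev_diff hg, ev_diff hf] with p h2 h3
  have h4 := (h3.hasFDerivAt.add (h2.hasFDerivAt.const_mul c)).fderiv
  unfold D
  change fderiv ℝ (f + fun p => c * g p) p (0,1) = _
  rw [h4]
  simp

lemma Dit_mul {g : E × ℝ → ℝ} (hg : AnalyticAt ℝ g 0) (j : ℕ) :
    D^[j+1] (fun p => p.2 * g p) =ᶠ[𝓝 0] fun p => p.2 * D^[j+1] g p + (j+1) * D^[j] g p := by
  induction j with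
  | zero => simpa using D_mul hg
  | succ j ih =>
    rw [Function.iterate_succ_apply']
    have a2 : AnalyticAt ℝ (fun p : E × ℝ => p.2) 0 := analyticAt_snd
    have h1 := D_congr ih
    have h2 := D_add_smul (a2.mul (Dit_an hg (j+1))) (Dit_an hg j) (j+1)
    have h3 := D_mul (Dit_an hg (j+1))
    refine h1.trans (h2.trans ?_)
    filter_upwards [h3] with p hp
    change D (fun p : E × ℝ => p.2 * (D^[j+1] g) p) p + _ = _
    rw [hp]
    simp only [Function.iterate_succ_apply']
    push_cast; ring

lemma Dit_expand {f g : E × ℝ → ℝ} {a : E → ℝ} (ha : AnalyticAt ℝ a 0) (hg : AnalyticAt ℝ g 0)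
    (h : ∀ᶠ p in 𝓝 0, f p = a p.1 + p.2 * g p) (j : ℕ) :
    D^[j+1] f =ᶠ[𝓝 0] fun p => p.2 * D^[j+1] g p + (j+1) * D^[j] g p := by
  refine EventuallyEq.trans ?_ (Dit_mul hg j)
  rw [Function.iterate_succ_apply, Function.iterate_succ_apply]
  refine Dit_congr ?_ j
  have a2 : AnalyticAt ℝ (fun p : E × ℝ => p.2) 0 := analyticAt_snd
  exact (D_congr h).trans (D_fst_add ha (a2.mul hg))

lemma tendsto_inl : Tendsto (fun x : E => ((x, 0) : E × ℝ)) (𝓝 0) (𝓝 0) := by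
  have : Continuous (fun x : E => ((x, 0) : E × ℝ)) := by fun_prop
  exact this.tendsto' _ _ rfl

lemma an_inl : AnalyticAt ℝ (fun x : E => ((x, 0) : E × ℝ)) 0 :=
  AnalyticAt.prod analyticAt_id analyticAt_const

theorem taylor (k : ℕ) : ∀ f : E × ℝ → ℝ, AnalyticAt ℝ f 0 →
    ∃ (a : ℕ → E → ℝ) (U : E × ℝ → ℝ), (∀ j, AnalyticAt ℝ (a j) 0) ∧ AnalyticAt ℝ U 0 ∧
    (∀ᶠ p in 𝓝 0, f p = ∑ j ∈ Finset.range k, a j p.1 * p.2 ^ j + p.2 ^ k * U p) ∧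
    (∀ j < k, ∀ᶠ x in 𝓝 0, D^[j] f (x, 0) = j.factorial * a j x) ∧
    D^[k] f 0 = k.factorial * U 0 := by
  induction k with
  | zero =>
    intro f hf
    exact ⟨fun _ _ => 0, f, fun _ => analyticAt_const, hf, by simp, by simp, by simp⟩
  | succ k ih =>
    intro f hf
    let π : E × ℝ →L[ℝ] E × ℝ := (ContinuousLinearMap.fst ℝ E ℝ).prod 0
    obtain ⟨g, hg, e⟩ := hadamard hf π (0, 1) (ContinuousLinearMap.snd ℝ E ℝ)
      (by rintro ⟨x, t⟩; simp [π])
    obtain ⟨a, U, ha, hU, h1, h2, h3⟩ := ih g hg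
    have ha0 : AnalyticAt ℝ (fun x : E => f (x, 0)) 0 := analyticAt_comp0 hf an_inl rfl
    have e' : ∀ᶠ p in 𝓝 (0 : E × ℝ), f p = (fun x => f (x, 0)) p.1 + p.2 * g p := by
      filter_upwards [e] with p hp
      simpa [π] using hp
    have key := Dit_expand ha0 hg e'
    refine ⟨fun j => Nat.casesOn j (fun x => f (x, 0)) a, U, ?_, hU, ?_, ?_, ?_⟩
    · rintro (_ | j)
      · exact ha0
      · exact ha j
    · filter_upwards [e', h1] with p hp hp1
      rw [hp, hp1, Finset.sum_range_succ']
      simp only [mul_add, Finset.mul_sum, pow_zero, mul_one]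
      have : ∀ j ∈ Finset.range k, p.2 * (a j p.1 * p.2 ^ j) = a j p.1 * p.2 ^ (j+1) := by
        intro j _; ring
      rw [Finset.sum_congr rfl this]
      change _ = _ + f (p.1, 0) + _
      ring
    · rintro (_ | j) hj
      · simp
      · filter_upwards [tendsto_inl.eventually (key j), h2 j (by omega)] with x hx hx2
        rw [hx, hx2]
        simp [Nat.factorial_succ]; ring
    · rw [(key k).self_of_nhds]
      simp only [h3]
      simp [Nat.factorial_succ]; ring

lemma D_shift {f : E × ℝ → ℝ} (hf : AnalyticAt ℝ f 0) {φ : E → ℝ} (hφ : AnalyticAt ℝ φ 0)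
    (h0 : φ 0 = 0) :
    D (fun p => f (p.1, p.2 + φ p.1)) =ᶠ[𝓝 0] fun p => D f (p.1, p.2 + φ p.1) := by
  have t : Tendsto (fun p : E × ℝ => p.1) (𝓝 0) (𝓝 0) := continuous_fst.tendsto 0
  have aφ : AnalyticAt ℝ (fun p : E × ℝ => φ p.1) 0 :=
    analyticAt_comp0 hφ analyticAt_fst rfl
  have as : AnalyticAt ℝ (fun p : E × ℝ => (p.1, p.2 + φ p.1)) 0 :=
    AnalyticAt.prod analyticAt_fst (analyticAt_snd.add aφ)
  have ts : Tendsto (fun p : E × ℝ => (p.1, p.2 + φ p.1)) (𝓝 0) (𝓝 0) := by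
    have := as.continuousAt.tendsto
    simp only [Prod.fst_zero, Prod.snd_zero, h0, add_zero] at this
    exact this
  filter_upwards [t.eventually (ev_diff hφ), ts.eventually (ev_diff hf)] with p h1 h2
  have h3 : HasFDerivAt (fun p : E × ℝ => φ p.1)
      ((fderiv ℝ φ p.1).comp (ContinuousLinearMap.fst ℝ E ℝ)) p :=
    h1.hasFDerivAt.comp p hasFDerivAt_fst
  have h4 : HasFDerivAt (fun p : E × ℝ => (p.1, p.2 + φ p.1)) _ p :=
    hasFDerivAt_fst.prodMk (hasFDerivAt_snd.add h3)
  have h5 := (h2.hasFDerivAt.comp p h4).fderiv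
  unfold D
  change fderiv ℝ (f ∘ (fun p : E × ℝ => (p.1, p.2 + φ p.1))) p (0,1) = _
  rw [h5]
  simp

lemma shift_an {φ : E → ℝ} (hφ : AnalyticAt ℝ φ 0) :
    AnalyticAt ℝ (fun p : E × ℝ => (p.1, p.2 + φ p.1)) 0 :=
  AnalyticAt.prod analyticAt_fst (analyticAt_snd.add (analyticAt_comp0 hφ analyticAt_fst rfl))

lemma Dit_shift {f : E × ℝ → ℝ} (hf : AnalyticAt ℝ f 0) {φ : E → ℝ} (hφ : AnalyticAt ℝ φ 0)
    (h0 : φ 0 = 0) (j : ℕ) :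
    D^[j] (fun p => f (p.1, p.2 + φ p.1)) =ᶠ[𝓝 0] fun p => D^[j] f (p.1, p.2 + φ p.1) := by
  induction j with
  | zero => simp
  | succ j ih =>
    rw [Function.iterate_succ_apply', Function.iterate_succ_apply']
    exact (D_congr ih).trans (D_shift (Dit_an hf j) hφ h0)

open scoped ContDiff in
theorem ift [CompleteSpace E] {g : E × ℝ → ℝ} (hg : AnalyticAt ℝ g 0) (g0 : g 0 = 0)
    (hD : D g 0 ≠ 0) :
    ∃ φ : E → ℝ, AnalyticAt ℝ φ 0 ∧ φ 0 = 0 ∧ ∀ᶠ x in 𝓝 0, g (x, φ x) = 0 := by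
  have cd : ContDiffAt ℝ ω g 0 := hg.contDiffAt
  have hinv : (fderiv ℝ g 0 ∘L .inr ℝ E ℝ).IsInvertible := by
    refine ⟨ContinuousLinearEquiv.unitsEquivAut ℝ (Units.mk0 _ hD), ?_⟩
    ext
    simp [D]
  refine ⟨cd.implicitFunction (by simp) hinv, ?_, ?_, ?_⟩
  · have := cd.contDiffAt_implicitFunction (by simp) hinv
    exact this.analyticAt
  · exact cd.implicitFunction_apply_self (by simp) hinv
  · have := cd.eventually_apply_implicitFunction (by simp) hinv
    rw [g0] at this
    exact this

theorem exists_reg {f : E × ℝ → ℝ} (hf : AnalyticAt ℝ f 0)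
    (hz : ¬ ∀ᶠ t in 𝓝 (0:ℝ), f (0, t) = 0) : ∃ k, D^[k] f 0 ≠ 0 := by
  by_contra hcon
  push Not at hcon
  have han : AnalyticAt ℝ (fun t : ℝ => f (0, t)) 0 :=
    analyticAt_comp0 hf (AnalyticAt.prod analyticAt_const analyticAt_id) rfl
  obtain ⟨n, g, hg, g0, e⟩ := han.exists_eventuallyEq_pow_smul_nonzero_iff.2 hz
  obtain ⟨a, U, ha, hU, h1, h2, h3⟩ := taylor (n+1) f hf
  have ha0 : ∀ j < n+1, a j 0 = 0 := by
    intro j hj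
    have := (h2 j hj).self_of_nhds
    have h4 := hcon j
    rw [show ((0:E),(0:ℝ)) = 0 from rfl, h4] at this
    have : (j.factorial : ℝ) * a j 0 = 0 := this.symm
    rcases mul_eq_zero.1 this with h | h
    · exact absurd h (by exact_mod_cast j.factorial_ne_zero)
    · exact h
  have tr : Tendsto (fun t : ℝ => ((0:E), t)) (𝓝 0) (𝓝 0) := by
    have : Continuous (fun t : ℝ => ((0:E), t)) := by fun_prop
    exact this.tendsto' _ _ rfl
  have hh : ∀ᶠ t in 𝓝[≠] (0:ℝ), g t = t * U (0, t) := by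
    filter_upwards [nhdsWithin_le_nhds e, nhdsWithin_le_nhds (tr.eventually h1),
      self_mem_nhdsWithin] with t ht1 ht2 ht3
    rw [ht2] at ht1
    have : ∑ j ∈ Finset.range (n+1), a j ((0:E), t).1 * ((0:E), t).2 ^ j = 0 :=
      Finset.sum_eq_zero fun j hj => by
        simp [ha0 j (Finset.mem_range.1 hj)]
    rw [this] at ht1
    simp only [sub_zero, zero_add, smul_eq_mul, pow_succ, mul_assoc] at ht1
    exact (mul_left_cancel₀ (pow_ne_zero n ht3) ht1).symm
  have l1 : Tendsto g (𝓝[≠] 0) (𝓝 (g 0)) := hg.continuousAt.tendsto.mono_left nhdsWithin_le_nhds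
  have l2 : Tendsto (fun t : ℝ => t * U (0, t)) (𝓝[≠] 0) (𝓝 (0 * U 0)) := by
    refine Tendsto.mono_left ?_ nhdsWithin_le_nhds
    exact tendsto_id.mul (hU.continuousAt.tendsto.comp tr)
  have := tendsto_nhds_unique (l1.congr' hh) l2
  exact g0 (by simpa using this)

end DD

lemma poly_dvd (k : ℕ) : ∀ (P : Polynomial ℝ) (g : ℝ → ℝ), ContinuousAt g 0 →
    (∀ᶠ w in 𝓝[≠] (0:ℝ), P.eval w = w ^ k * g w) → Polynomial.X ^ k ∣ P := by
  induction k with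
  | zero => intro P g _ _; simp
  | succ k ih =>
    intro P g hg h
    have l1 : Tendsto (fun w => P.eval w) (𝓝[≠] 0) (𝓝 (P.eval 0)) :=
      P.continuous.continuousAt.tendsto.mono_left nhdsWithin_le_nhds
    have l2 : Tendsto (fun w : ℝ => w^(k+1) * g w) (𝓝[≠] 0) (𝓝 (0^(k+1) * g 0)) :=
      (((continuous_pow (k+1)).tendsto 0).mul hg.tendsto).mono_left nhdsWithin_le_nhds
    have h0 : P.eval 0 = 0 := by
      have := tendsto_nhds_unique (l1.congr' h) l2
      simpa using this
    obtain ⟨Q, rfl⟩ := (Polynomial.X_dvd_iff (f := P)).2 (by rwa [Polynomial.coeff_zero_eq_eval_zero])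
    have := ih Q g hg (by
      filter_upwards [h, self_mem_nhdsWithin] with w hw hw0
      rw [Polynomial.eval_mul, Polynomial.eval_X, pow_succ', mul_assoc] at hw
      exact mul_left_cancel₀ hw0 hw)
    rw [pow_succ']
    exact mul_dvd_mul_left _ this

section Charts
variable {I : Type} (𝒰 : Ultrafilter I)

lemma tricho (q : I → ℝ) : (∃ c, Tendsto q 𝒰 (𝓝 c)) ∨ Tendsto q 𝒰 atTop ∨ Tendsto q 𝒰 atBot := by
  by_cases h : ∃ M : ℝ, ∀ᶠ t in (𝒰 : Filter I), q t ∈ Icc (-M) M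
  · left
    obtain ⟨M, hM⟩ := h
    obtain ⟨c, _, hc⟩ := (isCompact_Icc (a := -M) (b := M)).ultrafilter_le_nhds (𝒰.map q)
      (by rw [le_principal_iff]; exact hM)
    exact ⟨c, hc⟩
  · right
    push Not at h
    by_cases hs : ∀ᶠ t in (𝒰 : Filter I), 0 ≤ q t
    · left
      refine tendsto_atTop.2 fun M => ?_
      have := h M
      filter_upwards [this, hs] with t h1 h2
      by_contra hc
      push Not at hc
      exact h1 ⟨by linarith, hc.le⟩
    · right
      have hs := Ultrafilter.eventually_not.2 hs
      refine tendsto_atBot.2 fun M => ?_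
      have := h (-M)
      filter_upwards [this, hs] with t h1 h2
      by_contra hc
      push Not at hc h2
      exact h1 ⟨by linarith, by linarith⟩

lemma sign_tricho (q : I → ℝ) : (∀ᶠ t in (𝒰 : Filter I), q t = 0) ∨
    (∀ᶠ t in (𝒰 : Filter I), 0 < q t) ∨ (∀ᶠ t in (𝒰 : Filter I), q t < 0) := by
  have : ∀ᶠ t in (𝒰 : Filter I), q t = 0 ∨ 0 < q t ∨ q t < 0 := by
    filter_upwards with t
    rcases lt_trichotomy (q t) 0 with h | h | h <;> simp [h]
  rw [Ultrafilter.eventually_or, Ultrafilter.eventually_or] at this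
  exact this

variable {E : Type*} [NormedAddCommGroup E] [NormedSpace ℝ E]
variable {κ κ' κ'' : Type} [Fintype κ] [Fintype κ'] [Fintype κ'']

structure Chart (x : I → E) (z : I → κ → ℝ) (Φ : (κ → ℝ) → E) : Prop where
  an : AnalyticAt ℝ Φ 0
  zero : Φ 0 = 0
  tz : Tendsto z 𝒰 (FP κ)
  eq : ∀ᶠ t in (𝒰 : Filter I), x t = Φ (z t)
  inj : ∃ s ∈ FP κ, InjOn Φ s

variable {𝒰}

lemma Chart.comp {x : I → E} {y : I → κ → ℝ} {z : I → κ' → ℝ} {Φ : (κ → ℝ) → E}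
    {Ψ : (κ' → ℝ) → κ → ℝ} (h : Chart 𝒰 x y Φ) (h' : Chart 𝒰 y z Ψ)
    (ht : Tendsto Ψ (FP κ') (FP κ)) : Chart 𝒰 x z (fun v => Φ (Ψ v)) where
  an := analyticAt_comp0 h.an h'.an h'.zero
  zero := by rw [h'.zero, h.zero]
  tz := h'.tz
  eq := by filter_upwards [h.eq, h'.eq] with t a b; rw [a, b]
  inj := by
    obtain ⟨s, hs, is⟩ := h.inj
    obtain ⟨s', hs', is'⟩ := h'.inj
    refine ⟨s' ∩ Ψ ⁻¹' s, inter_mem hs' (ht hs), ?_⟩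
    intro a ha b hb hab
    exact is' ha.1 hb.1 (is ha.2 hb.2 hab)

lemma NN.PN_of_chart {α : κ → ℕ} {f : (κ → ℝ) → ℝ} {z : I → κ → ℝ} (hf : NN α f)
    (hz : Tendsto z 𝒰 (FP κ)) (h : ∀ᶠ t in (𝒰 : Filter I), 0 < f (z t)) : PN α f :=
  hf.PN_of_pos (hz.frequently h.frequently)

/-- monomial chart -/
structure MChart (𝒰 : Ultrafilter I) (y : I → κ → ℝ) (z : I → κ' → ℝ) (N : κ → κ' → ℕ)
    (Ψ : (κ' → ℝ) → κ → ℝ) : Prop where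
  ch : Chart 𝒰 y z Ψ
  mono : MonoMap N Ψ

lemma MChart.tendsto {y : I → κ → ℝ} {z : I → κ' → ℝ} {N : κ → κ' → ℕ}
    {Ψ : (κ' → ℝ) → κ → ℝ} (h : MChart 𝒰 y z N Ψ) : Tendsto Ψ (FP κ') (FP κ) :=
  h.mono.tendsto h.ch.zero

lemma MChart.comp {y : I → κ → ℝ} {z : I → κ' → ℝ} {w : I → κ'' → ℝ} {N : κ → κ' → ℕ}
    {Ψ : (κ' → ℝ) → κ → ℝ} {N' : κ' → κ'' → ℕ} {Ψ' : (κ'' → ℝ) → κ' → ℝ}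
    (h : MChart 𝒰 y z N Ψ) (h' : MChart 𝒰 z w N' Ψ') :
    MChart 𝒰 y w (fun i => expo N' (N i)) (fun v => Ψ (Ψ' v)) :=
  ⟨h.ch.comp h'.ch h'.tendsto, h.mono.comp h'.mono h'.ch.zero⟩

def expoZ (N : κ → κ' → ℕ) (A : κ → ℤ) : κ' → ℤ := fun j => ∑ i, A i * N i j

lemma expo_apply (N : κ → κ' → ℕ) (α : κ → ℕ) (j : κ') : expo N α j = ∑ i, α i * N i j := by
  simp [expo]

lemma expoZ_comp (N : κ → κ' → ℕ) (N' : κ' → κ'' → ℕ) (A : κ → ℤ) :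
    expoZ (fun i => expo N' (N i)) A = expoZ N' (expoZ N A) := by
  ext l
  simp only [expoZ, expo_apply, Nat.cast_sum, Nat.cast_mul, Finset.mul_sum, Finset.sum_mul]
  rw [Finset.sum_comm]
  simp only [mul_assoc]

lemma expoZ_neg (N : κ → κ' → ℕ) (A : κ → ℤ) : expoZ N (-A) = - expoZ N A := by
  ext l; simp [expoZ]

lemma expoZ_nonneg (N : κ → κ' → ℕ) {A : κ → ℤ} (h : 0 ≤ A) : 0 ≤ expoZ N A :=
  fun _ => Finset.sum_nonneg fun i _ => mul_nonneg (h i) (by positivity)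

lemma expoZ_nonpos (N : κ → κ' → ℕ) {A : κ → ℤ} (h : A ≤ 0) : expoZ N A ≤ 0 :=
  fun _ => Finset.sum_nonpos fun i _ => mul_nonpos_of_nonpos_of_nonneg (h i) (by positivity)

lemma expoZ_id [DecidableEq κ] (A : κ → ℤ) :
    expoZ (fun i : κ => (Pi.single i 1 : κ → ℕ)) A = A := by
  ext j; simp [expoZ, Pi.single_apply]

lemma MChart.refl [DecidableEq κ] {y : I → κ → ℝ} (hy : Tendsto y 𝒰 (FP κ)) :
    MChart 𝒰 y y (fun i => Pi.single i 1) (fun v => v) where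
  ch := ⟨analyticAt_id, rfl, hy, by simp, univ, univ_mem, fun a _ b _ h => h⟩
  mono := fun i => PN_coord i

lemma chart_update [DecidableEq κ] {y : I → κ → ℝ} (hy : Tendsto y 𝒰 (FP κ)) {i j : κ} (hij : i ≠ j)
    (w : I → ℝ) (hw : Tendsto w 𝒰 (𝓝 0)) (hw0 : ∀ᶠ t in (𝒰 : Filter I), 0 < w t) (a b : ℝ)
    (hb : b ≠ 0) (ni nj : ℕ)
    (hpn : PN (Pi.single i ni + Pi.single j nj) (fun v : κ → ℝ => v j * (a + b * v i)))
    (e : ∀ᶠ t in (𝒰 : Filter I), y t i = y t j * (a + b * w t)) :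
    MChart 𝒰 y (fun t => Function.update (y t) i (w t))
      (fun l => if l = i then Pi.single i ni + Pi.single j nj else Pi.single l 1)
      (fun v => Function.update v i (v j * (a + b * v i))) := by
  have hm : MonoMap (fun l => if l = i then (Pi.single i ni + Pi.single j nj : κ → ℕ)
      else Pi.single l 1) (fun v : κ → ℝ => Function.update v i (v j * (a + b * v i))) := by
    intro l
    by_cases hl : l = i
    · subst hl; simpa using hpn
    · simpa [hl] using PN_coord l
  refine ⟨⟨hm.analyticAt, ?_, ?_, ?_, {v | ∀ i, 0 < v i}, FP_pos, ?_⟩, hm⟩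
  · ext l
    by_cases hl : l = i
    · subst hl; simp
    · simp [hl]
  · obtain ⟨h1, h2⟩ := tendsto_FP.1 hy
    refine tendsto_FP.2 ⟨?_, ?_⟩
    · rw [tendsto_pi_nhds] at h1 ⊢
      intro l
      by_cases hl : l = i
      · subst hl; simpa using hw
      · simpa [hl] using h1 l
    · filter_upwards [h2, hw0] with t a b l
      by_cases hl : l = i
      · subst hl; simpa using b
      · simpa [hl] using a l
  · filter_upwards [e] with t ht
    ext l
    by_cases hl : l = i
    · subst hl; simp [hij.symm, ht]
    · simp [hl]
  · intro v hv v' hv' h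
    have hne : ∀ l, l ≠ i → v l = v' l := by
      intro l hl
      have := congrFun h l
      simpa [hl] using this
    ext l
    by_cases hl : l = i
    · subst hl
      have := congrFun h l
      simp only [Function.update_self, ← hne j hij.symm] at this
      have := mul_left_cancel₀ (hv j).ne' this
      have := add_left_cancel this
      exact mul_left_cancel₀ hb this
    · exact hne l hl

lemma expoZ_update [DecidableEq κ] {i j : κ} (hij : i ≠ j) (ni nj : ℕ) (A : κ → ℤ) :
    expoZ (fun l => if l = i then (Pi.single i ni + Pi.single j nj : κ → ℕ) else Pi.single l 1) A
     = Function.update (Function.update A j (nj * A i + A j)) i (ni * A i) := by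
  ext l
  simp only [expoZ]
  rw [← Finset.add_sum_erase _ _ (Finset.mem_univ i)]
  have : ∀ x ∈ Finset.univ.erase i, A x * (((if x = i then
      (Pi.single i ni + Pi.single j nj : κ → ℕ) else Pi.single x 1) l : ℕ) : ℤ)
      = if x = l then A l else 0 := by
    intro x hx
    rw [if_neg (Finset.ne_of_mem_erase hx)]
    by_cases hxl : x = l
    · subst hxl; simp
    · simp [hxl, Pi.single_apply, Ne.symm hxl]
  rw [Finset.sum_congr rfl this, Finset.sum_ite_eq']
  by_cases hl : l = i
  · subst hl; simp [hij, mul_comm]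
  · by_cases hlj : l = j
    · subst hlj; simp [hl, mul_comm]
    · simp [hl, hlj, Pi.single_apply]

/-- Result of one toric step. -/
def StepRes (𝒰 : Ultrafilter I) (y : I → κ → ℝ) (A B : κ → ℤ) (i : κ) (P : Prop) : Prop :=
  ∃ (κ' : Type) (_ : Fintype κ') (z : I → κ' → ℝ) (N : κ → κ' → ℕ) (Ψ : (κ' → ℝ) → κ → ℝ)
    (φ : κ' → κ), Function.Injective φ ∧ (P → i ∈ range φ) ∧ MChart 𝒰 y z N Ψ ∧
    ∀ l, expoZ N A l = B (φ l)

lemma step_zero [DecidableEq κ] {y : I → κ → ℝ} (hy : Tendsto y 𝒰 (FP κ)) {i j : κ} (hij : i ≠ j)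
    (h : Tendsto (fun t => y t i / y t j) 𝒰 (𝓝 0)) (A : κ → ℤ) (k : κ) (P : Prop) :
    StepRes 𝒰 y A (Function.update A j (A i + A j)) k P := by
  obtain ⟨h1, h2⟩ := tendsto_FP.1 hy
  have hc := chart_update hy hij (fun t => y t i / y t j) h
    (by filter_upwards [h2] with t ht; exact div_pos (ht i) (ht j)) 0 1 one_ne_zero 1 1
    (by
      have := (PN_coord i).mul (PN_coord j)
      exact this.congr (by filter_upwards with v; ring))
    (by filter_upwards [h2] with t ht; have := (ht j).ne'; field_simp; ring)
  refine ⟨κ, inferInstance, _, _, _, id, Function.injective_id, fun _ => ⟨k, rfl⟩, hc, ?_⟩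
  intro l
  rw [expoZ_update hij]
  by_cases hl : l = i
  · subst hl; simp [hij]
  · simp [hl]

lemma step_const [DecidableEq κ] {y : I → κ → ℝ} (hy : Tendsto y 𝒰 (FP κ)) {i j : κ} (hij : i ≠ j)
    {c : ℝ} (hc : 0 < c)
    (h : Tendsto (fun t => y t i / y t j) 𝒰 (𝓝 c)) (A : κ → ℤ) :
    StepRes 𝒰 y A (Function.update (Function.update A j (A i + A j)) i 0) i False := by
  obtain ⟨h1, h2⟩ := tendsto_FP.1 hy
  have hw : Tendsto (fun t => y t i / y t j - c) 𝒰 (𝓝 0) := by simpa using h.sub_const c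
  have main : ∀ b : ℝ, b * b = 1 → (∀ᶠ t in (𝒰 : Filter I), 0 < b * (y t i / y t j - c)) →
      StepRes 𝒰 y A (Function.update (Function.update A j (A i + A j)) i 0) i False := by
    intro b hb hpos
    have hc := chart_update hy hij (fun t => b * (y t i / y t j - c)) (by simpa using hw.const_mul b)
      hpos c b (by rintro rfl; simp at hb) 0 1
      (by
        have := (PN_coord j).mul (PN_unit (u := fun v : κ → ℝ => c + b * v i)
          (analyticAt_const.add (analyticAt_const.mul (analyticAt_coord i 0))) (by simpa using hc))
        simpa using this)
      (by
        filter_upwards [h2] with t ht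
        rw [← mul_assoc, hb]; have := (ht j).ne'; field_simp; ring)
    refine ⟨κ, inferInstance, _, _, _, id, Function.injective_id, by simp, hc, ?_⟩
    intro l
    rw [expoZ_update hij]
    simp
  rcases sign_tricho 𝒰 (fun t => y t i / y t j - c) with hs | hs | hs
  · let Ψ : ({l : κ // l ≠ i} → ℝ) → κ → ℝ := fun v l =>
      if h : l = i then c * v ⟨j, hij.symm⟩ else v ⟨l, h⟩
    let N : κ → {l : κ // l ≠ i} → ℕ := fun l =>
      if h : l = i then Pi.single ⟨j, hij.symm⟩ 1 else Pi.single ⟨l, h⟩ 1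
    have hm : MonoMap N Ψ := by
      intro l
      by_cases hl : l = i
      · subst hl
        have := (PN_unit (κ := {l' : κ // l' ≠ l}) (u := fun _ => c) analyticAt_const hc).mul
          (PN_coord ⟨j, hij.symm⟩)
        simpa [N, Ψ] using this
      · simpa [N, Ψ, hl] using PN_coord (κ := {l : κ // l ≠ i}) ⟨l, hl⟩
    refine ⟨{l : κ // l ≠ i}, inferInstance, fun t l => y t l, N, Ψ, Subtype.val,
      Subtype.val_injective, by simp, ⟨⟨hm.analyticAt, ?_, ?_, ?_, univ, univ_mem, ?_⟩, hm⟩, ?_⟩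
    · ext l; simp [Ψ]
    · refine tendsto_FP.2 ⟨?_, ?_⟩
      · rw [tendsto_pi_nhds] at h1 ⊢
        intro l; exact h1 l
      · filter_upwards [h2] with t ht l using ht l
    · filter_upwards [hs, h2] with t ht ht2
      ext l
      by_cases hl : l = i
      · subst hl
        have := (ht2 j).ne'
        simp only [Ψ, dif_pos]
        field_simp at ht
        linarith
      · simp [Ψ, hl]
    · intro v _ v' _ hv
      ext ⟨l, hl⟩
      have := congrFun hv l
      simpa [Ψ, hl] using this
    · rintro ⟨l, hl⟩
      simp only [expoZ]
      rw [← Finset.add_sum_erase _ _ (Finset.mem_univ i)]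
      have : ∀ x ∈ Finset.univ.erase i, A x * ((N x ⟨l, hl⟩ : ℕ) : ℤ) = if x = l then A l else 0 := by
        intro x hx
        have hxi := Finset.ne_of_mem_erase hx
        by_cases hxl : x = l
        · subst hxl; simp [N, hxi]
        · simp [N, hxi, hxl, Pi.single_apply, Ne.symm hxl]
      rw [Finset.sum_congr rfl this, Finset.sum_ite_eq']
      by_cases hlj : l = j
      · subst hlj; simp [N, hl]
      · simp [N, hl, hlj, Pi.single_apply]
  · exact main 1 (by norm_num) (by simpa using hs)
  · exact main (-1) (by norm_num) (by filter_upwards [hs] with t ht; linarith)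

/-- conclusion of the toric lemma for one vector -/
def Tor (𝒰 : Ultrafilter I) (y : I → κ → ℝ) (A : κ → ℤ) : Prop :=
  ∃ (κ' : Type) (_ : Fintype κ') (z : I → κ' → ℝ) (N : κ → κ' → ℕ) (Ψ : (κ' → ℝ) → κ → ℝ),
    Fintype.card κ' ≤ Fintype.card κ ∧ MChart 𝒰 y z N Ψ ∧ (0 ≤ expoZ N A ∨ expoZ N A ≤ 0)

lemma Tor.neg {y : I → κ → ℝ} {A : κ → ℤ} (h : Tor 𝒰 y (-A)) : Tor 𝒰 y A := by
  obtain ⟨κ', i1, z, N, Ψ, h1, h2, h3⟩ := h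
  refine ⟨κ', i1, z, N, Ψ, h1, h2, ?_⟩
  rw [expoZ_neg] at h3
  rcases h3 with h | h
  · right; simpa using h
  · left; simpa using h

lemma Tor.of_step {y : I → κ → ℝ} {A B : κ → ℤ} {i : κ} {P : Prop}
    (h : StepRes 𝒰 y A B i P)
    (H : ∀ (κ' : Type) (_ : Fintype κ') (z : I → κ' → ℝ) (φ : κ' → κ), Tendsto z 𝒰 (FP κ') →
      Function.Injective φ → (P → i ∈ range φ) → Tor 𝒰 z (fun l => B (φ l))) : Tor 𝒰 y A := by
  obtain ⟨κ', i1, z, N, Ψ, φ, hφ, hP, hc, he⟩ := h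
  obtain ⟨κ'', i2, w, N', Ψ', h1, h2, h3⟩ := H κ' i1 z φ hc.ch.tz hφ hP
  refine ⟨κ'', i2, w, _, _, h1.trans (Fintype.card_le_of_injective φ hφ), hc.comp h2, ?_⟩
  rw [expoZ_comp, show expoZ N A = fun l => B (φ l) from funext he]
  exact h3

lemma tor_trivial {y : I → κ → ℝ} (hy : Tendsto y 𝒰 (FP κ)) {A : κ → ℤ} (h : 0 ≤ A ∨ A ≤ 0) :
    Tor 𝒰 y A := by
  classical
  exact ⟨κ, inferInstance, y, _, _, le_rfl, MChart.refl hy, by rwa [expoZ_id]⟩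

lemma card_filter_inj {φ : κ' → κ} (hφ : Function.Injective φ) (p q : κ → Prop) [DecidablePred p]
    [DecidablePred q] (h : ∀ l, p l → q l) [DecidablePred fun l => p (φ l)] :
    (Finset.univ.filter fun l => p (φ l)).card ≤ (Finset.univ.filter q).card := by
  refine Finset.card_le_card_of_injOn φ ?_ hφ.injOn
  intro l hl
  simp at hl ⊢
  exact h _ hl

open Classical in
lemma tor_aux (M : ℕ) (hM : 0 < M) (n : ℕ)
    (Hn : ∀ (n' : ℕ), n' < n → ∀ (κ : Type) [Fintype κ] (y : I → κ → ℝ) (A : κ → ℤ),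
      Tendsto y 𝒰 (FP κ) → (∀ l, |A l| ≤ M) → (Finset.univ.filter fun l => |A l| = M).card ≤ n' →
      Tor 𝒰 y A) (m : ℕ) :
    ∀ (κ : Type) [Fintype κ] (y : I → κ → ℝ) (A : κ → ℤ),
      Tendsto y 𝒰 (FP κ) → (∀ l, |A l| ≤ M) → (Finset.univ.filter fun l => |A l| = M).card ≤ n →
      (∃ i, A i = M) → (Finset.univ.filter fun l => A l < 0).card ≤ m → Tor 𝒰 y A := by
  induction m with
  | zero =>
    intro κ _ y A hy _ _ _ h
    refine tor_trivial hy (Or.inl fun l => ?_)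
    have := Finset.card_eq_zero.1 (Nat.le_zero.1 h)
    rw [Finset.filter_eq_empty_iff] at this
    simpa using this (Finset.mem_univ l)
  | succ m ih =>
    intro κ _ y A hy hA hn hi hm
    by_cases hneg : ∃ j, A j < 0
    swap
    · exact tor_trivial hy (Or.inl fun l => by push Not at hneg; exact hneg l)
    obtain ⟨j, hj⟩ := hneg
    obtain ⟨i, hi⟩ := hi
    have hij : i ≠ j := by rintro rfl; omega
    obtain ⟨h1, h2⟩ := tendsto_FP.1 hy
    have hjM := hA j
    rw [abs_le] at hjM
    have hcard : 0 < (Finset.univ.filter fun l => |A l| = M).card :=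
      Finset.card_pos.2 ⟨i, by simp [hi]⟩
    have drop : ∀ B : κ → ℤ, (∀ l, |B l| ≤ |A l| ∨ (l = j ∧ |B l| < M)) → |B i| < M →
        ∀ (κ' : Type) (_ : Fintype κ') (z : I → κ' → ℝ) (φ : κ' → κ), Tendsto z 𝒰 (FP κ') →
        Function.Injective φ → (False → i ∈ range φ) → Tor 𝒰 z (fun l => B (φ l)) := by
      intro B hB hBi κ' _ z φ hz hφ _
      have hlt : (Finset.univ.filter fun l => |B l| = M).card < n := by
        refine lt_of_lt_of_le (Finset.card_lt_card ?_) hn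
        refine (Finset.ssubset_iff_of_subset ?_).2 ⟨i, by simp [hi], by simp [hBi.ne]⟩
        intro l hl
        simp at hl ⊢
        have := hA l
        rcases hB l with h | h
        · omega
        · omega
      refine Hn _ hlt κ' z _ hz (fun l => ?_) (card_filter_inj hφ (fun l => |B l| = M) (fun l => |B l| = M) fun l h => h)
      have := hA (φ l)
      rcases hB (φ l) with h | h
      · omega
      · omega
    rcases tricho 𝒰 (fun t => y t i / y t j) with ⟨c, hc⟩ | hc | hc
    · have hc0 : 0 ≤ c := ge_of_tendsto hc (by
        filter_upwards [h2] with t ht; exact (div_pos (ht i) (ht j)).le)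
      rcases hc0.eq_or_lt with rfl | hc0
      · refine Tor.of_step (step_zero hy hij hc A i True) ?_
        intro κ' _ z φ hz hφ hP
        obtain ⟨i', hi'⟩ := hP trivial
        have hB : ∀ l, |Function.update A j (A i + A j) l| ≤ M ∧
          (|Function.update A j (A i + A j) l| = M → |A l| = M) := by
          intro l
          by_cases hl : l = j
          · subst hl
            simp only [Function.update_self]
            have : |A i + A l| < M := by rw [abs_lt]; omega
            exact ⟨this.le, fun h => absurd h this.ne⟩
          · simp only [Function.update_of_ne hl]; exact ⟨hA l, id⟩
        refine ih κ' z _ hz (fun l => (hB (φ l)).1) ?_ ⟨i', by simp [hi', hij, hi]⟩ ?_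
        · exact (card_filter_inj hφ (fun l => |Function.update A j (A i + A j) l| = M)
            (fun l => |A l| = M) (fun l h => (hB l).2 h)).trans hn
        · have : (Finset.univ.filter fun l => Function.update A j (A i + A j) l < 0).card <
              (Finset.univ.filter fun l => A l < 0).card := by
            refine Finset.card_lt_card ((Finset.ssubset_iff_of_subset ?_).2
              ⟨j, by simp [hj], by simp; omega⟩)
            intro l hl
            simp at hl ⊢
            by_cases hlj : l = j
            · subst hlj; exact hj
            · simpa [hlj] using hl
          have h2 := card_filter_inj hφ (fun l => Function.update A j (A i + A j) l < 0) _
            (fun l h => h)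
          omega
      · refine Tor.of_step (step_const hy hij hc0 hc A) (drop _ ?_ ?_)
        · intro l
          by_cases hl : l = i
          · subst hl; simp
          · by_cases hlj : l = j
            · subst hlj; right; simp [hl]; rw [abs_lt]; omega
            · simp [hl, hlj]
        · simp; exact_mod_cast hM
    · have hc' : Tendsto (fun t => y t j / y t i) 𝒰 (𝓝 0) := by
        have := hc.inv_tendsto_atTop
        refine this.congr fun t => ?_
        simp
      refine Tor.of_step (step_zero hy hij.symm hc' A i False) (drop _ ?_ ?_)
      · intro l
        by_cases hl : l = i
        · subst hl; left; simp; rw [abs_le, abs_of_nonneg (by omega)]; omega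
        · simp [hl]
      · simp; rw [abs_lt]; omega
    · exfalso
      have := hc.eventually (eventually_lt_atBot 0)
      obtain ⟨t, a, b⟩ := (this.and h2).exists
      exact absurd a (not_lt.2 (div_pos (b i) (b j)).le)

open Classical in
lemma tor_M (M : ℕ) : ∀ (κ : Type) [Fintype κ] (y : I → κ → ℝ) (A : κ → ℤ),
      Tendsto y 𝒰 (FP κ) → (∀ l, |A l| ≤ M) → Tor 𝒰 y A := by
  induction M with
  | zero =>
    intro κ _ y A hy h
    refine tor_trivial hy (Or.inl fun l => ?_)
    have := h l
    simp at this
    simp [this]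
  | succ M ih =>
    have key : ∀ n : ℕ, ∀ (κ : Type) [Fintype κ] (y : I → κ → ℝ) (A : κ → ℤ),
      Tendsto y 𝒰 (FP κ) → (∀ l, |A l| ≤ (M+1 : ℕ)) →
      (Finset.univ.filter fun l => |A l| = (M+1 : ℕ)).card ≤ n → Tor 𝒰 y A := by
      intro n
      induction n using Nat.strong_induction_on with
      | _ n ihn =>
        intro κ _ y A hy hA hn
        by_cases hex : ∃ i, |A i| = (M+1 : ℕ)
        · obtain ⟨i, hi⟩ := hex
          rcases (abs_eq (by positivity)).1 hi with h | h
          · exact tor_aux (M+1) (by omega) n ihn _ κ y A hy hA hn ⟨i, h⟩ le_rfl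
          · refine Tor.neg (tor_aux (M+1) (by omega) n ihn _ κ y (-A) hy (by simpa using hA) ?_
              ⟨i, by simp [h]⟩ le_rfl)
            simpa using hn
        · refine ih κ y A hy fun l => ?_
          push Not at hex
          have := hex l
          have := hA l
          push_cast at *
          omega
    intro κ _ y A hy hA
    exact key _ κ y A hy hA le_rfl

theorem toric1 {y : I → κ → ℝ} (hy : Tendsto y 𝒰 (FP κ)) (A : κ → ℤ) : Tor 𝒰 y A := by
  refine tor_M (∑ l, |A l|).toNat κ y A hy fun l => ?_
  have h1 : |A l| ≤ ∑ l, |A l| :=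
    Finset.single_le_sum (f := fun l => |A l|) (fun i _ => abs_nonneg _) (Finset.mem_univ l)
  omega

theorem toric {J : Type*} (s : Finset J) {y : I → κ → ℝ} (hy : Tendsto y 𝒰 (FP κ))
    (A : J → κ → ℤ) :
    ∃ (κ' : Type) (_ : Fintype κ') (z : I → κ' → ℝ) (N : κ → κ' → ℕ) (Ψ : (κ' → ℝ) → κ → ℝ),
    Fintype.card κ' ≤ Fintype.card κ ∧ MChart 𝒰 y z N Ψ ∧
      ∀ j ∈ s, (0 ≤ expoZ N (A j) ∨ expoZ N (A j) ≤ 0) := by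
  classical
  induction s using Finset.induction_on with
  | empty => exact ⟨κ, inferInstance, y, _, _, le_rfl, MChart.refl hy, by simp⟩
  | insert a s ha ih =>
    obtain ⟨κ', i1, z, N, Ψ, h1, h2, h3⟩ := ih
    obtain ⟨κ'', i2, w, N', Ψ', h1', h2', h3'⟩ := toric1 h2.ch.tz (expoZ N (A a))
    refine ⟨κ'', i2, w, _, _, h1'.trans h1, h2.comp h2', ?_⟩
    intro j hj
    rw [expoZ_comp]
    rcases Finset.mem_insert.1 hj with rfl | hj
    · exact h3'
    · rcases h3 j hj with h | h
      · exact Or.inl (expoZ_nonneg _ h)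
      · exact Or.inr (expoZ_nonpos _ h)

end Charts

section LUsec
variable {I : Type} {𝒰 : Ultrafilter I}
variable {κ κ' κ'' : Type} [Fintype κ] [Fintype κ'] [Fintype κ'']

lemma NC.mulPN {α : κ → ℕ} {g h : (κ → ℝ) → ℝ} (hg : PN α g) (hh : NC h) :
    NC (fun v => g v * h v) := by
  obtain ⟨β, hh⟩ := hh
  exact ⟨_, hg.NN.mul hh⟩

/-- Conclusion of the inductive step. -/
def QC (𝒰 : Ultrafilter I) (x : I → κ → ℝ) (s : I → ℝ) (f : (κ → ℝ) × ℝ → ℝ) : Prop :=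
  ∃ (κ' : Type) (_ : Fintype κ') (z : I → κ' → ℝ) (N : κ → κ' → ℕ) (Φ : (κ' → ℝ) → (κ → ℝ) × ℝ),
    Fintype.card κ' ≤ Fintype.card κ + 1 ∧ Chart 𝒰 (fun t => (x t, s t)) z Φ ∧
    MonoMap N (fun v => (Φ v).1) ∧ (NC (fun v => f (Φ v)) ∨ Fintype.card κ' ≤ Fintype.card κ)

lemma Qpre {x : I → κ → ℝ} {y : I → κ' → ℝ} {N : κ → κ' → ℕ} {Ψ : (κ' → ℝ) → κ → ℝ}
    (hc : MChart 𝒰 x y N Ψ) (hcard : Fintype.card κ' ≤ Fintype.card κ) {s s' : I → ℝ}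
    {θ : (κ' → ℝ) × ℝ → ℝ} (hθ : AnalyticAt ℝ θ 0) (hθ0 : θ 0 = 0)
    (hs : ∀ᶠ t in (𝒰 : Filter I), s t = θ (y t, s' t))
    (hinj : ∀ v : κ' → ℝ, (∀ i, 0 < v i) → ∀ w w', θ (v, w) = θ (v, w') → w = w')
    {f : (κ → ℝ) × ℝ → ℝ} {f2 : (κ' → ℝ) × ℝ → ℝ} (β : κ' → ℕ)
    (hf : ∀ᶠ p in 𝓝 0, f (Ψ p.1, θ p) = mono β p.1 * f2 p) (h : QC 𝒰 y s' f2) : QC 𝒰 x s f := by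
  obtain ⟨κ1, i1, z, N', Φ, h1, h2, h3, h4⟩ := h
  have z1 : (Φ 0).1 = 0 := by rw [h2.zero]; rfl
  have t1 := h3.tendsto z1
  have tΦ : Tendsto Φ (𝓝 0) (𝓝 0) := by
    have := h2.an.continuousAt.tendsto
    rwa [h2.zero] at this
  refine ⟨κ1, i1, z, _, fun v => (Ψ (Φ v).1, θ (Φ v)), by omega, ⟨?_, ?_, h2.tz, ?_, ?_⟩,
    hc.mono.comp h3 z1, ?_⟩
  · refine AnalyticAt.prod ?_ (analyticAt_comp0 hθ h2.an h2.zero)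
    exact analyticAt_comp0 hc.ch.an h3.analyticAt z1
  · show (Ψ (Φ 0).1, θ (Φ 0)) = 0
    rw [z1, hc.ch.zero, h2.zero, hθ0]; rfl
  · filter_upwards [hs, h2.eq, hc.ch.eq] with t a b c
    rw [← b, a, c]
  · obtain ⟨S, hS, iS⟩ := hc.ch.inj
    obtain ⟨S', hS', iS'⟩ := h2.inj
    refine ⟨S' ∩ ((fun v => (Φ v).1) ⁻¹' (S ∩ {v | ∀ i, 0 < v i})),
      inter_mem hS' (t1 (inter_mem hS FP_pos)), ?_⟩
    intro v hv v' hv' e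
    simp only [Prod.mk.injEq] at e
    have e1 : (Φ v).1 = (Φ v').1 := iS hv.2.1 hv'.2.1 e.1
    have e2 : (Φ v).2 = (Φ v').2 := by
      refine hinj (Φ v).1 hv.2.2 _ _ ?_
      conv_rhs => rw [e1]
      exact e.2
    exact iS' hv.1 hv'.1 (Prod.ext e1 e2)
  · rcases h4 with h4 | h4
    · left
      have := NC.mulPN (PN_mono_comp h3 β) h4
      exact this.congr (tΦ.eventually hf)
    · right; omega

/-- adding a positive last coordinate -/
def opt (v : Option κ → ℝ) : (κ → ℝ) × ℝ := (fun i => v (some i), v none)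

lemma opt_an (x : Option κ → ℝ) : AnalyticAt ℝ (opt (κ := κ)) x := by
  refine AnalyticAt.prod ?_ (analyticAt_coord none x)
  rw [analyticAt_pi_iff]
  exact fun i => analyticAt_coord (some i) x

lemma opt_tendsto {x : I → κ → ℝ} {s : I → ℝ} (hx : Tendsto x 𝒰 (FP κ)) (hs : Tendsto s 𝒰 (𝓝 0))
    (hs0 : ∀ᶠ t in (𝒰 : Filter I), 0 < s t) :
    Tendsto (fun t (o : Option κ) => o.elim (s t) (x t)) 𝒰 (FP (Option κ)) := by
  obtain ⟨h1, h2⟩ := tendsto_FP.1 hx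
  rw [tendsto_pi_nhds] at h1
  refine tendsto_FP.2 ⟨tendsto_pi_nhds.2 ?_, ?_⟩
  · rintro (_ | i)
    · exact hs
    · exact h1 i
  · filter_upwards [h2, hs0] with t a b
    rintro (_ | i)
    · exact b
    · exact a i

lemma opt_chart {x : I → κ → ℝ} {s : I → ℝ} (hx : Tendsto x 𝒰 (FP κ)) (hs : Tendsto s 𝒰 (𝓝 0))
    (hs0 : ∀ᶠ t in (𝒰 : Filter I), 0 < s t) :
    Chart 𝒰 (fun t => (x t, s t)) (fun t (o : Option κ) => o.elim (s t) (x t)) opt where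
  an := opt_an 0
  zero := rfl
  tz := opt_tendsto hx hs hs0
  eq := by filter_upwards with t; rfl
  inj := by
    refine ⟨univ, univ_mem, ?_⟩
    intro v _ v' _ h
    simp only [opt, Prod.mk.injEq] at h
    ext (_ | i)
    · exact h.2
    · exact congrFun h.1 i

lemma opt_mono [DecidableEq κ] :
    MonoMap (fun i : κ => (Pi.single (some i) 1 : Option κ → ℕ)) (fun v => (opt v).1) :=
  fun i => PN_coord (some i)

/-- Sign flip of the last variable -/
lemma Qflip {x : I → κ → ℝ} (hx : Tendsto x 𝒰 (FP κ)) {s : I → ℝ}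
    {f : (κ → ℝ) × ℝ → ℝ} (h : QC 𝒰 x (fun t => - s t) (fun p => f (p.1, - p.2))) :
    QC 𝒰 x s f := by
  classical
  refine Qpre (MChart.refl hx) le_rfl (s' := fun t => - s t) (θ := fun p => - p.2)
    (analyticAt_snd.neg) (by simp) (by simp) ?_ 0 ?_ h
  · intro v _ w w' h; simpa using h
  · simp

lemma Qzero {x : I → κ → ℝ} (hx : Tendsto x 𝒰 (FP κ)) {s : I → ℝ}
    (hs0 : ∀ᶠ t in (𝒰 : Filter I), s t = 0) (f : (κ → ℝ) × ℝ → ℝ) : QC 𝒰 x s f := by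
  classical
  refine ⟨κ, inferInstance, x, fun i => Pi.single i 1, fun v => (v, 0), by omega,
    ⟨an_inl, rfl, hx, ?_, univ, univ_mem, ?_⟩, fun i => PN_coord i, Or.inr le_rfl⟩
  · filter_upwards [hs0] with t ht; rw [ht]
  · intro v _ v' _ h; simpa using h

/-- `f = t ^ k * unit`. -/
lemma Qbase {x : I → κ → ℝ} (hx : Tendsto x 𝒰 (FP κ)) {s : I → ℝ} (hs : Tendsto s 𝒰 (𝓝 0))
    (k : ℕ) : ∀ {f U : (κ → ℝ) × ℝ → ℝ}, AnalyticAt ℝ U 0 → U 0 ≠ 0 →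
    (∀ᶠ p in 𝓝 0, f p = p.2 ^ k * U p) → QC 𝒰 x s f := by
  classical
  have pos : ∀ {s : I → ℝ}, Tendsto s 𝒰 (𝓝 0) → (∀ᶠ t in (𝒰 : Filter I), 0 < s t) →
      ∀ {f U : (κ → ℝ) × ℝ → ℝ}, AnalyticAt ℝ U 0 → U 0 ≠ 0 →
      (∀ᶠ p in 𝓝 0, f p = p.2 ^ k * U p) → QC 𝒰 x s f := by
    intro s hs hs0 f U hU hU0 hf
    refine ⟨Option κ, inferInstance, _, _, opt, by simp, opt_chart hx hs hs0, opt_mono, Or.inl ?_⟩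
    have := ((PN_coord (κ := Option κ) none).pow k).NN.mul
      (NN_unit (analyticAt_comp0 hU (opt_an 0) rfl) hU0)
    refine ⟨_, this.congr ?_⟩
    have t : Tendsto (opt (κ := κ)) (𝓝 0) (𝓝 0) := (opt_an 0).continuousAt.tendsto
    filter_upwards [t.eventually hf] with v hv
    rw [hv]; rfl
  intro f U hU hU0 hf
  rcases sign_tricho 𝒰 s with h | h | h
  · exact Qzero hx h f
  · exact pos hs h hU hU0 hf
  · refine Qflip hx (pos (by simpa using hs.neg) (by simpa using h)
      (U := fun p => (-1)^k * U (p.1, - p.2)) ?_ ?_ ?_)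
    · exact analyticAt_const.mul
        (analyticAt_comp0 hU (AnalyticAt.prod analyticAt_fst analyticAt_snd.neg) (by simp))
    · refine mul_ne_zero (pow_ne_zero _ (by norm_num)) ?_
      have : ((0 : (κ → ℝ) × ℝ).1, -(0 : (κ → ℝ) × ℝ).2) = 0 := by simp
      rw [this]; exact hU0
    · have t : Tendsto (fun p : (κ → ℝ) × ℝ => (p.1, - p.2)) (𝓝 0) (𝓝 0) := by
        have : Continuous (fun p : (κ → ℝ) × ℝ => (p.1, - p.2)) := by fun_prop
        exact this.tendsto' _ _ (by simp)
      filter_upwards [t.eventually hf] with p hp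
      rw [hp, neg_pow]; ring

lemma mono_tendsto {y : I → κ → ℝ} (hy : Tendsto y 𝒰 (FP κ)) (α : κ → ℕ) :
    ∀ᶠ t in (𝒰 : Filter I), mono α (y t) ≤ 1 := by
  obtain ⟨h1, h2⟩ := tendsto_FP.1 hy
  rw [tendsto_pi_nhds] at h1
  have : ∀ᶠ t in (𝒰 : Filter I), ∀ i, y t i < 1 :=
    eventually_all.2 fun i => (h1 i).eventually (gt_mem_nhds one_pos)
  filter_upwards [this, h2] with t a b
  exact Finset.prod_le_one (fun i _ => pow_nonneg (b i).le _)
    (fun i _ => pow_le_one₀ (b i).le (a i).le)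

lemma expoZ_cast (N : κ → κ' → ℕ) (α : κ → ℕ) (l : κ') :
    expoZ N (fun i => (α i : ℤ)) l = (expo N α l : ℕ) := by
  simp [expoZ, expo_apply]

lemma analyticAt_sum' {E : Type*} [NormedAddCommGroup E] [NormedSpace ℝ E] {J : Type*}
    {s : Finset J} {f : J → E → ℝ} {x : E} (h : ∀ j ∈ s, AnalyticAt ℝ (f j) x) :
    AnalyticAt ℝ (fun v => ∑ j ∈ s, f j v) x := Finset.analyticAt_fun_sum s h

/-- the infinite-ratio case -/
lemma Qinf_pos {x : I → κ → ℝ} (hx : Tendsto x 𝒰 (FP κ)) {s : I → ℝ} (hs : Tendsto s 𝒰 (𝓝 0))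
    (hs0 : ∀ᶠ t in (𝒰 : Filter I), 0 < s t) (β : κ → ℕ) (k : ℕ)
    (hinf : Tendsto (fun t => s t / mono β (x t)) 𝒰 atTop)
    {f U : (κ → ℝ) × ℝ → ℝ} {A : ℕ → (κ → ℝ) → ℝ} (hA : ∀ j < k, AnalyticAt ℝ (A j) 0)
    (hU : AnalyticAt ℝ U 0) (hU0 : U 0 ≠ 0)
    (hf : ∀ᶠ p in 𝓝 0, f p = ∑ j ∈ Finset.range k, mono β p.1 ^ (k - j) * A j p.1 * p.2 ^ j
      + p.2 ^ k * U p) : QC 𝒰 x s f := by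
  classical
  have hc1 := opt_chart hx hs hs0
  let B : Option κ → ℤ := fun o => o.elim (-1) (fun i => (β i : ℤ))
  obtain ⟨κ1, i1, z, N, Ψ, h1, h2, h3⟩ := toric1 hc1.tz B
  have hPs : PN (N none) (fun v => Ψ v none) := h2.mono none
  have hPb : PN (expo (fun i => N (some i)) β) (fun v => mono β (fun i => Ψ v (some i))) :=
    PN_mono_comp (N := fun i => N (some i)) (Ψ := fun v i => Ψ v (some i))
      (fun i => h2.mono (some i)) β
  have hexp : ∀ l, expoZ N B l = (expo (fun i => N (some i)) β l : ℤ) - N none l := by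
    intro l
    simp only [expoZ, Fintype.sum_option, B, expo_apply]
    push_cast
    simp; ring
  obtain ⟨u1, a1, p1, e1⟩ := hPs
  obtain ⟨u2, a2, p2, e2⟩ := hPb
  -- values along the ultrafilter
  have ev1 := (h2.ch.tz.mono_right FP_le).eventually e1
  have ev2 := (h2.ch.tz.mono_right FP_le).eventually e2
  have hpos := h2.ch.tz.eventually FP_pos
  have tu1 : Tendsto (fun t => u1 (z t)) 𝒰 (𝓝 (u1 0)) :=
    a1.continuousAt.tendsto.comp (h2.ch.tz.mono_right FP_le)
  have tu2 : Tendsto (fun t => u2 (z t)) 𝒰 (𝓝 (u2 0)) :=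
    a2.continuousAt.tendsto.comp (h2.ch.tz.mono_right FP_le)
  have tq : Tendsto (fun t => u1 (z t) / u2 (z t)) 𝒰 (𝓝 (u1 0 / u2 0)) := tu1.div tu2 p2.ne'
  have hval : ∀ᶠ t in (𝒰 : Filter I), s t / mono β (x t) = (mono (N none) (z t) * u1 (z t)) /
      (mono (expo (fun i => N (some i)) β) (z t) * u2 (z t)) := by
    filter_upwards [ev1, ev2, h2.ch.eq] with t a b c
    rw [← a, ← b, ← c]
    rfl
  -- the case of nonpositive exponents is impossible
  have notle : ¬ (∀ l, expo (fun i => N (some i)) β l ≤ N none l) := by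
    intro hle
    have hN : N none = expo (fun i => N (some i)) β + (N none - expo (fun i => N (some i)) β) := by
      ext l; have := hle l; simp; omega
    have hb : ∀ᶠ t in (𝒰 : Filter I), s t / mono β (x t) ≤ u1 0 / u2 0 + 1 := by
      filter_upwards [hval, hpos, tq.eventually (gt_mem_nhds (lt_add_one _)),
        mono_tendsto h2.ch.tz (N none - expo (fun i => N (some i)) β),
        tu1.eventually (lt_mem_nhds p1), tu2.eventually (lt_mem_nhds p2)] with t a b c d e g
      rw [a, hN, mono_add]
      have m1 := mono_pos (expo (fun i => N (some i)) β) b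
      have m2 := mono_pos (N none - expo (fun i => N (some i)) β) b
      rw [mul_assoc, mul_div_mul_left _ _ m1.ne', mul_div_assoc]
      have : 0 < u1 (z t) / u2 (z t) := div_pos e g
      calc _ ≤ 1 * (u1 (z t) / u2 (z t)) := by gcongr
        _ ≤ _ := by linarith
    obtain ⟨t, ht1, ht2⟩ := (hb.and (hinf.eventually (eventually_gt_atTop (u1 0 / u2 0 + 1)))).exists
    linarith
  have hge : ∀ l, N none l ≤ expo (fun i => N (some i)) β l := by
    rcases h3 with h3 | h3
    · intro l
      have := h3 l
      rw [hexp] at this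
      simp at this
      exact_mod_cast this
    · exfalso
      refine notle fun l => ?_
      have := h3 l
      rw [hexp] at this
      simp at this
      exact_mod_cast this
  obtain ⟨δ, hδ⟩ : ∃ δ : κ1 → ℕ, expo (fun i => N (some i)) β = N none + δ := by
    refine ⟨expo (fun i => N (some i)) β - N none, ?_⟩
    ext l; have := hge l; simp; omega
  have hδ0 : mono δ 0 = 0 := by
    have : ∃ l, δ l ≠ 0 := by
      by_contra hcon
      push Not at hcon
      apply notle
      intro l
      rw [hδ]; simp [hcon l]
    obtain ⟨l, hl⟩ := this
    exact Finset.prod_eq_zero (Finset.mem_univ l) (by simp [hl])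
  -- the chart
  let Φ : (κ1 → ℝ) → (κ → ℝ) × ℝ := fun v => opt (Ψ v)
  have anΦ : AnalyticAt ℝ Φ 0 := analyticAt_comp0 (opt_an 0) h2.ch.an h2.ch.zero
  have Φ0 : Φ 0 = 0 := by simp only [Φ, h2.ch.zero]; rfl
  have tΦ : Tendsto Φ (𝓝 0) (𝓝 0) := by
    have := anΦ.continuousAt.tendsto
    rwa [Φ0] at this
  have an1 : AnalyticAt ℝ (fun v => (Φ v).1) 0 := analyticAt_comp0 analyticAt_fst anΦ Φ0
  let G : (κ1 → ℝ) → ℝ := fun v => mono δ v * (u2 v / u1 v)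
  have anG : AnalyticAt ℝ G 0 := (analyticAt_mono δ 0).mul (a2.div a1 p1.ne')
  have G0 : G 0 = 0 := by simp [G, hδ0]
  have hG : ∀ᶠ v in 𝓝 0, mono β (Φ v).1 = (Φ v).2 * G v := by
    have : ∀ᶠ v in 𝓝 (0 : κ1 → ℝ), u1 v ≠ 0 := a1.continuousAt.eventually_ne p1.ne'
    filter_upwards [e1, e2, this] with v h1 h2 h3
    change mono β (fun i => Ψ v (some i)) = Ψ v none * G v
    rw [h1, h2, hδ, mono_add]
    simp only [G]
    field_simp
  have card1 : Fintype.card κ1 ≤ Fintype.card κ + 1 := by simpa using h1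
  refine ⟨κ1, i1, z, _, Φ, card1, hc1.comp h2.ch h2.tendsto, fun i => h2.mono (some i), Or.inl ?_⟩
  let W : (κ1 → ℝ) → ℝ := fun v => ∑ j ∈ Finset.range k, G v ^ (k - j) * A j (Φ v).1 + U (Φ v)
  have anW : AnalyticAt ℝ W 0 := by
    refine (analyticAt_sum' fun j hj => ?_).add (analyticAt_comp0 hU anΦ Φ0)
    refine (anG.pow _).mul (analyticAt_comp0 (hA j (Finset.mem_range.1 hj)) an1 ?_)
    rw [Φ0]; rfl
  have W0 : W 0 ≠ 0 := by
    have : ∑ j ∈ Finset.range k, G 0 ^ (k - j) * A j (Φ 0).1 = 0 := by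
      refine Finset.sum_eq_zero fun j hj => ?_
      have := Finset.mem_range.1 hj
      rw [G0, zero_pow (by omega), zero_mul]
    show (∑ j ∈ Finset.range k, G 0 ^ (k - j) * A j (Φ 0).1) + U (Φ 0) ≠ 0
    rw [this, zero_add, Φ0]
    exact hU0
  have := ((h2.mono none).pow k).NN.mul (NN_unit anW W0)
  refine ⟨_, this.congr ?_⟩
  filter_upwards [tΦ.eventually hf, hG] with v hv hGv
  rw [hv, hGv]
  change _ = (Φ v).2 ^ k * W v
  simp only [W, mul_add, Finset.mul_sum]
  congr 1
  refine Finset.sum_congr rfl fun j hj => ?_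
  have := Finset.mem_range.1 hj
  rw [mul_pow]
  have e : (Φ v).2 ^ k = (Φ v).2 ^ (k - j) * (Φ v).2 ^ j := by
    rw [← pow_add]; congr 1; omega
  rw [e]; ring

lemma Qinf {x : I → κ → ℝ} (hx : Tendsto x 𝒰 (FP κ)) {s : I → ℝ} (hs : Tendsto s 𝒰 (𝓝 0))
    (β : κ → ℕ) (k : ℕ)
    (hinf : Tendsto (fun t => s t / mono β (x t)) 𝒰 atTop ∨
      Tendsto (fun t => s t / mono β (x t)) 𝒰 atBot)
    {f U : (κ → ℝ) × ℝ → ℝ} {A : ℕ → (κ → ℝ) → ℝ} (hA : ∀ j < k, AnalyticAt ℝ (A j) 0)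
    (hU : AnalyticAt ℝ U 0) (hU0 : U 0 ≠ 0)
    (hf : ∀ᶠ p in 𝓝 0, f p = ∑ j ∈ Finset.range k, mono β p.1 ^ (k - j) * A j p.1 * p.2 ^ j
      + p.2 ^ k * U p) : QC 𝒰 x s f := by
  have hpos := hx.eventually FP_pos
  rcases hinf with hinf | hinf
  · refine Qinf_pos hx hs ?_ β k hinf hA hU hU0 hf
    filter_upwards [hpos, hinf.eventually (eventually_gt_atTop 0)] with t a b
    have := mono_pos β a
    have := mul_pos b this
    rwa [div_mul_cancel₀ _ (mono_pos β a).ne'] at this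
  · refine Qflip hx (Qinf_pos hx (by simpa using hs.neg) ?_ β k ?_
      (A := fun j v => (-1)^j * A j v) (U := fun p => (-1)^k * U (p.1, - p.2)) ?_ ?_ ?_ ?_)
    · filter_upwards [hpos, hinf.eventually (eventually_lt_atBot 0)] with t a b
      have h1 := mono_pos β a
      have := mul_neg_of_neg_of_pos b h1
      rw [div_mul_cancel₀ _ (mono_pos β a).ne'] at this
      linarith
    · have := tendsto_neg_atBot_atTop.comp hinf
      refine this.congr fun t => ?_
      simp [neg_div]
    · exact fun j hj => analyticAt_const.mul (hA j hj)
    · exact analyticAt_const.mul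
        (analyticAt_comp0 hU (AnalyticAt.prod analyticAt_fst analyticAt_snd.neg) (by simp))
    · refine mul_ne_zero (pow_ne_zero _ (by norm_num)) ?_
      have : ((0 : (κ → ℝ) × ℝ).1, -(0 : (κ → ℝ) × ℝ).2) = 0 := by simp
      rw [this]; exact hU0
    · have t : Tendsto (fun p : (κ → ℝ) × ℝ => (p.1, - p.2)) (𝓝 0) (𝓝 0) := by
        have : Continuous (fun p : (κ → ℝ) × ℝ => (p.1, - p.2)) := by fun_prop
        exact this.tendsto' _ _ (by simp)
      filter_upwards [t.eventually hf] with p hp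
      rw [hp, neg_pow]
      congr 1
      · refine Finset.sum_congr rfl fun j _ => ?_
        rw [neg_pow]; ring
      · ring

end LUsec

section LUsec
variable {I : Type} {𝒰 : Ultrafilter I}
variable {κ κ' κ'' : Type} [Fintype κ] [Fintype κ'] [Fintype κ'']

open Polynomial in
lemma poly_pow {q : ℝ[X]} {k : ℕ} (hk : 0 < k) (hdeg : q.natDegree ≤ k) (hk1 : q.coeff (k-1) = 0)
    (hlead : q.coeff k ≠ 0) (l : ℝ) (h : X ^ k ∣ q.comp (X + C l)) (j : ℕ) (hj : j < k) :
    q.coeff j = 0 := by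
  obtain ⟨r, hr⟩ := h
  have e0 : (q.comp (X + C l)).comp (X - C l) = q := by
    rw [comp_assoc]; simp
  have hd : (q.comp (X + C l)).natDegree ≤ k := by
    rw [natDegree_comp, natDegree_X_add_C, mul_one]; exact hdeg
  have hr0 : r.natDegree = 0 := by
    by_cases h0 : r = 0
    · simp [h0]
    rw [hr, natDegree_mul (pow_ne_zero _ X_ne_zero) h0, natDegree_X_pow] at hd
    omega
  obtain ⟨c, rfl⟩ := natDegree_eq_zero.1 hr0
  rw [hr] at e0
  simp only [mul_comp, pow_comp, X_comp, C_comp] at e0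
  have hc : ∀ j, q.coeff j = (-l)^(k-j) * k.choose j * c := by
    intro j
    rw [← e0, coeff_mul_C, sub_eq_add_neg, ← C_neg, coeff_X_add_C_pow]
  have h1 := hc (k-1)
  rw [hk1] at h1
  have h2 := hc k
  simp at h2
  have hc0 : c ≠ 0 := h2 ▸ hlead
  have e3 : k - (k-1) = 1 := by omega
  have e4 : ((k.choose (k-1) : ℕ) : ℝ) ≠ 0 := by
    exact_mod_cast (Nat.choose_pos (by omega)).ne'
  have hl : l = 0 := by
    rw [e3, pow_one] at h1
    have := h1.symm
    simp only [mul_eq_zero, neg_eq_zero, hc0, e4, or_false] at this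
    exact this
  rw [hc j, hl, neg_zero, zero_pow (by omega)]; simp

open Polynomial in
lemma finite_case {E : Type*} [NormedAddCommGroup E] [NormedSpace ℝ E] [CompleteSpace E]
    {k : ℕ} (hk : 0 < k) {f : E × ℝ → ℝ} (hf : AnalyticAt ℝ f 0) (A : ℕ → ℝ) (U l : ℝ)
    (hfe : ∀ᶠ w in 𝓝 (0:ℝ), f (0, w) = ∑ j ∈ Finset.range k, A j * (l + w) ^ j + (l + w)^k * U)
    (hU : U ≠ 0) (hA : A (k-1) = 0) (hj : ∃ j < k, A j ≠ 0) : ∃ j < k, D^[j] f 0 ≠ 0 := by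
  by_contra hcon
  push Not at hcon
  obtain ⟨a, V, h1, h2, h3, h4, -⟩ := taylor k f hf
  have ha : ∀ j < k, a j 0 = 0 := by
    intro j hj
    have := (h4 j hj).self_of_nhds
    have h := hcon j hj
    rw [show ((0:E),(0:ℝ)) = 0 from rfl, h] at this
    simpa [Nat.factorial_ne_zero] using this.symm
  have ti : Tendsto (fun w : ℝ => ((0:E), w)) (𝓝 0) (𝓝 0) := by
    have : Continuous (fun w : ℝ => ((0:E), w)) := by fun_prop
    exact this.tendsto' _ _ rfl
  let q : ℝ[X] := ∑ j ∈ Finset.range k, C (A j) * X ^ j + C U * X ^ k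
  have hcoef : ∀ i, q.coeff i = (if i < k then A i else 0) + (if i = k then U else 0) := by
    intro i
    simp only [q, coeff_add, finsetSum_coeff, coeff_C_mul, coeff_X_pow]
    congr 1
    · simp
    · simp
  have hdeg : q.natDegree ≤ k := by
    rw [natDegree_le_iff_coeff_eq_zero]
    intro i hi
    rw [hcoef, if_neg (by omega), if_neg (by omega)]; simp
  have hdvd : X ^ k ∣ q.comp (X + C l) := by
    refine poly_dvd k _ (fun w => V (0, w)) ?_ ?_
    · have : ContinuousAt V (0 : E × ℝ) := h2.continuousAt
      exact ContinuousAt.comp (x := (0:ℝ)) (f := fun w : ℝ => ((0:E), w)) this (by fun_prop)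
    · refine nhdsWithin_le_nhds ?_
      filter_upwards [hfe, ti.eventually h3] with w e1 e2
      rw [e1] at e2
      simp only [eval_comp, q, eval_add, eval_finsetSum, eval_mul, eval_C, eval_pow, eval_X]
      rw [add_comm w l, mul_comm U, e2, Finset.sum_eq_zero, zero_add]
      intro j hj
      rw [ha j (Finset.mem_range.1 hj), zero_mul]
  obtain ⟨j, hj, hAj⟩ := hj
  have := poly_pow hk hdeg (by rw [hcoef, if_pos (by omega), if_neg (by omega), hA, add_zero])
    (by rw [hcoef, if_neg (by omega), if_pos rfl, zero_add]; exact hU) l hdvd j hj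
  rw [hcoef, if_pos hj, if_neg (by omega), add_zero] at this
  exact hAj this

def LU (𝒰 : Ultrafilter I) (n : ℕ) : Prop :=
  ∀ (ι : Type) [Fintype ι], Fintype.card ι ≤ n → ∀ x : I → ι → ℝ, Tendsto x 𝒰 (𝓝 0) →
    ∀ (J : Type) (s : Finset J) (f : J → (ι → ℝ) → ℝ), (∀ j ∈ s, AnalyticAt ℝ (f j) 0) →
    ∃ (κ : Type) (_ : Fintype κ) (z : I → κ → ℝ) (Φ : (κ → ℝ) → ι → ℝ),
      Fintype.card κ ≤ Fintype.card ι ∧ Chart 𝒰 x z Φ ∧ ∀ j ∈ s, NC0 (fun v => f j (Φ v))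

lemma LUm {n : ℕ} (H : LU 𝒰 n) {x : I → κ → ℝ} (hx : Tendsto x 𝒰 (FP κ))
    (hn : Fintype.card κ ≤ n) {J : Type} (s : Finset J) (f : J → (κ → ℝ) → ℝ)
    (hf : ∀ j ∈ s, AnalyticAt ℝ (f j) 0) :
    ∃ (κ' : Type) (_ : Fintype κ') (z : I → κ' → ℝ) (N : κ → κ' → ℕ) (Φ : (κ' → ℝ) → κ → ℝ),
      Fintype.card κ' ≤ Fintype.card κ ∧ MChart 𝒰 x z N Φ ∧ ∀ j ∈ s, NC0 (fun v => f j (Φ v)) := by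
  classical
  obtain ⟨κ', i1, z, Φ, h1, h2, h3⟩ := H κ hn x (hx.mono_right FP_le) (J ⊕ κ)
    (s.disjSum Finset.univ) (fun o => o.elim f (fun i v => v i)) (by
      rintro (j | i) hj
      · exact hf j (by simpa using hj)
      · exact analyticAt_coord i 0)
  have hN : ∀ i, ∃ α, PN α (fun v => Φ v i) := by
    intro i
    have hpos : ∀ᶠ t in (𝒰 : Filter I), 0 < Φ (z t) i := by
      filter_upwards [h2.eq, hx.eventually FP_pos] with t a b
      rw [← a]; exact b i
    rcases h3 (Sum.inr i) (by simp) with h | ⟨α, h⟩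
    · exfalso
      obtain ⟨t, a, b⟩ := (hpos.and ((h2.tz.mono_right FP_le).eventually h)).exists
      simp at b
      linarith
    · exact ⟨α, h.PN_of_chart h2.tz hpos⟩
  choose N hN using hN
  exact ⟨κ', i1, z, N, Φ, h1, ⟨h2, hN⟩, fun j hj => h3 (Sum.inl j) (by simpa using hj)⟩

lemma root_chart [DecidableEq κ] {y : I → κ → ℝ} (hy : Tendsto y 𝒰 (FP κ)) {m : ℕ} (hm : m ≠ 0) :
    MChart 𝒰 y (fun t i => (y t i) ^ ((m:ℝ)⁻¹)) (fun i => m • Pi.single i 1) (fun v i => v i ^ m) := by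
  obtain ⟨h1, h2⟩ := tendsto_FP.1 hy
  rw [tendsto_pi_nhds] at h1
  have hmm : MonoMap (fun i : κ => m • (Pi.single i 1 : κ → ℕ)) (fun v i => v i ^ m) :=
    fun i => (PN_coord i).pow m
  refine ⟨⟨hmm.analyticAt, ?_, ?_, ?_, ?_⟩, hmm⟩
  · ext i; simp [hm]
  · refine tendsto_FP.2 ⟨tendsto_pi_nhds.2 fun i => ?_, ?_⟩
    · have := (h1 i).rpow_const (p := (m:ℝ)⁻¹) (Or.inr (by positivity))
      have hm' : (m:ℝ)⁻¹ ≠ 0 := by positivity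
      simpa [Real.zero_rpow hm'] using this
    · filter_upwards [h2] with t a i
      exact Real.rpow_pos_of_pos (a i) _
  · filter_upwards [h2] with t a
    ext i
    rw [← Real.rpow_natCast, ← Real.rpow_mul (a i).le, inv_mul_cancel₀ (by positivity), Real.rpow_one]
  · refine ⟨_, FP_pos, ?_⟩
    intro v hv v' hv' e
    ext i
    exact (pow_left_inj₀ (hv i).le (hv' i).le hm).1 (congrFun e i)

lemma expo_root [DecidableEq κ] (m : ℕ) (α : κ → ℕ) :
    expo (fun i => m • (Pi.single i 1 : κ → ℕ)) α = m • α := by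
  ext l
  simp [expo_apply, Pi.single_apply, mul_comm]

lemma expo_smul (N : κ → κ' → ℕ) (m : ℕ) (α : κ → ℕ) : expo N (m • α) = m • expo N α := by
  ext l; simp [expo_apply, Finset.mul_sum, mul_assoc]

lemma fam {n : ℕ} (H : LU 𝒰 n) {x : I → κ → ℝ} (hx : Tendsto x 𝒰 (FP κ))
    (hn : Fintype.card κ ≤ n) (k : ℕ) (a : ℕ → (κ → ℝ) → ℝ) (ha : ∀ j < k, AnalyticAt ℝ (a j) 0) :
    ∃ (κ' : Type) (_ : Fintype κ') (y : I → κ' → ℝ) (N : κ → κ' → ℕ) (Ψ : (κ' → ℝ) → κ → ℝ)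
      (γ : ℕ → κ' → ℕ), Fintype.card κ' ≤ Fintype.card κ ∧ MChart 𝒰 x y N Ψ ∧
      (∀ j < k, (∀ᶠ v in 𝓝 0, a j (Ψ v) = 0) ∨ NN ((k - j) • γ j) (fun v => a j (Ψ v))) ∧
      ∀ i < k, ∀ j < k, γ i ≤ γ j ∨ γ j ≤ γ i := by
  classical
  obtain ⟨κ1, i1, y1, N1, Ψ1, c1, m1, h1⟩ := LUm H hx hn (Finset.range k) a
    (fun j hj => ha j (Finset.mem_range.1 hj))
  have hα : ∀ j, ∃ α : κ1 → ℕ, j < k → (∀ᶠ v in 𝓝 0, a j (Ψ1 v) = 0) ∨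
      NN α (fun v => a j (Ψ1 v)) := by
    intro j
    by_cases hj : j < k
    · rcases h1 j (Finset.mem_range.2 hj) with h | ⟨α, h⟩
      · exact ⟨0, fun _ => Or.inl h⟩
      · exact ⟨α, fun _ => Or.inr h⟩
    · exact ⟨0, fun h => absurd h hj⟩
  choose α hα using hα
  have m2 := root_chart m1.ch.tz (Nat.factorial_ne_zero k)
  let β : ℕ → κ1 → ℕ := fun j => (k.factorial / (k - j)) • α j
  have hβ : ∀ j < k, k.factorial • α j = (k - j) • β j := by
    intro j hj
    simp only [β, smul_smul]
    rw [Nat.mul_div_cancel' (Nat.dvd_factorial (by omega) (by omega))]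
  obtain ⟨κ3, i3, y3, N3, Ψ3, c3, m3, h3⟩ := toric (Finset.range k ×ˢ Finset.range k) m2.ch.tz
    (fun p i => (β p.1 i : ℤ) - β p.2 i)
  have m12 := m1.comp m2
  refine ⟨κ3, i3, y3, _, _, fun j => expo N3 (β j), c3.trans c1, m12.comp m3, ?_, ?_⟩
  · intro j hj
    rcases hα j hj with h | h
    · left
      exact ((m2.mono.comp m3.mono m3.ch.zero).tendsto_nhds
        (by rw [m3.ch.zero]; exact m2.ch.zero)).eventually h
    · right
      have := (h.comp m2.mono m2.ch.zero).comp m3.mono m3.ch.zero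
      rwa [expo_root, hβ j hj, expo_smul] at this
  · intro i hi j hj
    have key : ∀ l, expoZ N3 (fun l => (β i l : ℤ) - β j l) l =
        (expo N3 (β i) l : ℤ) - expo N3 (β j) l := by
      intro l
      simp only [expoZ, expo_apply, sub_mul, Finset.sum_sub_distrib]
      push_cast; rfl
    rcases h3 (i, j) (by simp [hi, hj]) with h | h
    · right; intro l
      show expo N3 (β j) l ≤ expo N3 (β i) l
      have := h l
      simp only [key, Pi.zero_apply] at this; omega
    · left; intro l
      show expo N3 (β i) l ≤ expo N3 (β j) l
      have := h l
      simp only [key, Pi.zero_apply] at this; omega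

end LUsec

section LUsec
variable {I : Type} {𝒰 : Ultrafilter I}
variable {κ κ' κ'' : Type} [Fintype κ] [Fintype κ'] [Fintype κ'']

lemma NN.div_mono {β γ : κ → ℕ} {f : (κ → ℝ) → ℝ} {m : ℕ} (h : NN (m • γ) f) (hβ : β ≤ γ) :
    ∃ A : (κ → ℝ) → ℝ, AnalyticAt ℝ A 0 ∧ (∀ᶠ v in 𝓝 0, f v = mono β v ^ m * A v) ∧
      (β = γ → A 0 ≠ 0) := by
  obtain ⟨u, h1, h2, h3⟩ := h
  obtain ⟨δ, rfl⟩ : ∃ δ, γ = β + δ := ⟨γ - β, by ext l; have : β l ≤ γ l := hβ l; simp; omega⟩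
  refine ⟨fun v => mono (m • δ) v * u v, (analyticAt_mono _ 0).mul h1, ?_, ?_⟩
  · filter_upwards [h3] with v hv
    rw [hv, smul_add, mono_add, mono_smul]; ring
  · intro e
    have : δ = 0 := by
      ext l
      have := congrFun e l
      simpa using this
    rw [this]; simpa using h2

def QIH (𝒰 : Ultrafilter I) (n k : ℕ) : Prop :=
  ∀ (κ : Type) [Fintype κ], Fintype.card κ ≤ n → ∀ (x : I → κ → ℝ) (s : I → ℝ)
    (f : (κ → ℝ) × ℝ → ℝ), Tendsto x 𝒰 (FP κ) → Tendsto s 𝒰 (𝓝 0) → AnalyticAt ℝ f 0 →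
    (∃ j < k, D^[j] f 0 ≠ 0) → QC 𝒰 x s f

lemma Qnorm {n : ℕ} (H : LU 𝒰 n) {k : ℕ} (hk : 0 < k) (IH : QIH 𝒰 n k)
    {x : I → κ → ℝ} (hx : Tendsto x 𝒰 (FP κ)) (hn : Fintype.card κ ≤ n)
    {s : I → ℝ} (hs : Tendsto s 𝒰 (𝓝 0)) {f U : (κ → ℝ) × ℝ → ℝ} {a : ℕ → (κ → ℝ) → ℝ}
    (ha : ∀ j < k, AnalyticAt ℝ (a j) 0) (ha0 : ∀ j < k, a j 0 = 0)
    (hak : ∀ᶠ v in 𝓝 0, a (k-1) v = 0) (hU : AnalyticAt ℝ U 0) (hU0 : U 0 ≠ 0)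
    (hf : ∀ᶠ p in 𝓝 0, f p = ∑ j ∈ Finset.range k, a j p.1 * p.2 ^ j + p.2 ^ k * U p) :
    QC 𝒰 x s f := by
  classical
  obtain ⟨κ1, i1, y, N, Ψ, γ, c1, m1, h1, h2⟩ := fam H hx hn k a ha
  let Θ : (κ1 → ℝ) × ℝ → (κ → ℝ) × ℝ := fun p => (Ψ p.1, p.2)
  have anΘ : AnalyticAt ℝ Θ 0 :=
    AnalyticAt.prod (analyticAt_comp0 m1.ch.an analyticAt_fst rfl) analyticAt_snd
  have Θ0 : Θ 0 = 0 := by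
    show (Ψ 0, (0:ℝ)) = 0
    rw [m1.ch.zero]; rfl
  have tΘ : Tendsto Θ (𝓝 0) (𝓝 0) := by
    have := anΘ.continuousAt.tendsto
    rwa [Θ0] at this
  have tfst : Tendsto (fun p : (κ1 → ℝ) × ℝ => p.1) (𝓝 0) (𝓝 0) := continuous_fst.tendsto 0
  have anU1 : AnalyticAt ℝ (fun p => U (Θ p)) 0 := analyticAt_comp0 hU anΘ Θ0
  have U10 : U (Θ 0) ≠ 0 := by rw [Θ0]; exact hU0
  have reduce : ∀ f1 : (κ1 → ℝ) × ℝ → ℝ, (∀ᶠ p in 𝓝 0, f (Θ p) = f1 p) → QC 𝒰 y s f1 →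
      QC 𝒰 x s f := by
    intro f1 hf1 hq
    refine Qpre m1 c1 (θ := fun p => p.2) analyticAt_snd rfl (s' := s) (by simp)
      (fun v _ w w' h => h) 0 ?_ hq
    filter_upwards [hf1] with p hp
    rw [mono_zero, one_mul]; exact hp
  by_cases hall : ∀ j < k, ∀ᶠ v in 𝓝 0, a j (Ψ v) = 0
  · refine reduce (fun p => p.2 ^ k * U (Θ p)) ?_ (Qbase m1.ch.tz hs k anU1 U10 (by simp))
    have hall' : ∀ᶠ p in 𝓝 (0 : (κ1 → ℝ) × ℝ), ∀ j ∈ Finset.range k, a j (Ψ p.1) = 0 :=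
      (Finset.eventually_all _).2 fun j hj => tfst.eventually (hall j (Finset.mem_range.1 hj))
    filter_upwards [tΘ.eventually hf, hall'] with p e1 e2
    rw [e1, Finset.sum_eq_zero, zero_add]
    intro j hj
    simp only [Θ]
    rw [e2 j hj, zero_mul]
  rw [not_forall] at hall
  let S : Finset ℕ := (Finset.range k).filter fun j => ¬ ∀ᶠ v in 𝓝 0, a j (Ψ v) = 0
  have hS : S.Nonempty := by
    obtain ⟨j, hjh⟩ := hall
    rw [Classical.not_imp] at hjh
    obtain ⟨hj, h⟩ := hjh
    exact ⟨j, by simp only [S, Finset.mem_filter, Finset.mem_range]; exact ⟨hj, h⟩⟩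
  obtain ⟨j0, hj0, hmin⟩ := S.exists_min_image (fun j => ∑ l, γ j l) hS
  simp only [S, Finset.mem_filter, Finset.mem_range] at hj0 hmin
  set β := γ j0 with hβ
  have hle : ∀ j < k, (¬ ∀ᶠ v in 𝓝 0, a j (Ψ v) = 0) → β ≤ γ j := by
    intro j hj hnz
    rcases h2 j0 hj0.1 j hj with h | h
    · exact h
    · have h3 := hmin j ⟨hj, hnz⟩
      have : ∑ l, γ j l = ∑ l, β l := le_antisymm (Finset.sum_le_sum fun l _ => h l) h3
      have := (Finset.sum_eq_sum_iff_of_le (fun l _ => h l)).1 this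
      exact fun l => (this l (Finset.mem_univ l)).ge
  have hA : ∀ j, ∃ A : (κ1 → ℝ) → ℝ, j < k → (AnalyticAt ℝ A 0 ∧
      (∀ᶠ v in 𝓝 0, a j (Ψ v) = mono β v ^ (k - j) * A v) ∧ (j = j0 → A 0 ≠ 0) ∧
      ((∀ᶠ v in 𝓝 0, a j (Ψ v) = 0) → A 0 = 0)) := by
    intro j
    by_cases hj : j < k
    · by_cases hz : ∀ᶠ v in 𝓝 0, a j (Ψ v) = 0
      · refine ⟨fun _ => 0, fun _ => ⟨analyticAt_const, by simpa using hz, ?_, by simp⟩⟩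
        rintro rfl
        exact absurd hz hj0.2
      · have hnn := (h1 j hj).resolve_left hz
        obtain ⟨A, b1, b2, b3⟩ := hnn.div_mono (hle j hj hz)
        refine ⟨A, fun _ => ⟨b1, b2, ?_, fun h => absurd h hz⟩⟩
        rintro rfl
        exact b3 rfl
    · exact ⟨fun _ => 0, fun h => absurd h hj⟩
  choose A hA using hA
  have hβ0 : mono β 0 = 0 := by
    have : ∃ l, β l ≠ 0 := by
      by_contra hcon
      push Not at hcon
      have hb : β = 0 := funext hcon
      have e := (hA j0 hj0.1).2.1.self_of_nhds
      rw [m1.ch.zero, ha0 j0 hj0.1, hb, mono_zero, one_pow, one_mul] at e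
      exact (hA j0 hj0.1).2.2.1 rfl e.symm
    obtain ⟨l, hl⟩ := this
    exact Finset.prod_eq_zero (Finset.mem_univ l) (by simp [hl])
  have hAev : ∀ᶠ p in 𝓝 (0 : (κ1 → ℝ) × ℝ), ∀ j ∈ Finset.range k,
      a j (Ψ p.1) = mono β p.1 ^ (k - j) * A j p.1 :=
    (Finset.eventually_all _).2 fun j hj => tfst.eventually (hA j (Finset.mem_range.1 hj)).2.1
  let f1 : (κ1 → ℝ) × ℝ → ℝ := fun p =>
    ∑ j ∈ Finset.range k, mono β p.1 ^ (k - j) * A j p.1 * p.2 ^ j + p.2 ^ k * U (Θ p)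
  refine reduce f1 ?_ ?_
  · filter_upwards [tΘ.eventually hf, hAev] with p e1 e2
    rw [e1]
    simp only [f1]
    congr 1
    refine Finset.sum_congr rfl fun j hj => ?_
    rw [← e2 j hj]
  have hy := m1.ch.tz
  rcases tricho 𝒰 (fun t => s t / mono β (y t)) with ⟨l, hl⟩ | hinf
  swap
  · exact Qinf hy hs β k hinf (fun j hj => (hA j hj).1) anU1 U10 (by simp [f1])
  let θ : (κ1 → ℝ) × ℝ → ℝ := fun p => mono β p.1 * (l + p.2)
  have anmono : AnalyticAt ℝ (fun p : (κ1 → ℝ) × ℝ => mono β p.1) 0 :=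
    analyticAt_comp0 (analyticAt_mono β 0) analyticAt_fst rfl
  have anl : AnalyticAt ℝ (fun p : (κ1 → ℝ) × ℝ => l + p.2) 0 := analyticAt_const.add analyticAt_snd
  have anθ : AnalyticAt ℝ θ 0 := anmono.mul anl
  have θ0 : θ 0 = 0 := by
    show mono β 0 * _ = 0
    rw [hβ0, zero_mul]
  have anA : ∀ j < k, AnalyticAt ℝ (fun p : (κ1 → ℝ) × ℝ => A j p.1) 0 := fun j hj =>
    analyticAt_comp0 (hA j hj).1 analyticAt_fst rfl
  have anpair : AnalyticAt ℝ (fun p : (κ1 → ℝ) × ℝ => (p.1, θ p)) 0 :=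
    AnalyticAt.prod analyticAt_fst anθ
  let f2 : (κ1 → ℝ) × ℝ → ℝ := fun p =>
    ∑ j ∈ Finset.range k, A j p.1 * (l + p.2) ^ j + (l + p.2) ^ k * U (Θ (p.1, θ p))
  have anf2 : AnalyticAt ℝ f2 0 := by
    refine (analyticAt_sum' fun j hj => ?_).add ((anl.pow k).mul ?_)
    · exact (anA j (Finset.mem_range.1 hj)).mul (anl.pow j)
    · exact analyticAt_comp0 (f := fun p => U (Θ p)) anU1 anpair (by rw [θ0]; rfl)
  refine Qpre (MChart.refl hy) le_rfl (θ := θ) anθ θ0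
    (s' := fun t => s t / mono β (y t) - l) ?_ ?_ (k • β) (f2 := f2) ?_ ?_
  · filter_upwards [hy.eventually FP_pos] with t ht
    simp only [θ]
    have := (mono_pos β ht).ne'
    field_simp
    ring
  · intro v hv w w' h
    have h' := mul_left_cancel₀ (mono_pos β hv).ne' h
    simpa using h'
  · filter_upwards with p
    simp only [f1, f2, mono_smul, mul_add, Finset.mul_sum]
    congr 1
    · refine Finset.sum_congr rfl fun j hj => ?_
      have := Finset.mem_range.1 hj
      have e : mono β p.1 ^ k = mono β p.1 ^ (k - j) * mono β p.1 ^ j := by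
        rw [← pow_add]; congr 1; omega
      rw [e]; simp only [θ]; rw [mul_pow]; ring
    · simp only [θ]; rw [mul_pow]; ring
  · refine IH κ1 (c1.trans hn) y _ f2 hy (by simpa using hl.sub_const l) anf2 ?_
    refine finite_case hk anf2 (fun j => A j 0) (U 0) l ?_ hU0 ?_ ⟨j0, hj0.1, (hA j0 hj0.1).2.2.1 rfl⟩
    · filter_upwards with w
      simp only [f2]
      congr 2
      have : Θ (0, θ (0, w)) = 0 := by
        simp only [Θ, θ, hβ0, zero_mul, m1.ch.zero]; rfl
      rw [this]
    · exact (hA (k-1) (by omega)).2.2.2 ((m1.mono.tendsto_nhds m1.ch.zero).eventually hak)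

theorem Qall {n : ℕ} (H : LU 𝒰 n) (k : ℕ) : QIH 𝒰 n k := by
  induction k with
  | zero =>
    intro κ _ _ x s f _ _ _ ⟨j, hj, _⟩
    omega
  | succ k IH =>
    intro κ _ hn x s f hx hs hf hex
    by_cases hlt : ∃ j < k, D^[j] f 0 ≠ 0
    · exact IH κ hn x s f hx hs hf hlt
    push Not at hlt
    have hk0 : D^[k] f 0 ≠ 0 := by
      obtain ⟨j, hj, hjn⟩ := hex
      rcases Nat.lt_succ_iff_lt_or_eq.1 hj with h | rfl
      · exact absurd (hlt j h) hjn
      · exact hjn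
    rcases Nat.eq_zero_or_pos k with rfl | hk
    · exact Qbase hx hs 0 hf (by simpa using hk0) (by simp)
    classical
    obtain ⟨φ, hφ, φ0, hφe⟩ := ift (Dit_an hf (k-1)) (hlt (k-1) (by omega)) (by
      rw [← Function.iterate_succ_apply' D, show (k-1).succ = k by omega]; exact hk0)
    let f1 : (κ → ℝ) × ℝ → ℝ := fun p => f (p.1, p.2 + φ p.1)
    have s0 : (fun p : (κ → ℝ) × ℝ => (p.1, p.2 + φ p.1)) 0 = 0 := by
      simp [φ0]
    have anf1 : AnalyticAt ℝ f1 0 := analyticAt_comp0 hf (shift_an hφ) s0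
    have tφ : Tendsto φ (𝓝 0) (𝓝 0) := by
      have := hφ.continuousAt.tendsto; rwa [φ0] at this
    have hx0 : Tendsto x 𝒰 (𝓝 0) := hx.mono_right FP_le
    refine Qpre (MChart.refl hx) le_rfl (θ := fun p => p.2 + φ p.1)
      (s' := fun t => s t - φ (x t)) (f2 := f1) ?_ ?_ (by simp) ?_ 0 (by simp [f1]) ?_
    · exact analyticAt_snd.add (analyticAt_comp0 hφ analyticAt_fst rfl)
    · simp [φ0]
    · intro v _ w w' h; simpa using h
    obtain ⟨a, U, b1, b2, b3, b4, b5⟩ := taylor k f1 anf1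
    have D0 : ∀ j, D^[j] f1 0 = D^[j] f 0 := by
      intro j
      have := (Dit_shift hf hφ φ0 j).self_of_nhds
      rw [this]
      exact congrArg _ s0
    refine Qnorm H hk IH hx hn (by simpa using hs.sub (tφ.comp hx0)) (fun j _ => b1 j) ?_ ?_ b2 ?_ b3
    · intro j hj
      have := (b4 j hj).self_of_nhds
      rw [show ((0 : κ → ℝ),(0:ℝ)) = 0 from rfl, D0, hlt j hj] at this
      simpa [Nat.factorial_ne_zero] using this.symm
    · have h1 := tendsto_inl.eventually (Dit_shift hf hφ φ0 (k-1))
      filter_upwards [b4 (k-1) (by omega), h1, hφe] with v e1 e2 e3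
      have e2' : D^[k-1] f1 (v, 0) = D^[k-1] f (v, 0 + φ v) := e2
      rw [e2', zero_add, e3] at e1
      simpa [Nat.factorial_ne_zero] using e1.symm
    · intro h0
      rw [D0, h0, mul_zero] at b5
      exact hk0 b5

end LUsec

section LUsec
variable {I : Type} {𝒰 : Ultrafilter I}
variable {κ κ' κ'' : Type} [Fintype κ] [Fintype κ'] [Fintype κ'']

lemma exists_line {E : Type*} [NormedAddCommGroup E] [NormedSpace ℝ E] {F : E → ℝ}
    (hF : AnalyticAt ℝ F 0) (hz : ¬ ∀ᶠ x in 𝓝 0, F x = 0) :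
    ∃ v : E, ¬ ∀ᶠ t in 𝓝 (0:ℝ), F (t • v) = 0 := by
  by_contra hcon
  push Not at hcon
  obtain ⟨r, hr, hball⟩ := Metric.eventually_nhds_iff_ball.1 hF.eventually_analyticAt
  apply hz
  refine Metric.eventually_nhds_iff_ball.2 ⟨r, hr, fun v hv => ?_⟩
  let S : Set ℝ := {t | t • v ∈ Metric.ball (0:E) r}
  have hS : Convex ℝ S := by
    have : S = (LinearMap.toSpanSingleton ℝ E v) ⁻¹' Metric.ball (0:E) r := by
      ext t; simp [S]
    rw [this]
    exact (convex_ball _ _).linear_preimage _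
  have han : AnalyticOnNhd ℝ (fun t : ℝ => F (t • v)) S := by
    intro t ht
    have h1 : AnalyticAt ℝ (fun t : ℝ => t • v) t :=
      ((ContinuousLinearMap.toSpanSingleton ℝ v).analyticAt t)
    exact AnalyticAt.comp (f := fun t : ℝ => t • v) (hball _ ht) h1
  have h0 : (0:ℝ) ∈ S := by simp [S, hr]
  have h1 : (1:ℝ) ∈ S := by simpa [S] using hv
  have := han.eqOn_zero_of_preconnected_of_eventuallyEq_zero hS.isPreconnected h0 (hcon v) h1
  simpa using this

lemma exists_line' {ι : Type} [Fintype ι] [Nonempty ι] {F : (ι → ℝ) → ℝ}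
    (hF : AnalyticAt ℝ F 0) (hz : ¬ ∀ᶠ x in 𝓝 0, F x = 0) :
    ∃ (v : ι → ℝ) (i : ι), v i ≠ 0 ∧ ¬ ∀ᶠ t in 𝓝 (0:ℝ), F (t • v) = 0 := by
  classical
  obtain ⟨v, hv⟩ := exists_line hF hz
  by_cases h0 : v = 0
  · subst h0
    have hF0 : F 0 ≠ 0 := by
      intro h; apply hv; simp [h]
    obtain ⟨i⟩ := ‹Nonempty ι›
    refine ⟨Pi.single i 1, i, by simp, fun hcon => hF0 ?_⟩
    simpa using hcon.self_of_nhds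
  · obtain ⟨i, hi⟩ := Function.ne_iff.1 h0
    exact ⟨v, i, hi, hv⟩

def LUc (𝒰 : Ultrafilter I) {ι : Type} [Fintype ι] (x : I → ι → ℝ) {J : Type} (s : Finset J)
    (f : J → (ι → ℝ) → ℝ) : Prop :=
    ∃ (κ : Type) (_ : Fintype κ) (z : I → κ → ℝ) (Φ : (κ → ℝ) → ι → ℝ),
      Fintype.card κ ≤ Fintype.card ι ∧ Chart 𝒰 x z Φ ∧ ∀ j ∈ s, NC0 (fun v => f j (Φ v))

lemma Chart.post {E F : Type*} [NormedAddCommGroup E] [NormedSpace ℝ E] [NormedAddCommGroup F]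
    [NormedSpace ℝ F] {x : I → E} {x' : I → F} {z : I → κ → ℝ} {Φ : (κ → ℝ) → E}
    (h : Chart 𝒰 x z Φ) {P : E → F} (hP : AnalyticAt ℝ P 0) (P0 : P 0 = 0)
    (hinj : Function.Injective P) (e : ∀ᶠ t in (𝒰 : Filter I), x' t = P (x t)) :
    Chart 𝒰 x' z (fun v => P (Φ v)) where
  an := analyticAt_comp0 hP h.an h.zero
  zero := by rw [h.zero, P0]
  tz := h.tz
  eq := by filter_upwards [e, h.eq] with t a b; rw [a, b]
  inj := by
    obtain ⟨S, hS, iS⟩ := h.inj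
    exact ⟨S, hS, hinj.comp_injOn iS⟩

lemma LU_step {n : ℕ} (H : LU 𝒰 n) {ι : Type} [Fintype ι] (hι : Fintype.card ι = n + 1)
    {x : I → ι → ℝ} (hx : Tendsto x 𝒰 (𝓝 0)) {J : Type} (s : Finset J)
    (f : J → (ι → ℝ) → ℝ) (hf : ∀ j ∈ s, AnalyticAt ℝ (f j) 0) : LUc 𝒰 x s f := by
  classical
  have : Nonempty ι := Fintype.card_pos_iff.1 (by omega)
  let s' := s.filter fun j => ¬ ∀ᶠ v in 𝓝 0, f j v = 0
  let F : (ι → ℝ) → ℝ := fun v => ∏ j ∈ s', f j v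
  have anF : AnalyticAt ℝ F 0 := Finset.analyticAt_fun_prod _ fun j hj => hf j (Finset.mem_filter.1 hj).1
  have hF : ¬ ∀ᶠ v in 𝓝 0, F v = 0 := by
    intro h
    obtain ⟨j, hj, h'⟩ := germ_prod_eq_zero s' f (fun j hj => hf j (Finset.mem_filter.1 hj).1) h
    exact (Finset.mem_filter.1 hj).2 h'
  obtain ⟨v, i0, hv, hline⟩ := exists_line' anF hF
  let K := {l : ι // l ≠ i0}
  have cK : Fintype.card K = n := by
    simp only [K, Fintype.card_subtype_compl, Fintype.card_subtype_eq]; omega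
  let P : (K → ℝ) × ℝ → ι → ℝ := fun p l => if h : l = i0 then p.2 * v i0 else p.1 ⟨l, h⟩ + p.2 * v l
  have anP : AnalyticAt ℝ P 0 := by
    rw [analyticAt_pi_iff]
    intro l
    by_cases h : l = i0
    · simp only [P, h, dite_true]
      exact analyticAt_snd.mul analyticAt_const
    · simp only [P, h, dite_false]
      exact (analyticAt_comp0 (analyticAt_coord _ 0) analyticAt_fst rfl).add
        (analyticAt_snd.mul analyticAt_const)
  have P0 : P 0 = 0 := by
    ext l; by_cases h : l = i0 <;> simp [P, h]
  have Pinj : Function.Injective P := by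
    intro p q e
    have e2 : p.2 = q.2 := by
      have := congrFun e i0
      simpa [P, hv] using this
    refine Prod.ext ?_ e2
    ext ⟨l, hl⟩
    have := congrFun e l
    simpa [P, hl, e2] using this
  have Pline : ∀ t, P (0, t) = t • v := by
    intro t; ext l
    by_cases h : l = i0 <;> simp [P, h]
  let τ : I → ℝ := fun t => x t i0 / v i0
  let w : I → K → ℝ := fun t l => x t l - τ t * v l
  have hx' := tendsto_pi_nhds.1 hx
  have tτ : Tendsto τ 𝒰 (𝓝 0) := by simpa using (hx' i0).div_const (v i0)
  have tw : Tendsto w 𝒰 (𝓝 0) := by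
    refine tendsto_pi_nhds.2 fun l => ?_
    simpa using (hx' l).sub (tτ.mul_const (v l))
  have hxP : ∀ t, x t = P (w t, τ t) := by
    intro t
    ext l
    by_cases h : l = i0
    · subst h; simp [P, τ, hv]
    · simp [P, h, w]
  by_cases hdrop : ∃ l : K, ∀ᶠ t in (𝒰 : Filter I), w t l = 0
  · obtain ⟨l0, hl0⟩ := hdrop
    let K2 := {l : K // l ≠ l0}
    let Q : (Option K2 → ℝ) → (K → ℝ) × ℝ :=
      fun u => (fun l => if h : l = l0 then 0 else u (some ⟨l, h⟩), u none)
    have anQ : AnalyticAt ℝ Q 0 := by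
      refine AnalyticAt.prod ?_ (analyticAt_coord none 0)
      rw [analyticAt_pi_iff]
      intro l
      by_cases h : l = l0
      · simp only [h, dite_true]; exact analyticAt_const
      · simp only [h, dite_false]; exact analyticAt_coord _ 0
    have Q0 : Q 0 = 0 := by
      simp only [Q]; ext l <;> simp
    have Qinj : Function.Injective Q := by
      intro p q e
      simp only [Q, Prod.mk.injEq] at e
      ext (_ | ⟨l, hl⟩)
      · exact e.2
      · have := congrFun e.1 l
        simpa [hl] using this
    let y : I → Option K2 → ℝ := fun t o => o.elim (τ t) (fun l => w t l.1)
    have ty : Tendsto y 𝒰 (𝓝 0) := by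
      refine tendsto_pi_nhds.2 ?_
      rintro (_ | l)
      · exact tτ
      · exact tendsto_pi_nhds.1 tw l.1
    have cK2 : Fintype.card (Option K2) = n := by
      have : 0 < Fintype.card K := Fintype.card_pos_iff.2 ⟨l0⟩
      simp only [K2, Fintype.card_option, Fintype.card_subtype_compl, Fintype.card_subtype_eq]
      omega
    have PQ0 : P (Q 0) = 0 := by rw [Q0, P0]
    have anPQ : AnalyticAt ℝ (fun u => P (Q u)) 0 := analyticAt_comp0 anP anQ Q0
    obtain ⟨κ, i1, z, Φ, a1, a2, a3⟩ := H (Option K2) cK2.le y ty J s (fun j u => f j (P (Q u)))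
      (fun j hj => analyticAt_comp0 (hf j hj) anPQ PQ0)
    refine ⟨κ, i1, z, _, by omega, a2.post anPQ PQ0 (Pinj.comp Qinj) ?_, a3⟩
    filter_upwards [hl0] with t ht
    rw [hxP t]
    congr 1
    simp only [Q, y]
    refine Prod.ext ?_ rfl
    ext l
    by_cases h : l = l0
    · subst h; simp [ht]
    · simp [h]
  · have hsgn : ∀ l : K, ∃ σ : ℝ, σ * σ = 1 ∧ ∀ᶠ t in (𝒰 : Filter I), 0 < σ * w t l := by
      intro l
      rcases sign_tricho 𝒰 (fun t => w t l) with h | h | h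
      · exact absurd ⟨l, h⟩ hdrop
      · exact ⟨1, by norm_num, by simpa using h⟩
      · exact ⟨-1, by norm_num, by simpa using h⟩
    choose σ hσ hpos using hsgn
    let R : (K → ℝ) × ℝ → (K → ℝ) × ℝ := fun p => (fun l => σ l * p.1 l, p.2)
    have anR : AnalyticAt ℝ R 0 := by
      refine AnalyticAt.prod ?_ analyticAt_snd
      rw [analyticAt_pi_iff]
      exact fun l => analyticAt_const.mul (analyticAt_comp0 (analyticAt_coord _ 0) analyticAt_fst rfl)
    have R0 : R 0 = 0 := by simp only [R]; ext l <;> simp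
    have RR : ∀ p, R (R p) = p := by
      intro p
      simp only [R, ← mul_assoc, hσ, one_mul]
    have Rinj : Function.Injective R := fun p q e => by rw [← RR p, e, RR]
    let y : I → K → ℝ := fun t l => σ l * w t l
    have ty : Tendsto y 𝒰 (FP K) := by
      refine tendsto_FP.2 ⟨tendsto_pi_nhds.2 fun l => ?_, eventually_all.2 hpos⟩
      simpa using (tendsto_pi_nhds.1 tw l).const_mul (σ l)
    have anPR : AnalyticAt ℝ (fun p => P (R p)) 0 := analyticAt_comp0 anP anR R0
    have PR0 : P (R 0) = 0 := by rw [R0, P0]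
    have anG : AnalyticAt ℝ (fun p => F (P (R p))) 0 := analyticAt_comp0 anF anPR PR0
    obtain ⟨k, hk⟩ := exists_reg anG (by
      intro h
      apply hline
      filter_upwards [h] with t ht
      have : R (0, t) = (0, t) := by simp only [R]; ext l <;> simp
      rwa [this, Pline] at ht)
    obtain ⟨κ, i1, z, N, Φ, a1, a2, a3, a4⟩ := Qall H (k+1) K cK.le y τ _ ty tτ anG ⟨k, by omega, hk⟩
    have hch : Chart 𝒰 x z (fun u => P (R (Φ u))) := by
      refine a2.post anPR PR0 (Pinj.comp Rinj) ?_
      filter_upwards with t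
      rw [hxP t]
      congr 1
      exact (RR _).symm
    have anf : ∀ j ∈ s, AnalyticAt ℝ (fun u => f j (P (R (Φ u)))) 0 := fun j hj =>
      analyticAt_comp0 (hf j hj) hch.an hch.zero
    have tch : Tendsto (fun u => P (R (Φ u))) (𝓝 0) (𝓝 0) := by
      have := hch.an.continuousAt.tendsto
      rwa [hch.zero] at this
    rcases a4 with a4 | a4
    · refine ⟨κ, i1, z, _, by omega, hch, ?_⟩
      intro j hj
      by_cases hz : ∀ᶠ v in 𝓝 0, f j v = 0
      · exact Or.inl (tch.eventually hz)
      · right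
        have hj' : j ∈ s' := Finset.mem_filter.2 ⟨hj, hz⟩
        refine NC_factor (anf j hj) (h := fun u => ∏ i ∈ s'.erase j, f i (P (R (Φ u)))) ?_ ?_
        · exact Finset.analyticAt_fun_prod _ fun i hi =>
            anf i (Finset.mem_filter.1 (Finset.mem_of_mem_erase hi)).1
        · refine a4.congr ?_
          filter_upwards with u
          exact Finset.mul_prod_erase s' (fun i => f i (P (R (Φ u)))) hj'
    · obtain ⟨κ2, i2, z2, N2, Φ2, b1, b2, b3⟩ := LUm H hch.tz (by omega) s _ anf
      exact ⟨κ2, i2, z2, _, by omega, hch.comp b2.ch b2.tendsto, b3⟩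

theorem LUall (n : ℕ) : LU 𝒰 n := by
  induction n with
  | zero =>
    intro ι _ hι x hx J s f hf
    have : IsEmpty ι := Fintype.card_eq_zero_iff.1 (by omega)
    refine ⟨ι, inferInstance, x, fun v => v, le_rfl,
      ⟨analyticAt_id, rfl, tendsto_FP.2 ⟨hx, by simp⟩, by simp, univ, univ_mem, fun a _ b _ h => h⟩, ?_⟩
    intro j hj
    by_cases h0 : f j 0 = 0
    · left
      filter_upwards with v
      rw [Subsingleton.elim v 0, h0]
    · exact Or.inr ⟨0, NN_unit (hf j hj) h0⟩
  | succ n ih =>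
    intro ι _ hι x hx J s f hf
    rcases Nat.lt_or_ge n (Fintype.card ι) with h | h
    · exact LU_step ih (by omega) hx s f hf
    · exact ih ι h x hx J s f hf

end LUsec

section IFTan
variable {F : Type*} [NormedAddCommGroup F] [NormedSpace ℝ F] [CompleteSpace F]

theorem iftan {G : ℝ × F → F} {r : F} (hG : ContDiffAt ℝ 1 G (0, r))
    (h0 : ∀ᶠ ξ in 𝓝 r, G (0, ξ) = ξ - r)
    (han : ∀ᶠ p in 𝓝 ((0:ℝ), r), 0 < p.1 → AnalyticAt ℝ G p) :
    ∃ ξ : ℝ → F, Tendsto ξ (𝓝[>] 0) (𝓝 r) ∧ ∀ᶠ τ in 𝓝[>] 0, AnalyticAt ℝ ξ τ ∧ G (τ, ξ τ) = 0 := by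
  have one : (1 : WithTop ℕ∞) ≠ 0 := one_ne_zero
  have hd : DifferentiableAt ℝ G (0, r) := hG.differentiableAt one
  have hinv0 : fderiv ℝ G (0, r) ∘L .inr ℝ ℝ F = ContinuousLinearMap.id ℝ F := by
    have h1 : HasFDerivAt (fun ξ : F => G (0, ξ)) (fderiv ℝ G (0, r) ∘L .inr ℝ ℝ F) r := by
      have : HasFDerivAt (fun ξ : F => ((0:ℝ), ξ)) (.inr ℝ ℝ F) r := hasFDerivAt_prodMk_right 0 r
      exact HasFDerivAt.comp r (hd.hasFDerivAt) this
    have h2 : HasFDerivAt (fun ξ : F => G (0, ξ)) (ContinuousLinearMap.id ℝ F) r := by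
      have : HasFDerivAt (fun ξ : F => ξ - r) (ContinuousLinearMap.id ℝ F) r :=
        (hasFDerivAt_id r).sub_const r
      exact this.congr_of_eventuallyEq h0
    exact h1.unique h2
  have hinv : (fderiv ℝ G (0, r) ∘L .inr ℝ ℝ F).IsInvertible := by
    rw [hinv0]; exact ⟨ContinuousLinearEquiv.refl ℝ F, rfl⟩
  set ξ := hG.implicitFunction one hinv with hξ
  have G0 : G (0, r) = 0 := by simpa using h0.self_of_nhds
  have ξ0 : ξ 0 = r := hG.implicitFunction_apply_self one hinv
  have ξc : ContDiffAt ℝ 1 ξ 0 := hG.contDiffAt_implicitFunction one hinv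
  have ξeq : ∀ᶠ τ in 𝓝 0, G (τ, ξ τ) = 0 := by
    have := hG.eventually_apply_implicitFunction one hinv
    rw [G0] at this
    exact this
  have tξ : Tendsto (fun τ => (τ, ξ τ)) (𝓝 0) (𝓝 ((0:ℝ), r)) := by
    have := (continuousAt_id (x := (0:ℝ))).prodMk ξc.continuousAt
    have h := this.tendsto
    simp only [id, ξ0] at h
    exact h
  have hinv' : ∀ᶠ p in 𝓝 ((0:ℝ), r), (fderiv ℝ G p ∘L .inr ℝ ℝ F).IsInvertible := by
    have c1 : ContinuousAt (fderiv ℝ G) (0, r) := (hG.fderiv_right (m := 0) (by simp)).continuousAt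
    have c2 : ContinuousAt (fun p => fderiv ℝ G p ∘L .inr ℝ ℝ F) (0, r) :=
      c1.clm_comp continuousAt_const
    have h := c2.tendsto
    obtain ⟨e, he⟩ := hinv
    rw [← he] at h
    exact h.eventually (ContinuousLinearEquiv.nhds e)
  have evc : ∀ᶠ τ in 𝓝 0, ContinuousAt ξ τ := by
    have := ξc.eventually (by simp)
    filter_upwards [this] with τ h using h.continuousAt
  refine ⟨ξ, ?_, ?_⟩
  · have := ξc.continuousAt.tendsto
    rw [ξ0] at this
    exact this.mono_left nhdsWithin_le_nhds
  · filter_upwards [self_mem_nhdsWithin, nhdsWithin_le_nhds ξeq,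
      nhdsWithin_le_nhds ξeq.eventually_nhds, nhdsWithin_le_nhds evc,
      nhdsWithin_le_nhds (tξ.eventually hinv'), nhdsWithin_le_nhds (tξ.eventually han)]
      with τ hτ h1 h2 h3 h4 h5
    refine ⟨?_, h1⟩
    have an := h5 hτ
    have cd : ContDiffAt ℝ ⊤ G (τ, ξ τ) := an.contDiffAt
    have a := cd.contDiffAt_implicitFunction (by simp) h4
    have a' : AnalyticAt ℝ (cd.implicitFunction (by simp) h4) τ := a.analyticAt
    refine a'.congr ?_
    have e := cd.eventually_apply_eq_iff_implicitFunction (by simp) h4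
    have t : Tendsto (fun s => (s, ξ s)) (𝓝 τ) (𝓝 (τ, ξ τ)) :=
      (continuousAt_id (x := τ)).prodMk h3
    filter_upwards [t.eventually e, h2] with s e1 e2
    exact e1.1 (by rw [e2, h1])

end IFTan

lemma eN_an {t : ℝ} (ht : 0 < t) : AnalyticAt ℝ expNegInvGlue t := by
  have : AnalyticAt ℝ (fun x : ℝ => Real.exp (-x⁻¹)) t :=
    (analyticAt_id.inv ht.ne').neg.rexp
  refine this.congr ?_
  filter_upwards [lt_mem_nhds ht] with x hx
  simp [expNegInvGlue, not_le.2 hx]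

lemma eN_eq {t : ℝ} (ht : 0 < t) : expNegInvGlue t = Real.exp (-t⁻¹) := by
  simp [expNegInvGlue, not_le.2 ht]

lemma mono_zero_arg {κ : Type} [Fintype κ] {α : κ → ℕ} (h : α ≠ 0) : mono α (0 : κ → ℝ) = 0 := by
  obtain ⟨i, hi⟩ := Function.ne_iff.1 h
  exact Finset.prod_eq_zero (Finset.mem_univ i) (zero_pow (M₀ := ℝ) hi)

section Z
variable {κ : Type} [Fintype κ] (T : Set κ) (B : κ → κ → ℕ)

open Classical in
noncomputable def zz : ℕ → ℝ × (κ → ℝ) → κ → ℝ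
  | 0, p => fun _ => expNegInvGlue p.1
  | m+1, p => fun i => if i ∈ T then expNegInvGlue (mono (B i) (zz m p) / p.2 i)
      else expNegInvGlue p.1

variable {T B}

lemma zz_succ_mem {i : κ} (h : i ∈ T) (m : ℕ) (p : ℝ × (κ → ℝ)) :
    zz T B (m+1) p i = expNegInvGlue (mono (B i) (zz T B m p) / p.2 i) := by simp [zz, h]

lemma zz_not {i : κ} (h : i ∉ T) (m : ℕ) (p : ℝ × (κ → ℝ)) :
    zz T B m p i = expNegInvGlue p.1 := by cases m <;> simp [zz, h]

lemma zz_pos {p : ℝ × (κ → ℝ)} (h1 : 0 < p.1) (h2 : ∀ i, 0 < p.2 i) (m : ℕ) (i : κ) :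
    0 < zz T B m p i := by
  induction m generalizing i with
  | zero => exact expNegInvGlue.pos_of_pos h1
  | succ m ih =>
    by_cases h : i ∈ T
    · rw [zz_succ_mem h]
      exact expNegInvGlue.pos_of_pos (div_pos (mono_pos _ ih) (h2 i))
    · rw [zz_not h]; exact expNegInvGlue.pos_of_pos h1

lemma zz_an {p : ℝ × (κ → ℝ)} (h1 : 0 < p.1) (h2 : ∀ i, 0 < p.2 i) (m : ℕ) :
    AnalyticAt ℝ (zz T B m) p := by
  have a0 : AnalyticAt ℝ (fun p : ℝ × (κ → ℝ) => expNegInvGlue p.1) p :=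
    (eN_an h1).comp analyticAt_fst
  induction m with
  | zero => exact AnalyticAt.pi fun i => a0
  | succ m ih =>
    refine AnalyticAt.pi fun i => ?_
    by_cases h : i ∈ T
    · simp only [zz_succ_mem h]
      refine AnalyticAt.fun_comp (eN_an (div_pos (mono_pos _ (zz_pos h1 h2 m)) (h2 i))) ?_
      refine AnalyticAt.fun_div ((analyticAt_mono _ _).fun_comp ih)
        ((analyticAt_coord i _).fun_comp analyticAt_snd) (h2 i).ne'
    · simp only [zz_not h]; exact a0

lemma zz_cd {p : ℝ × (κ → ℝ)} (h2 : ∀ i, 0 < p.2 i) (m : ℕ) :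
    ContDiffAt ℝ 1 (zz T B m) p := by
  have a0 : ContDiffAt ℝ 1 (fun p : ℝ × (κ → ℝ) => expNegInvGlue p.1) p :=
    (expNegInvGlue.contDiff (n := 1)).contDiffAt.comp p contDiffAt_fst
  induction m with
  | zero => exact contDiffAt_pi.2 fun i => a0
  | succ m ih =>
    refine contDiffAt_pi.2 fun i => ?_
    by_cases h : i ∈ T
    · simp only [zz_succ_mem h]
      refine (expNegInvGlue.contDiff (n := 1)).contDiffAt.comp p ?_
      refine ContDiffAt.div ((analyticAt_mono _ _).contDiffAt.comp p ih)
        ((analyticAt_coord i _).contDiffAt.comp p contDiffAt_snd) (h2 i).ne'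
    · simp only [zz_not h]; exact a0

lemma zz_zero (hB : ∀ i ∈ T, B i ≠ 0) (ξ : κ → ℝ) (m : ℕ) : zz T B m (0, ξ) = 0 := by
  induction m with
  | zero => ext i; simp [zz]
  | succ m ih =>
    ext i
    by_cases h : i ∈ T
    · rw [zz_succ_mem h, ih, mono_zero_arg (hB i h)]; simp
    · rw [zz_not h]; simp

lemma zz_stab (hB : ∀ i ∈ T, B i ≠ 0)
    (hT : ∀ i ∈ T, ∀ j ∈ T, B i j ≠ 0 → ∑ l, B j l < ∑ l, B i l) (p : ℝ × (κ → ℝ)) (m : ℕ) :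
    ∀ i ∈ T, ∑ l, B i l ≤ m → zz T B (m+1) p i = zz T B m p i := by
  induction m with
  | zero =>
    intro i hi h
    refine absurd ?_ (hB i hi)
    ext l
    have := Finset.single_le_sum (f := B i) (fun _ _ => Nat.zero_le _) (Finset.mem_univ l)
    simp only [Pi.zero_apply]; omega
  | succ m ih =>
    intro i hi h
    rw [zz_succ_mem hi, zz_succ_mem hi]
    congr 2
    refine Finset.prod_congr rfl fun j _ => ?_
    by_cases hj : j ∈ T
    · by_cases hb : B i j = 0
      · simp [hb]
      · rw [ih j hj (by have := hT i hi j hj hb; omega)]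
    · rw [zz_not hj, zz_not hj]

lemma zz_fix (hB : ∀ i ∈ T, B i ≠ 0)
    (hT : ∀ i ∈ T, ∀ j ∈ T, B i j ≠ 0 → ∑ l, B j l < ∑ l, B i l) :
    ∃ M, ∀ p : ℝ × (κ → ℝ), ∀ i ∈ T,
      zz T B M p i = expNegInvGlue (mono (B i) (zz T B M p) / p.2 i) := by
  refine ⟨∑ i, ∑ l, B i l, fun p i hi => ?_⟩
  rw [← zz_succ_mem hi, zz_stab hB hT p _ i hi]
  exact Finset.single_le_sum (f := fun i => ∑ l, B i l) (fun _ _ => Nat.zero_le _) (Finset.mem_univ i)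

end Z

section Curve
variable {κ K : Type} [Fintype κ] [Fintype K]

/-- There is an analytic arc in the positive orthant, tending to the origin and inside `S`. -/
def HasCurve (S : Set (κ → ℝ)) : Prop := ∃ η : ℝ → κ → ℝ,
  (∀ᶠ τ in 𝓝[>] 0, AnalyticAt ℝ η τ) ∧ (∃ ε > 0, InjOn η (Ioo 0 ε)) ∧
  Tendsto η (𝓝[>] 0) (FP κ) ∧ ∀ᶠ τ in 𝓝[>] 0, η τ ∈ S

open Classical in
theorem curveD (T : Set κ) (hT0 : ∃ i, i ∉ T) (B : κ → κ → ℕ) (r : κ → ℝ) (hr : ∀ i, 0 < r i)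
    (hB : ∀ i ∈ T, B i ≠ 0) (hT : ∀ i ∈ T, ∀ j ∈ T, B i j ≠ 0 → ∑ l, B j l < ∑ l, B i l)
    (A : K → κ → ℝ) (b : K → κ → ℕ) (h : K → (κ → ℝ) → ℝ) (hh : ∀ k, AnalyticAt ℝ (h k) 0)
    (h2 : ∀ k, ∑ i, (if i ∈ T ∧ B i = b k then A k i * r i else 0) = h k 0)
    (h3 : ∀ k, ∀ j ∈ T, A k j ≠ 0 → B j ≠ b k → B j ≤ b k)
    (R : κ → K → ℝ)
    (h4 : ∀ k l, b k = b l → ∑ i, (if i ∈ T ∧ B i = b k then A k i * R i l else 0) = if k = l then 1 else 0)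
    (i0 : K → κ) (h5 : ∀ k, i0 k ∉ T ∧ b k (i0 k) ≠ 0) :
    HasCurve {v : κ → ℝ | ∀ k, ∑ i, A k i * (- Real.log (v i)) = h k v / mono (b k) v} := by
  obtain ⟨M, hM⟩ := zz_fix hB hT
  set z := zz T B M with hz
  set v : ℝ → ℝ := fun τ => τ⁻¹ * expNegInvGlue τ with hv
  have vcd : ContDiff ℝ 1 v := by
    have := expNegInvGlue.contDiff_polynomial_eval_inv_mul (n := 1) Polynomial.X
    simpa using this
  have van : ∀ τ, 0 < τ → AnalyticAt ℝ v τ := fun τ ht =>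
    (analyticAt_id.inv ht.ne').mul (eN_an ht)
  set br : K → ℝ × (κ → ℝ) → ℝ := fun k p => (h k (z p) - h k 0)
    - ∑ j, (if j ∈ T then 0 else A k j * v p.1 * mono (b k - Pi.single (i0 k) 1) (z p))
    - ∑ j, (if j ∈ T ∧ B j ≠ b k then A k j * p.2 j * mono (b k - B j) (z p) else 0) with hbr
  set Ω : ℝ × (κ → ℝ) → κ → ℝ := fun p i => r i + ∑ k, (if i ∈ T ∧ B i = b k then R i k * br k p else 0)
    with hΩ
  set G : ℝ × (κ → ℝ) → κ → ℝ := fun p => p.2 - Ω p with hG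
  have z0 : ∀ ξ, z (0, ξ) = 0 := fun ξ => zz_zero hB ξ M
  have br0 : ∀ k ξ, br k (0, ξ) = 0 := by
    intro k ξ
    simp only [hbr, z0]
    have e1 : ∑ j, (if j ∈ T then 0 else A k j * v 0 * mono (b k - Pi.single (i0 k) 1) (0 : κ → ℝ)) = 0 :=
      Finset.sum_eq_zero fun j _ => by simp [hv]
    have e2 : ∑ j, (if j ∈ T ∧ B j ≠ b k then A k j * ξ j * mono (b k - B j) (0 : κ → ℝ) else 0) = 0 := by
      refine Finset.sum_eq_zero fun j _ => ?_
      split_ifs with hj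
      · by_cases ha : A k j = 0
        · simp [ha]
        · rw [mono_zero_arg, mul_zero]
          intro hc
          have h6 := h3 k j hj.1 ha hj.2
          apply hj.2
          ext l
          have h7 := congrFun hc l
          have h8 : B j l ≤ b k l := h6 l
          simp only [Pi.sub_apply, Pi.zero_apply] at h7
          omega
      · rfl
    rw [e1, e2]; simp
  have G0 : ∀ ξ, G (0, ξ) = ξ - r := by
    intro ξ; ext i; simp [hG, hΩ, br0]
  have zcd : ContDiffAt ℝ 1 z (0, r) := zz_cd hr M
  have hrel : ∀ i, ContDiffAt ℝ 1 (fun p : ℝ × (κ → ℝ) => p.2 i) (0, r) := fun i =>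
    (analyticAt_coord i _).contDiffAt.comp (0, r) contDiffAt_snd
  have hra : ∀ i (p : ℝ × (κ → ℝ)), AnalyticAt ℝ (fun p : ℝ × (κ → ℝ) => p.2 i) p := fun i p =>
    (analyticAt_coord i _).fun_comp analyticAt_snd
  have mcd : ∀ α, ContDiffAt ℝ 1 (fun p => mono α (z p)) (0, r) := fun α =>
    (analyticAt_mono _ _).contDiffAt.comp (0, r) zcd
  have brcd : ∀ k, ContDiffAt ℝ 1 (br k) (0, r) := by
    intro k
    have hk : ContDiffAt ℝ 1 (h k) (z (0, r)) := by rw [z0]; exact (hh k).contDiffAt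
    refine ContDiffAt.sub (ContDiffAt.sub (ContDiffAt.sub (hk.comp (0, r) zcd) contDiffAt_const) ?_) ?_
    · refine ContDiffAt.sum fun j _ => ?_
      split_ifs
      · exact contDiffAt_const
      · exact (contDiffAt_const.mul (vcd.contDiffAt.comp (0, r) contDiffAt_fst)).mul (mcd _)
    · refine ContDiffAt.sum fun j _ => ?_
      split_ifs
      · exact (contDiffAt_const.mul (hrel j)).mul (mcd _)
      · exact contDiffAt_const
  have Gcd : ContDiffAt ℝ 1 G (0, r) := by
    refine contDiffAt_snd.sub (contDiffAt_pi.2 fun i => ?_)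
    refine contDiffAt_const.add (ContDiffAt.sum fun k _ => ?_)
    split_ifs
    · exact contDiffAt_const.mul (brcd k)
    · exact contDiffAt_const
  have evpos : ∀ᶠ p in 𝓝 ((0:ℝ), r), ∀ i, 0 < p.2 i := by
    rw [eventually_all]
    intro i
    exact (hrel i).continuousAt.eventually (lt_mem_nhds (hr i))
  have evh : ∀ᶠ p in 𝓝 ((0:ℝ), r), ∀ k, AnalyticAt ℝ (h k) (z p) := by
    rw [eventually_all]
    intro k
    have t : Tendsto z (𝓝 (0, r)) (𝓝 0) := by
      have := zcd.continuousAt.tendsto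
      rwa [z0] at this
    exact t.eventually (hh k).eventually_analyticAt
  have Gan : ∀ᶠ p in 𝓝 ((0:ℝ), r), 0 < p.1 → AnalyticAt ℝ G p := by
    filter_upwards [evpos, evh] with p hp hk hp1
    have za : AnalyticAt ℝ z p := zz_an hp1 hp M
    have ma : ∀ α, AnalyticAt ℝ (fun p => mono α (z p)) p := fun α =>
      (analyticAt_mono _ _).fun_comp za
    have bra : ∀ k, AnalyticAt ℝ (br k) p := by
      intro k
      refine AnalyticAt.sub (AnalyticAt.sub (AnalyticAt.sub ((hk k).fun_comp za) analyticAt_const) ?_) ?_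
      · refine analyticAt_sum' fun j _ => ?_
        split_ifs
        · exact analyticAt_const
        · exact (analyticAt_const.mul ((van _ hp1).fun_comp analyticAt_fst)).mul (ma _)
      · refine analyticAt_sum' fun j _ => ?_
        split_ifs
        · exact (analyticAt_const.mul (hra j p)).mul (ma _)
        · exact analyticAt_const
    refine analyticAt_snd.sub (AnalyticAt.pi fun i => ?_)
    refine analyticAt_const.add (analyticAt_sum' fun k _ => ?_)
    split_ifs
    · exact analyticAt_const.mul (bra k)
    · exact analyticAt_const
  obtain ⟨ξ, ξt, ξev⟩ := iftan Gcd (Eventually.of_forall G0) Gan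
  have pt : Tendsto (fun τ => (τ, ξ τ)) (𝓝[>] 0) (𝓝 ((0:ℝ), r)) :=
    (tendsto_nhdsWithin_of_tendsto_nhds tendsto_id).prodMk_nhds ξt
  have evξ : ∀ᶠ τ in 𝓝[>] 0, ∀ i, 0 < ξ τ i := pt.eventually evpos
  obtain ⟨j0, hj0⟩ := hT0
  refine ⟨fun τ => z (τ, ξ τ), ?_, ?_, ?_, ?_⟩
  · filter_upwards [ξev, self_mem_nhdsWithin, evξ] with τ a hτ hp
    have : AnalyticAt ℝ z (τ, ξ τ) := zz_an (p := (τ, ξ τ)) hτ hp M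
    exact AnalyticAt.fun_comp (f := fun s : ℝ => (s, ξ s)) this (analyticAt_id.prod a.1)
  · refine ⟨1, one_pos, ?_⟩
    intro s hs t ht hst
    have := congrFun hst j0
    simp only [hz, zz_not hj0, eN_eq hs.1, eN_eq ht.1] at this
    simpa using this
  · refine tendsto_FP.2 ⟨?_, ?_⟩
    · have := zcd.continuousAt.tendsto.comp pt
      rwa [z0] at this
    · filter_upwards [self_mem_nhdsWithin, evξ] with τ hτ hp i
      exact zz_pos (p := (τ, ξ τ)) hτ hp M i
  · filter_upwards [ξev, self_mem_nhdsWithin, evξ] with τ a hτ hp k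
    have hτ : 0 < τ := hτ
    set p : ℝ × (κ → ℝ) := (τ, ξ τ) with hpdef
    have zp : ∀ i, 0 < z p i := zz_pos hτ hp M
    have mp : ∀ α, 0 < mono α (z p) := fun α => mono_pos α zp
    have l1 : ∀ i ∈ T, - Real.log (z p i) = ξ τ i / mono (B i) (z p) := by
      intro i hi
      rw [hM p i hi, eN_eq (div_pos (mp _) (hp i)), Real.log_exp]
      simp [hpdef]
    have l2 : ∀ i ∉ T, - Real.log (z p i) = τ⁻¹ := by
      intro i hi
      rw [hz, zz_not hi, eN_eq hτ, Real.log_exp]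
      simp [hpdef]
    have fixp : ∀ i, ξ τ i = Ω p i := by
      intro i
      have := congrFun a.2 i
      simp only [hG, Pi.sub_apply, Pi.zero_apply] at this
      linarith
    rw [eq_div_iff (mp _).ne', Finset.sum_mul]
    -- split sum
    have key : ∀ i, A k i * - Real.log (z p i) * mono (b k) (z p) =
        (if i ∈ T ∧ B i = b k then A k i * ξ τ i else 0)
        + (if i ∈ T then 0 else A k i * v p.1 * mono (b k - Pi.single (i0 k) 1) (z p))
        + (if i ∈ T ∧ B i ≠ b k then A k i * p.2 i * mono (b k - B i) (z p) else 0) := by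
      intro i
      by_cases hi : i ∈ T
      · rw [l1 i hi]
        have := (mp (B i)).ne'
        by_cases hb : B i = b k
        · simp only [hi, hb, true_and, if_true, ne_eq, not_true_eq_false, if_false, add_zero]
          rw [hb] at this
          field_simp
        · simp only [hi, hb, true_and, if_true, ne_eq, not_false_eq_true, if_false, zero_add]
          by_cases ha : A k i = 0
          · simp [ha]
          · have h6 := h3 k i hi ha hb
            have : mono (b k) (z p) = mono (B i) (z p) * mono (b k - B i) (z p) := by
              rw [← mono_add, add_tsub_cancel_of_le h6]
            rw [this]
            change _ = A k i * ξ τ i * _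
            field_simp
      · rw [l2 i hi]
        simp only [hi, false_and, if_false, zero_add, add_zero]
        have : mono (b k) (z p) = expNegInvGlue τ * mono (b k - Pi.single (i0 k) 1) (z p) := by
          have e1 : z p (i0 k) = expNegInvGlue τ := by rw [hz, zz_not (h5 k).1]
          rw [← e1, ← mono_single (i0 k) (z p), ← mono_add, add_tsub_cancel_of_le]
          intro l
          by_cases hl : l = i0 k
          · subst hl; have := (h5 k).2; simp; omega
          · simp [Pi.single_apply, hl]
        rw [this]
        simp only [hv, hpdef]
        ring
    rw [Finset.sum_congr rfl fun i _ => key i, Finset.sum_add_distrib, Finset.sum_add_distrib]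
    have main : ∑ i, (if i ∈ T ∧ B i = b k then A k i * ξ τ i else 0) = h k 0 + br k p := by
      have e1 : ∀ i, (if i ∈ T ∧ B i = b k then A k i * ξ τ i else 0) =
          (if i ∈ T ∧ B i = b k then A k i * r i else 0) +
          ∑ l, (if b k = b l then (if i ∈ T ∧ B i = b k then A k i * R i l else 0) * br l p else 0) := by
        intro i
        split_ifs with hi
        · rw [fixp, hΩ]
          simp only [hi.1, hi.2, true_and]
          rw [mul_add, Finset.mul_sum]
          congr 1
          refine Finset.sum_congr rfl fun l _ => ?_
          split_ifs <;> ring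
        · simp
      rw [Finset.sum_congr rfl fun i _ => e1 i, Finset.sum_add_distrib, h2, Finset.sum_comm]
      congr 1
      have e2 : ∀ l, ∑ i, (if b k = b l then (if i ∈ T ∧ B i = b k then A k i * R i l else 0) * br l p else 0)
          = if k = l then br l p else 0 := by
        intro l
        by_cases hb : b k = b l
        · simp only [hb, if_true]
          rw [← Finset.sum_mul]
          have := h4 k l hb
          rw [hb] at this
          rw [this]
          split_ifs <;> simp
        · have : k ≠ l := fun hc => hb (by rw [hc])
          simp [hb, this]
      rw [Finset.sum_congr rfl fun l _ => e2 l]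
      simp
    rw [main, hbr]
    ring

end Curve

section E1
variable {I : Type} {𝒰 : Ultrafilter I} {κ κ' : Type} [Fintype κ] [Fintype κ']

lemma HasCurve.chart {S : Set (κ → ℝ)} {S' : Set (κ' → ℝ)} {y : I → κ → ℝ} {z : I → κ' → ℝ}
    {N : κ → κ' → ℕ} {Ψ : (κ' → ℝ) → κ → ℝ} (h : HasCurve S') (hm : MChart 𝒰 y z N Ψ)
    (hS : ∀ᶠ w in FP κ', w ∈ S' → Ψ w ∈ S) : HasCurve S := by
  obtain ⟨η, h1, ⟨ε, hε, h2⟩, h3, h4⟩ := h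
  refine ⟨fun τ => Ψ (η τ), ?_, ?_, hm.tendsto.comp h3, ?_⟩
  · filter_upwards [h1, h3.eventually (FP_le hm.ch.an.eventually_analyticAt)] with τ a b
    exact b.fun_comp a
  · obtain ⟨s, hs, inj⟩ := hm.ch.inj
    have := h3.eventually hs
    obtain ⟨δ, hδ, hd⟩ := mem_nhdsGT_iff_exists_Ioo_subset.1 this
    refine ⟨min ε δ, lt_min hε hδ, ?_⟩
    intro a ha b hb hab
    exact h2 ⟨ha.1, ha.2.trans_le (min_le_left _ _)⟩ ⟨hb.1, hb.2.trans_le (min_le_left _ _)⟩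
      (inj (hd ⟨ha.1, ha.2.trans_le (min_le_right _ _)⟩) (hd ⟨hb.1, hb.2.trans_le (min_le_right _ _)⟩) hab)
  · filter_upwards [h4, h3.eventually hS] with τ a b using b a

lemma HasCurve.mono {S S' : Set (κ → ℝ)} (h : HasCurve S') 
    (hS : ∀ᶠ w in FP κ, w ∈ S' → w ∈ S) : HasCurve S := by
  obtain ⟨η, h1, h2, h3, h4⟩ := h
  refine ⟨η, h1, h2, h3, ?_⟩
  filter_upwards [h4, h3.eventually hS] with τ a b using b a

noncomputable def lg (A : κ → ℤ) (v : κ → ℝ) : ℝ := ∑ i, (A i : ℝ) * Real.log (v i)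

lemma lg_add (A A' : κ → ℤ) (v : κ → ℝ) : lg (A + A') v = lg A v + lg A' v := by
  simp [lg, add_mul, Finset.sum_add_distrib]
lemma lg_neg (A : κ → ℤ) (v : κ → ℝ) : lg (-A) v = - lg A v := by simp [lg]
lemma lg_sub (A A' : κ → ℤ) (v : κ → ℝ) : lg (A - A') v = lg A v - lg A' v := by
  rw [sub_eq_add_neg, lg_add, lg_neg]; rfl
lemma lg_zero (v : κ → ℝ) : lg 0 v = 0 := by simp [lg]

lemma mono_eq_exp (α : κ → ℕ) {v : κ → ℝ} (hv : ∀ i, 0 < v i) :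
    mono α v = Real.exp (lg (fun i => (α i : ℤ)) v) := by
  rw [lg, Real.exp_sum]
  refine Finset.prod_congr rfl fun i _ => ?_
  rw [← Real.rpow_natCast, Real.rpow_def_of_pos (hv i)]
  simp [mul_comm]

/-- value of a constraint -/
noncomputable def LV (A m : κ → ℤ) (u l : (κ → ℝ) → ℝ) (v : κ → ℝ) : ℝ :=
  lg A v + Real.exp (lg m v) * u v + l v

lemma lg_pull {N : κ → κ' → ℕ} {Ψ : (κ' → ℝ) → κ → ℝ} (h : MonoMap N Ψ) :
    ∃ w : (κ → ℤ) → (κ' → ℝ) → ℝ, (∀ A, AnalyticAt ℝ (w A) 0) ∧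
      ∀ᶠ v in FP κ', ∀ A, lg A (Ψ v) = lg (expoZ N A) v + w A v := by
  choose U hU U0 hUe using h
  refine ⟨fun A v => ∑ i, (A i : ℝ) * Real.log (U i v), fun A => ?_, ?_⟩
  · exact analyticAt_sum' fun i _ => analyticAt_const.mul ((analyticAt_log (U0 i)).fun_comp (hU i))
  · have e1 : ∀ᶠ v in 𝓝 (0 : κ' → ℝ), ∀ i, Ψ v i = mono (N i) v * U i v := eventually_all.2 hUe
    have e2 : ∀ᶠ v in 𝓝 (0 : κ' → ℝ), ∀ i, 0 < U i v := eventually_all.2 fun i =>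
      (hU i).continuousAt.eventually (lt_mem_nhds (U0 i))
    filter_upwards [FP_le e1, FP_le e2, FP_pos] with v h1 h2 h3 A
    have : ∀ i, Real.log (Ψ v i) = ∑ j, (N i j : ℝ) * Real.log (v j) + Real.log (U i v) := by
      intro i
      rw [h1, Real.log_mul (mono_pos _ h3).ne' (h2 i).ne', mono_eq_exp _ h3, Real.log_exp]
      simp [lg]
    simp only [lg, this, expoZ, mul_add, Finset.sum_add_distrib]
    congr 1
    push_cast
    simp only [Finset.mul_sum, Finset.sum_mul]
    rw [Finset.sum_comm]
    simp only [mul_assoc]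

lemma LV_pull {N : κ → κ' → ℕ} {Ψ : (κ' → ℝ) → κ → ℝ} (h : MonoMap N Ψ) (h0 : Ψ 0 = 0)
    (A m : κ → ℤ) (u : (κ → ℝ) → ℝ) {l : (κ → ℝ) → ℝ} (hl : AnalyticAt ℝ l 0) :
    ∃ E l' : (κ' → ℝ) → ℝ, AnalyticAt ℝ E 0 ∧ 0 < E 0 ∧ AnalyticAt ℝ l' 0 ∧
      ∀ᶠ v in FP κ', LV A m u l (Ψ v) =
        LV (expoZ N A) (expoZ N m) (fun v => u (Ψ v) * E v) l' v := by
  obtain ⟨w, hw, e⟩ := lg_pull h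
  refine ⟨fun v => Real.exp (w m v), fun v => w A v + l (Ψ v), (hw m).rexp, Real.exp_pos _,
    (hw A).add (analyticAt_comp0 hl h.analyticAt h0), ?_⟩
  filter_upwards [e] with v hv
  simp only [LV, hv, Real.exp_add]
  ring

/-- `a = O(1 + |b|)` along the ultrafilter -/
def Dom (𝒰 : Ultrafilter I) (a b : I → ℝ) : Prop :=
  ∃ C : ℝ, 0 ≤ C ∧ ∀ᶠ t in (𝒰 : Filter I), |a t| ≤ C * (1 + |b t|)

lemma Dom.refl (a : I → ℝ) : Dom 𝒰 a a :=
  ⟨1, zero_le_one, Eventually.of_forall fun t => by linarith [abs_nonneg (a t)]⟩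

lemma Dom.trans {a b c : I → ℝ} (h : Dom 𝒰 a b) (h' : Dom 𝒰 b c) : Dom 𝒰 a c := by
  obtain ⟨C, hC, h⟩ := h
  obtain ⟨C', hC', h'⟩ := h'
  refine ⟨C * (1 + C'), by positivity, ?_⟩
  filter_upwards [h, h'] with t h1 h2
  have := mul_le_mul_of_nonneg_left h2 hC
  have := abs_nonneg (c t)
  nlinarith [mul_nonneg hC this]

lemma Dom.add {a b c : I → ℝ} (h : Dom 𝒰 a c) (h' : Dom 𝒰 b c) : Dom 𝒰 (fun t => a t + b t) c := by
  obtain ⟨C, hC, h⟩ := h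
  obtain ⟨C', hC', h'⟩ := h'
  refine ⟨C + C', by positivity, ?_⟩
  filter_upwards [h, h'] with t h1 h2
  have := abs_add_le (a t) (b t)
  nlinarith

lemma Dom.smul {a c : I → ℝ} (r : ℝ) (h : Dom 𝒰 a c) : Dom 𝒰 (fun t => r * a t) c := by
  obtain ⟨C, hC, h⟩ := h
  refine ⟨|r| * C, by positivity, ?_⟩
  filter_upwards [h] with t h1
  rw [abs_mul, mul_assoc]
  exact mul_le_mul_of_nonneg_left h1 (abs_nonneg r)

lemma Dom.of_tendsto {a c : I → ℝ} {x : ℝ} (h : Tendsto a 𝒰 (𝓝 x)) : Dom 𝒰 a c := by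
  refine ⟨|x| + 1, by positivity, ?_⟩
  filter_upwards [h.abs.eventually (gt_mem_nhds (lt_add_one |x|))] with t ht
  have := abs_nonneg (c t)
  nlinarith [abs_nonneg x]

lemma Dom.sum {J : Type} (s : Finset J) {a : J → I → ℝ} {c : I → ℝ} (h : ∀ j ∈ s, Dom 𝒰 (a j) c) :
    Dom 𝒰 (fun t => ∑ j ∈ s, a j t) c := by
  classical
  induction s using Finset.induction_on with
  | empty => exact ⟨0, le_rfl, by simp⟩
  | insert j s hj ih =>
    simp only [Finset.sum_insert hj]
    exact (h j (by simp)).add (ih fun j hj => h j (by simp [hj]))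

lemma Dom.congr {a a' b : I → ℝ} (h : Dom 𝒰 a b) (e : ∀ᶠ t in (𝒰 : Filter I), a t = a' t) :
    Dom 𝒰 a' b := by
  obtain ⟨C, hC, h⟩ := h
  exact ⟨C, hC, by filter_upwards [h, e] with t h e; rwa [← e]⟩

lemma Dom.congr_right {a b b' : I → ℝ} (h : Dom 𝒰 a b) (e : ∀ᶠ t in (𝒰 : Filter I), b t = b' t) :
    Dom 𝒰 a b' := by
  obtain ⟨C, hC, h⟩ := h
  exact ⟨C, hC, by filter_upwards [h, e] with t h e; rwa [← e]⟩

/-- domination is stable under bounded perturbation -/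
lemma Dom.of_sub {a a' b : I → ℝ} {x : ℝ} (h : Tendsto (fun t => a t - a' t) 𝒰 (𝓝 x))
    (h' : Dom 𝒰 a' b) : Dom 𝒰 a b :=
  ((Dom.of_tendsto (c := b) h).add h').congr (Eventually.of_forall fun t => by ring)

/-- the valuation-independence property -/
def VI {K : Type} [Fintype K] (𝒰 : Ultrafilter I) (S : K → I → ℝ) : Prop :=
  ∀ (q : K → ℤ) (k : K), q k ≠ 0 → Dom 𝒰 (S k) (fun t => ∑ l, (q l : ℝ) * S l t)

lemma VI.change {K : Type} [Fintype K] {S S' : K → I → ℝ} (h : VI 𝒰 S) (x : K → ℝ)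
    (hx : ∀ k, Tendsto (fun t => S' k t - S k t) 𝒰 (𝓝 (x k))) : VI 𝒰 S' := by
  intro q k hq
  refine (Dom.of_sub (hx k) (h q k hq)).trans ?_
  have h1 : Tendsto (fun t => ∑ l, (q l : ℝ) * (S l t - S' l t)) 𝒰 (𝓝 (∑ l, (q l : ℝ) * (- x l))) := by
    refine tendsto_finsetSum _ fun l _ => ?_
    refine Tendsto.const_mul _ ?_
    have := (hx l).neg
    simpa using this
  refine Dom.of_sub (a' := fun t => ∑ l, (q l : ℝ) * S' l t) (x := ∑ l, (q l : ℝ) * (- x l)) ?_ (Dom.refl _)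
  refine h1.congr fun t => ?_
  rw [← Finset.sum_sub_distrib]
  simp [mul_sub]

lemma VI.sub {K K' : Type} [Fintype K] [Fintype K'] {S : K → I → ℝ} (h : VI 𝒰 S) (f : K' → K)
    (hf : Function.Injective f) : VI 𝒰 (fun k => S (f k)) := by
  classical
  intro q k hq
  have := h (fun l => ∑ k', if f k' = l then q k' else 0) (f k) (by
    simpa [hf.eq_iff] using hq)
  refine this.congr_right (Eventually.of_forall fun t => ?_)
  simp only [Int.cast_sum, Finset.sum_mul]
  rw [Finset.sum_comm]
  refine Finset.sum_congr rfl fun k' _ => ?_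
  rw [Finset.sum_eq_single (f k')]
  · simp
  · intro l _ hl; simp [hl.symm]
  · simp

theorem exists_VI {K : Type} [Fintype K] (S : K → I → ℝ) :
    ∃ Q : K → K → ℤ, (∀ x : K → ℝ, (∀ k, ∑ l, (Q k l : ℝ) * x l = 0) → x = 0) ∧
      VI 𝒰 (fun k t => ∑ l, (Q k l : ℝ) * S l t) := by
  classical
  -- submodule of combinations dominated by `b`
  let V : (I → ℝ) → Submodule ℚ (K → ℚ) := fun b =>
    { carrier := {q | Dom 𝒰 (fun t => ∑ l, (q l : ℝ) * S l t) b}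
      add_mem' := fun {p q} hp hq => (Dom.add hp hq).congr (Eventually.of_forall fun t => by
        simp [add_mul, Finset.sum_add_distrib])
      zero_mem' := ⟨0, le_rfl, by simp⟩
      smul_mem' := fun r q hq => (Dom.smul (r : ℝ) hq).congr (Eventually.of_forall fun t => by
        simp [Finset.mul_sum, mul_assoc]) }
  let SQ : (K → K → ℤ) → K → I → ℝ := fun Q k t => ∑ l, (Q k l : ℝ) * S l t
  let P : (K → K → ℤ) → Prop := fun Q => ∀ x : K → ℝ, (∀ k, ∑ l, (Q k l : ℝ) * x l = 0) → x = 0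
  let pot : (K → K → ℤ) → ℕ := fun Q => ∑ k, Module.finrank ℚ (V (SQ Q k))
  have hne : ∃ n, ∃ Q, P Q ∧ pot Q = n := by
    refine ⟨_, fun k l => if k = l then 1 else 0, ?_, rfl⟩
    intro x hx
    ext k
    simpa using hx k
  obtain ⟨Q, hQ, hpot⟩ := Nat.find_spec hne
  refine ⟨Q, hQ, ?_⟩
  intro q k0 hq
  by_contra hcon
  let row : K → ℤ := fun l => ∑ k, q k * Q k l
  have hrow : ∀ x : K → ℝ, ∑ l, (row l : ℝ) * x l = ∑ k, (q k : ℝ) * ∑ l, (Q k l : ℝ) * x l := by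
    intro x
    simp only [row, Int.cast_sum, Int.cast_mul, Finset.sum_mul, Finset.mul_sum]
    rw [Finset.sum_comm]
    simp only [mul_assoc]
  let Q' : K → K → ℤ := Function.update Q k0 row
  have PQ' : P Q' := by
    intro x hx
    have h1 : ∀ k, k ≠ k0 → ∑ l, (Q k l : ℝ) * x l = 0 := by
      intro k hk
      have := hx k
      simpa [Q', hk] using this
    have h2 : ∑ k, (q k : ℝ) * ∑ l, (Q k l : ℝ) * x l = 0 := by
      rw [← hrow]
      have := hx k0
      simpa [Q'] using this
    rw [Finset.sum_eq_single k0 (fun k _ hk => by rw [h1 k hk, mul_zero]) (by simp)] at h2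
    apply hQ
    intro k
    by_cases hk : k = k0
    · subst hk
      rcases mul_eq_zero.1 h2 with h | h
      · exact absurd (by exact_mod_cast h) hq
      · exact h
    · exact h1 k hk
  have hlt : pot Q' < Nat.find hne := by
    rw [← hpot]
    have e0 : SQ Q' k0 = fun t => ∑ k, (q k : ℝ) * SQ Q k t := by
      ext t
      simp only [SQ, Q', Function.update_self]
      exact hrow fun l => S l t
    have low : V (SQ Q' k0) < V (SQ Q k0) := by
      rw [SetLike.lt_iff_le_and_exists]
      have dichot : Dom 𝒰 (SQ Q' k0) (SQ Q k0) := by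
        by_contra hc
        apply hcon
        refine ⟨1, zero_le_one, ?_⟩
        have : ¬ ∀ᶠ t in (𝒰 : Filter I), |SQ Q' k0 t| ≤ 1 * (1 + |SQ Q k0 t|) :=
          fun h => hc ⟨1, zero_le_one, h⟩
        rw [← Ultrafilter.eventually_not] at this
        filter_upwards [this] with t ht
        rw [e0] at ht
        have e1 : SQ Q k0 t = ∑ l, (Q k0 l : ℝ) * S l t := rfl
        have e2 : ∀ k, SQ Q k t = ∑ l, (Q k l : ℝ) * S l t := fun k => rfl
        simp only [e2] at ht
        linarith
      refine ⟨fun p hp => Dom.trans hp dichot, fun l => (Q k0 l : ℚ), ?_, ?_⟩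
      · exact (Dom.refl (SQ Q k0)).congr (Eventually.of_forall fun t => by simp [SQ])
      · intro hc
        apply hcon
        have hc : Dom 𝒰 (fun t => ∑ l, (((Q k0 l : ℚ)) : ℝ) * S l t) (SQ Q' k0) := hc
        rw [e0] at hc
        exact hc.congr (Eventually.of_forall fun t => by simp)
    refine Finset.sum_lt_sum ?_ ⟨k0, Finset.mem_univ _, Submodule.finrank_lt_finrank_of_lt low⟩
    · intro k _
      by_cases hk : k = k0
      · subst hk; exact (Submodule.finrank_lt_finrank_of_lt low).le
      · have : SQ Q' k = SQ Q k := by ext t; simp [SQ, Q', hk]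
        exact le_of_eq (by rw [this])
  exact Nat.find_min hne hlt ⟨Q', PQ', rfl⟩

end E1

section E2
variable {I : Type} {𝒰 : Ultrafilter I} {κ K : Type} [Fintype κ] [Fintype K]

lemma mono_tendsto_zero {z : I → κ → ℝ} (hz : Tendsto z 𝒰 (FP κ)) {α : κ → ℕ} (h : α ≠ 0) :
    Tendsto (fun t => mono α (z t)) 𝒰 (𝓝 0) := by
  have := (analyticAt_mono α (0 : κ → ℝ)).continuousAt.tendsto.comp (hz.mono_right FP_le)
  rwa [mono_zero_arg h] at this

lemma tendsto_low {z : I → κ → ℝ} (hz : Tendsto z 𝒰 (FP κ)) {b b' : κ → ℕ} (h : b ≤ b') (hne : b ≠ b')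
    {Z : I → ℝ} {x : ℝ} (hx : Tendsto (fun t => Z t * mono b (z t)) 𝒰 (𝓝 x)) :
    Tendsto (fun t => Z t * mono b' (z t)) 𝒰 (𝓝 0) := by
  have h1 : b' - b ≠ 0 := by
    intro hc
    apply hne
    exact le_antisymm h (tsub_eq_zero_iff_le.1 hc)
  have := hx.mul (mono_tendsto_zero hz h1)
  rw [mul_zero] at this
  refine this.congr fun t => ?_
  rw [mul_assoc, ← mono_add, add_tsub_cancel_of_le h]

lemma sum_lt_of_lt {b b' : κ → ℕ} (h : b ≤ b') (hne : b ≠ b') : ∑ i, b i < ∑ i, b' i := by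
  have := lt_of_le_of_ne h hne
  obtain ⟨h1, i, hi⟩ := Pi.lt_def.1 this
  exact Finset.sum_lt_sum (fun i _ => h1 i) ⟨i, Finset.mem_univ _, hi⟩

lemma exists_dual {K' : Type} [Fintype K'] [DecidableEq K'] (w : K' → κ → ℤ)
    (hw : ∀ g : K' → ℤ, (∀ i, ∑ k, g k * w k i = 0) → g = 0) (l : K') :
    ∃ ρ : κ → ℝ, ∀ k, ∑ i, (w k i : ℝ) * ρ i = if k = l then 1 else 0 := by
  classical
  have li : LinearIndependent ℚ (fun k i => (w k i : ℚ) : K' → κ → ℚ) := by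
    rw [← LinearIndependent.iff_fractionRing ℤ ℚ, Fintype.linearIndependent_iff]
    intro g hg
    have := hw g fun i => by
      have := congrFun hg i
      simp only [Finset.sum_apply, Pi.smul_apply, zsmul_eq_mul, Pi.zero_apply] at this
      have h2 : ∑ k, (g k : ℚ) * (w k i : ℚ) = 0 := by
        rw [← this]
        refine Finset.sum_congr rfl fun k _ => ?_
        simp
      exact_mod_cast h2
    exact fun k => congrFun this k
  obtain ⟨f, hf⟩ := LinearMap.exists_extend ((Finsupp.lapply l : (K' →₀ ℚ) →ₗ[ℚ] ℚ) ∘ₗ li.repr)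
  refine ⟨fun i => (f (Pi.single i 1) : ℝ), fun k => ?_⟩
  have h1 : f (fun i => (w k i : ℚ) : κ → ℚ) = if k = l then 1 else 0 := by
    have hm : (fun i => (w k i : ℚ) : κ → ℚ) ∈ Submodule.span ℚ (range (fun k i => (w k i : ℚ) : K' → κ → ℚ)) :=
      Submodule.subset_span ⟨k, rfl⟩
    have := LinearMap.congr_fun hf ⟨_, hm⟩
    simp only [LinearMap.comp_apply, Submodule.subtype_apply] at this
    rw [this]
    have h2 := li.repr_eq_single k ⟨_, hm⟩ rfl
    change (li.repr ⟨_, hm⟩) l = _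
    rw [h2, Finsupp.single_apply]
  have h2 : f (fun i => (w k i : ℚ) : κ → ℚ) = ∑ i, (w k i : ℚ) * f (Pi.single i 1) := by
    conv_lhs => rw [← Finset.univ_sum_single (fun i => (w k i : ℚ) : κ → ℚ)]
    rw [map_sum]
    refine Finset.sum_congr rfl fun i _ => ?_
    rw [← smul_eq_mul, ← map_smul]
    congr 1
    ext j
    by_cases hj : j = i <;> simp [Pi.single_apply, hj]
  rw [h1] at h2
  have h3 := congrArg (fun x : ℚ => (x : ℝ)) h2
  push_cast at h3
  rw [← h3]
  split_ifs <;> simp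

theorem caseB [Nonempty κ] {z : I → κ → ℝ} (hz : Tendsto z 𝒰 (FP κ)) (A : K → κ → ℤ)
    (hA : ∀ k, 0 ≤ A k ∨ A k ≤ 0) (b : K → κ → ℕ) (hb : ∀ k, b k ≠ 0)
    (hbb : ∀ k l, b k ≤ b l ∨ b l ≤ b k) (h : K → (κ → ℝ) → ℝ) (hh : ∀ k, AnalyticAt ℝ (h k) 0)
    (h0 : ∀ k, h k 0 ≠ 0)
    (heq : ∀ k, ∀ᶠ t in (𝒰 : Filter I), - lg (A k) (z t) = h k (z t) / mono (b k) (z t))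
    (hV : VI 𝒰 (fun k t => - lg (A k) (z t))) :
    HasCurve {v : κ → ℝ | ∀ k, - lg (A k) v = h k v / mono (b k) v} := by
  classical
  have hpos : ∀ᶠ t in (𝒰 : Filter I), ∀ i, 0 < z t i := (tendsto_FP.1 hz).2
  have hz0 : Tendsto z 𝒰 (𝓝 0) := (tendsto_FP.1 hz).1
  have hzi : ∀ i, Tendsto (fun t => z t i) 𝒰 (𝓝 0) := fun i => (tendsto_pi_nhds.1 hz0) i
  set Z : κ → I → ℝ := fun i t => - Real.log (z t i) with hZ
  have Zpos : ∀ᶠ t in (𝒰 : Filter I), ∀ i, 0 ≤ Z i t := by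
    have : ∀ᶠ t in (𝒰 : Filter I), ∀ i, z t i < 1 :=
      eventually_all.2 fun i => (hzi i).eventually (gt_mem_nhds one_pos)
    filter_upwards [hpos, this] with t h1 h2 i
    have := Real.log_nonpos (h1 i).le (h2 i).le
    simp only [hZ]; linarith
  have hlg : ∀ k t, - lg (A k) (z t) = ∑ i, (A k i : ℝ) * Z i t := by
    intro k t; simp [lg, hZ]
  have hht : ∀ k, Tendsto (fun t => h k (z t)) 𝒰 (𝓝 (h k 0)) := fun k =>
    (hh k).continuousAt.tendsto.comp hz0
  have hSt : ∀ k, Tendsto (fun t => - lg (A k) (z t) * mono (b k) (z t)) 𝒰 (𝓝 (h k 0)) := by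
    intro k
    refine (hht k).congr' ?_
    filter_upwards [heq k, hpos] with t h1 h2
    rw [h1, div_mul_cancel₀ _ (mono_pos _ h2).ne']
  have limex : ∀ k i, A k i ≠ 0 → ∃ x, 0 ≤ x ∧ Tendsto (fun t => Z i t * mono (b k) (z t)) 𝒰 (𝓝 x) := by
    intro k i hki
    have nn : ∀ᶠ t in (𝒰 : Filter I), 0 ≤ Z i t * mono (b k) (z t) := by
      filter_upwards [Zpos, hpos] with t h1 h2
      exact mul_nonneg (h1 i) (mono_pos _ h2).le
    have bd : ∀ᶠ t in (𝒰 : Filter I), Z i t * mono (b k) (z t) ≤ |h k 0| + 1 := by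
      filter_upwards [(hSt k).abs.eventually (gt_mem_nhds (lt_add_one |h k 0|)), Zpos, hpos] with t h1 h2 h3
      refine le_trans ?_ h1.le
      rw [abs_mul, abs_of_pos (mono_pos (b k) h3)]
      refine mul_le_mul_of_nonneg_right ?_ (mono_pos _ h3).le
      rw [hlg]
      have h4 : (1:ℝ) ≤ |(A k i : ℝ)| := by exact_mod_cast Int.one_le_abs hki
      have h5 : Z i t ≤ |(A k i : ℝ)| * Z i t := le_mul_of_one_le_left (h2 i) h4
      refine h5.trans ?_
      rcases hA k with hs | hs
      · rw [abs_of_nonneg (by exact_mod_cast hs i)]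
        refine le_trans ?_ (le_abs_self _)
        exact Finset.single_le_sum (f := fun i => (A k i : ℝ) * Z i t)
          (fun j _ => mul_nonneg (by exact_mod_cast hs j) (h2 j)) (Finset.mem_univ i)
      · rw [abs_of_nonpos (by exact_mod_cast hs i)]
        refine le_trans ?_ (neg_le_abs _)
        rw [← Finset.sum_neg_distrib]
        have := Finset.single_le_sum (f := fun i => -((A k i : ℝ) * Z i t))
          (fun j _ => by
            have : (A k j : ℝ) ≤ 0 := by exact_mod_cast hs j
            have := mul_nonneg (neg_nonneg.2 this) (h2 j)
            linarith) (Finset.mem_univ i)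
        simpa using this
    rcases tricho 𝒰 (fun t => Z i t * mono (b k) (z t)) with ⟨x, hx⟩ | hx | hx
    · exact ⟨x, ge_of_tendsto hx nn, hx⟩
    · obtain ⟨t, h1, h2⟩ := (bd.and (hx.eventually (eventually_gt_atTop (|h k 0| + 1)))).exists
      linarith
    · obtain ⟨t, h1, h2⟩ := (nn.and (hx.eventually (eventually_lt_atBot 0))).exists
      linarith
  obtain ⟨T, hT⟩ : ∃ T : Set κ, ∀ i, i ∈ T ↔
      ∃ k x, 0 < x ∧ Tendsto (fun t => Z i t * mono (b k) (z t)) 𝒰 (𝓝 x) := ⟨{i | _}, fun i => Iff.rfl⟩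
  have hex : ∀ i, ∃ (β : κ → ℕ) (x : ℝ), 0 < x ∧ (i ∈ T → (∃ k, β = b k) ∧
      Tendsto (fun t => Z i t * mono β (z t)) 𝒰 (𝓝 x)) := by
    intro i
    by_cases hi : i ∈ T
    · obtain ⟨k, x, hx, ht⟩ := (hT i).1 hi
      exact ⟨b k, x, hx, fun _ => ⟨⟨k, rfl⟩, ht⟩⟩
    · exact ⟨0, 1, one_pos, fun h => absurd h hi⟩
  choose B r hr hBr using hex
  have cmp1 : ∀ i ∈ T, ∀ l x, Tendsto (fun t => Z i t * mono (b l) (z t)) 𝒰 (𝓝 x) → B i ≤ b l := by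
    intro i hi l x hx
    obtain ⟨⟨k, hk⟩, ht⟩ := hBr i hi
    by_contra hc
    have hle : b l ≤ B i := by
      rw [hk] at hc ⊢
      exact (hbb k l).resolve_left hc
    have hne : b l ≠ B i := fun e => hc e.symm.le
    exact (hr i).ne' (tendsto_nhds_unique ht (tendsto_low hz hle hne hx))
  have cmp2 : ∀ i ∈ T, ∀ l x, 0 < x → Tendsto (fun t => Z i t * mono (b l) (z t)) 𝒰 (𝓝 x) → B i = b l := by
    intro i hi l x hx0 hx
    by_contra hc
    exact hx0.ne' (tendsto_nhds_unique hx (tendsto_low hz (cmp1 i hi l x hx) hc (hBr i hi).2))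
  have one : ∀ i ∈ T, ∀ k, b k i ≠ 0 → B i ≤ b k ∧ B i ≠ b k := by
    intro i hi k hki
    obtain ⟨⟨l, hl⟩, ht⟩ := hBr i hi
    have hnot : ¬ b k ≤ B i := by
      intro hc
      have hii : B i i ≠ 0 := by have : b k i ≤ B i i := hc i; omega
      have e : B i = Pi.single i 1 + (B i - Pi.single i 1) := by
        rw [add_tsub_cancel_of_le]
        intro j
        by_cases hj : j = i
        · subst hj; simp; omega
        · simp [Pi.single_apply, hj]
      have t0 : Tendsto (fun t => Real.negMulLog (z t i)) 𝒰 (𝓝 0) := by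
        have := Real.continuous_negMulLog.continuousAt.tendsto.comp (hzi i)
        rw [Real.negMulLog_zero] at this
        exact this
      have : Tendsto (fun t => Z i t * mono (B i) (z t)) 𝒰 (𝓝 0) := by
        refine tendsto_of_tendsto_of_tendsto_of_le_of_le' tendsto_const_nhds t0 ?_ ?_
        · filter_upwards [Zpos, hpos] with t h1 h2
          exact mul_nonneg (h1 i) (mono_pos _ h2).le
        · filter_upwards [Zpos, hpos, mono_tendsto hz (B i - Pi.single i 1)] with t h1 h2 h3
          rw [e, mono_add, mono_single, Real.negMulLog]
          have h4 : 0 ≤ Z i t * z t i := mul_nonneg (h1 i) (h2 i).le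
          have := mul_le_mul_of_nonneg_left h3 h4
          simp only [hZ] at *
          nlinarith
      exact (hr i).ne' (tendsto_nhds_unique ht this)
    rw [hl] at hnot ⊢
    exact ⟨(hbb l k).resolve_right hnot, fun e => hnot e.symm.le⟩
  have hBne : ∀ i ∈ T, B i ≠ 0 := by
    intro i hi
    obtain ⟨⟨k, hk⟩, _⟩ := hBr i hi
    rw [hk]; exact hb k
  have hBT : ∀ i ∈ T, ∀ j ∈ T, B i j ≠ 0 → ∑ l, B j l < ∑ l, B i l := by
    intro i hi j hj hij
    obtain ⟨⟨k, hk⟩, _⟩ := hBr i hi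
    rw [hk] at hij ⊢
    obtain ⟨h1, h2⟩ := one j hj k hij
    exact sum_lt_of_lt h1 h2
  have five : ∀ n k, ∑ i, b k i ≤ n → ∃ i, i ∉ T ∧ b k i ≠ 0 := by
    intro n
    induction n with
    | zero =>
      intro k hk
      obtain ⟨j, hj⟩ := Function.ne_iff.1 (hb k)
      have := Finset.single_le_sum (f := b k) (fun _ _ => Nat.zero_le _) (Finset.mem_univ j)
      simp only [Pi.zero_apply] at hj
      omega
    | succ n ih =>
      intro k hk
      obtain ⟨j, hj⟩ := Function.ne_iff.1 (hb k)
      by_cases hjT : j ∈ T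
      · obtain ⟨⟨l, hl⟩, _⟩ := hBr j hjT
        obtain ⟨h1, h2⟩ := one j hjT k hj
        have h3 := sum_lt_of_lt h1 h2
        rw [hl] at h1 h3
        obtain ⟨i, hi, hi'⟩ := ih l (by omega)
        exact ⟨i, hi, by have : b l i ≤ b k i := h1 i; omega⟩
      · exact ⟨j, hjT, hj⟩
  have zero : ∃ i, i ∉ T := by
    by_contra hc
    push Not at hc
    obtain ⟨i⟩ := ‹Nonempty κ›
    obtain ⟨⟨k, _⟩, _⟩ := hBr i (hc i)
    obtain ⟨j, hj, _⟩ := five _ k le_rfl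
    exact hj (hc j)
  have two : ∀ k, ∑ i, (if i ∈ T ∧ B i = b k then (A k i : ℝ) * r i else 0) = h k 0 := by
    intro k
    refine tendsto_nhds_unique ?_ (hSt k)
    have : ∀ t, - lg (A k) (z t) * mono (b k) (z t) = ∑ i, (A k i : ℝ) * (Z i t * mono (b k) (z t)) := by
      intro t
      rw [hlg, Finset.sum_mul]
      simp only [mul_assoc]
    simp only [this]
    refine tendsto_finsetSum _ fun i _ => ?_
    by_cases ha : A k i = 0
    · simp [ha]
    · obtain ⟨x, hx, ht⟩ := limex k i ha
      split_ifs with hi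
      · have := (hBr i hi.1).2
        rw [hi.2] at this
        exact this.const_mul _
      · rcases hx.eq_or_lt with h1 | h1
        · subst h1
          simpa using ht.const_mul (A k i : ℝ)
        · exact absurd ⟨(hT i).2 ⟨k, x, h1, ht⟩, cmp2 i ((hT i).2 ⟨k, x, h1, ht⟩) k x h1 ht⟩ hi
  have four : ∀ l, ∃ ρ : κ → ℝ, ∀ k, b k = b l →
      ∑ i, (if i ∈ T ∧ B i = b k then (A k i : ℝ) * ρ i else 0) = if k = l then 1 else 0 := by
    intro l
    have hd : ∀ g : {k // b k = b l} → ℤ, (∀ i, ∑ k, g k * (if i ∈ T ∧ B i = b l then A k.1 i else 0) = 0) → g = 0 := by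
      intro g hg
      by_contra hgne
      obtain ⟨⟨k0, hk0⟩, hne⟩ := Function.ne_iff.1 hgne
      set q : K → ℤ := fun k => if hk : b k = b l then g ⟨k, hk⟩ else 0 with hq
      have hq0 : q k0 ≠ 0 := by simpa [hq, hk0] using hne
      obtain ⟨C, hC, hD⟩ := hV q k0 hq0
      have sub : ∀ F : K → ℝ, ∑ k, (q k : ℝ) * F k = ∑ k : {k // b k = b l}, (g k : ℝ) * F k.1 := by
        intro F
        rw [← Finset.sum_filter_of_ne (p := fun k => b k = b l), Finset.sum_subtype _ (p := fun k => b k = b l) (by simp)]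
        · refine Finset.sum_congr rfl fun k _ => ?_
          simp [hq, k.2]
        · intro k _ hk
          by_contra hc
          simp [hq, hc] at hk
      have lim0 : ∑ k : {k // b k = b l}, (g k : ℝ) * h k.1 0 = 0 := by
        have e1 : ∀ k : {k // b k = b l}, (g k : ℝ) * h k.1 0 =
            ∑ i, r i * ((g k * (if i ∈ T ∧ B i = b l then A k.1 i else 0) : ℤ) : ℝ) := by
          intro k
          rw [← two k.1, Finset.mul_sum]
          refine Finset.sum_congr rfl fun i _ => ?_
          rw [k.2]
          split_ifs
          · push_cast; ring
          · simp
        simp only [e1]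
        rw [Finset.sum_comm]
        refine Finset.sum_eq_zero fun i _ => ?_
        rw [← Finset.mul_sum, ← Int.cast_sum, hg i]
        simp
      have lim1 : Tendsto (fun t => (∑ k, (q k : ℝ) * (- lg (A k) (z t))) * mono (b l) (z t)) 𝒰 (𝓝 0) := by
        rw [← lim0]
        have : ∀ t, (∑ k, (q k : ℝ) * (- lg (A k) (z t))) * mono (b l) (z t) =
            ∑ k : {k // b k = b l}, (g k : ℝ) * ((- lg (A k.1) (z t)) * mono (b k.1) (z t)) := by
          intro t
          rw [sub, Finset.sum_mul]
          refine Finset.sum_congr rfl fun k _ => ?_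
          rw [k.2, mul_assoc]
        simp only [this]
        exact tendsto_finsetSum _ fun k _ => (hSt k.1).const_mul _
      have lim2 : Tendsto (fun t => C * (mono (b l) (z t) +
          |(∑ k, (q k : ℝ) * (- lg (A k) (z t))) * mono (b l) (z t)|)) 𝒰 (𝓝 0) := by
        have := ((mono_tendsto_zero hz (hb l)).add lim1.abs).const_mul C
        simpa using this
      have lim3 := (hSt k0).abs
      have : |h k0 0| ≤ 0 := by
        refine le_of_tendsto_of_tendsto lim3 lim2 ?_
        filter_upwards [hD, hpos] with t h1 h2
        have mp := mono_pos (b l) h2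
        rw [hk0, abs_mul, abs_mul, abs_of_pos mp]
        have := mul_le_mul_of_nonneg_right h1 mp.le
        refine this.trans (le_of_eq ?_)
        ring
      exact h0 k0 (abs_nonpos_iff.1 this)
    obtain ⟨ρ, hρ⟩ := exists_dual (K' := {k // b k = b l})
      (fun k i => if i ∈ T ∧ B i = b l then A k.1 i else 0) hd ⟨l, rfl⟩
    · refine ⟨ρ, fun k hk => ?_⟩
      have := hρ ⟨k, hk⟩
      simp only [Subtype.mk.injEq] at this
      rw [← this]
      refine Finset.sum_congr rfl fun i _ => ?_
      rw [hk]
      split_ifs <;> simp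
  choose R hR using four
  choose i0 hi0 using fun k => five _ k le_rfl
  have := curveD T zero B r hr hBne hBT (fun k i => (A k i : ℝ)) b h hh two ?_ (fun i l => R l i)
    (fun k l hkl => hR l k hkl) i0 hi0
  · refine this.mono (Eventually.of_forall fun v hv k => ?_)
    have := hv k
    simpa [lg] using this
  · intro k j hj ha hne
    have ha : A k j ≠ 0 := by simpa using ha
    obtain ⟨x, _, hx⟩ := limex k j ha
    exact cmp1 j hj k x hx

end E2

section E3
variable {I : Type} {𝒰 : Ultrafilter I} {κ κ' : Type} [Fintype κ] [Fintype κ'] {K : Type} [Fintype K]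

lemma MChart.nonempty [Nonempty κ] {y : I → κ → ℝ} {z : I → κ' → ℝ} {N : κ → κ' → ℕ}
    {Ψ : (κ' → ℝ) → κ → ℝ} (h : MChart 𝒰 y z N Ψ) : Nonempty κ' := by
  by_contra hc
  rw [not_nonempty_iff] at hc
  obtain ⟨v, hv⟩ := (h.tendsto.eventually (FP_pos (κ := κ))).exists
  have : v = 0 := Subsingleton.elim _ _
  rw [this, h.ch.zero] at hv
  obtain ⟨i⟩ := ‹Nonempty κ›
  exact lt_irrefl _ (hv i)

lemma lg_pull_tendsto {y : I → κ → ℝ} {z : I → κ' → ℝ} {N : κ → κ' → ℕ}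
    {Ψ : (κ' → ℝ) → κ → ℝ} (h : MChart 𝒰 y z N Ψ) (A : κ → ℤ) :
    ∃ x, Tendsto (fun t => - lg (expoZ N A) (z t) - - lg A (y t)) 𝒰 (𝓝 x) := by
  obtain ⟨w, hw, e⟩ := lg_pull h.mono
  refine ⟨w A 0, ?_⟩
  have := (hw A).continuousAt.tendsto.comp (tendsto_FP.1 h.ch.tz).1
  refine this.congr' ?_
  filter_upwards [h.ch.tz.eventually e, h.ch.eq] with t h1 h2
  rw [h2, h1 A]
  simp

structure Sys (𝒰 : Ultrafilter I) (y : I → κ → ℝ) (A m : K → κ → ℤ) (u l : K → (κ → ℝ) → ℝ) :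
    Prop where
  ty : Tendsto y 𝒰 (FP κ)
  au : ∀ k, AnalyticAt ℝ (u k) 0
  al : ∀ k, AnalyticAt ℝ (l k) 0
  eq : ∀ k, ∀ᶠ t in (𝒰 : Filter I), LV (A k) (m k) (u k) (l k) (y t) = 0
  vi : VI 𝒰 (fun k t => - lg (A k) (y t))

def Bd (𝒰 : Ultrafilter I) (a : I → ℝ) : Prop := Dom 𝒰 a (fun _ => 0)

lemma Sys.pull {y : I → κ → ℝ} {z : I → κ' → ℝ} {N : κ → κ' → ℕ}
    {Ψ : (κ' → ℝ) → κ → ℝ} {A m : K → κ → ℤ} {u l : K → (κ → ℝ) → ℝ} (h : Sys 𝒰 y A m u l)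
    (hm : MChart 𝒰 y z N Ψ) : ∃ E l' : K → (κ' → ℝ) → ℝ, (∀ k, AnalyticAt ℝ (E k) 0) ∧
      (∀ k, 0 < E k 0) ∧ Sys 𝒰 z (fun k => expoZ N (A k)) (fun k => expoZ N (m k))
        (fun k v => u k (Ψ v) * E k v) l' ∧
      (∀ᶠ v in FP κ', ∀ k, LV (A k) (m k) (u k) (l k) (Ψ v) =
        LV (expoZ N (A k)) (expoZ N (m k)) (fun v => u k (Ψ v) * E k v) (l' k) v) ∧
      (∀ k, Bd 𝒰 (fun t => - lg (expoZ N (A k)) (z t)) ↔ Bd 𝒰 (fun t => - lg (A k) (y t))) := by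
  choose E l' h1 h2 h3 h4 using fun k => LV_pull hm.mono hm.ch.zero (A k) (m k) (u k) (h.al k)
  choose x hx using fun k => lg_pull_tendsto hm (A k)
  refine ⟨E, l', h1, h2, ⟨hm.ch.tz, fun k => (analyticAt_comp0 (h.au k) hm.ch.an hm.ch.zero).mul (h1 k),
    h3, fun k => ?_, h.vi.change x hx⟩, eventually_all.2 h4, fun k => ⟨fun hb => ?_, fun hb => ?_⟩⟩
  · filter_upwards [h.eq k, hm.ch.tz.eventually (h4 k), hm.ch.eq] with t a b c
    rw [← b, ← c, a]
  · refine Dom.of_sub (x := - x k) ?_ hb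
    refine (hx k).neg.congr fun t => ?_
    ring
  · exact Dom.of_sub (hx k) hb

lemma exp_lg_nonneg {m : κ → ℤ} (hm : 0 ≤ m) {v : κ → ℝ} (hv : ∀ i, 0 < v i) :
    Real.exp (lg m v) = mono (fun i => (m i).toNat) v := by
  rw [mono_eq_exp _ hv]
  congr 2
  ext i
  exact (Int.toNat_of_nonneg (hm i)).symm

lemma exp_lg_nonpos {m : κ → ℤ} (hm : m ≤ 0) {v : κ → ℝ} (hv : ∀ i, 0 < v i) :
    Real.exp (lg m v) = (mono (fun i => (- m i).toNat) v)⁻¹ := by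
  have : Real.exp (lg (-m) v) = mono (fun i => (- m i).toNat) v :=
    exp_lg_nonneg (by simpa using hm) hv
  rw [← this, lg_neg, Real.exp_neg, inv_inv]

lemma lg_bdd_zero {z : I → κ → ℝ} (hz : Tendsto z 𝒰 (FP κ)) {A : κ → ℤ} (hA : 0 ≤ A ∨ A ≤ 0)
    (hb : Bd 𝒰 (fun t => - lg A (z t))) : A = 0 := by
  wlog hA' : 0 ≤ A generalizing A
  · have h2 : A ≤ 0 := hA.resolve_left hA'
    have := this (A := -A) (Or.inl (by simpa using h2)) (((Dom.smul (-1) hb)).congr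
      (Eventually.of_forall fun t => by rw [lg_neg]; ring)) (by simpa using h2)
    simpa using this
  by_contra hne
  obtain ⟨i, hi⟩ := Function.ne_iff.1 hne
  simp only [Pi.zero_apply] at hi
  have hi1 : 1 ≤ A i := by have : 0 ≤ A i := hA' i; omega
  obtain ⟨C, hC, hD⟩ := hb
  obtain ⟨hz0, hpos⟩ := tendsto_FP.1 hz
  have hzi : ∀ i, Tendsto (fun t => z t i) 𝒰 (𝓝 0) := fun i => (tendsto_pi_nhds.1 hz0) i
  have h1 : ∀ᶠ t in (𝒰 : Filter I), ∀ j, z t j < 1 :=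
    eventually_all.2 fun j => (hzi j).eventually (gt_mem_nhds one_pos)
  have h2 : ∀ᶠ t in (𝒰 : Filter I), z t i < Real.exp (-(C + 1)) :=
    (hzi i).eventually (gt_mem_nhds (Real.exp_pos _))
  obtain ⟨t, a, b, c, e⟩ := (hD.and (hpos.and (h1.and h2))).exists
  have hl : Real.log (z t i) < -(C + 1) := by
    rw [← Real.log_exp (-(C+1))]
    exact Real.log_lt_log (b i) e
  have : - (∑ j, (A j : ℝ) * Real.log (z t j)) ≥ - Real.log (z t i) := by
    rw [← Finset.sum_neg_distrib]
    have h3 := Finset.single_le_sum (f := fun j => -((A j : ℝ) * Real.log (z t j)))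
      (fun j _ => by
        have : (0:ℝ) ≤ A j := by exact_mod_cast hA' j
        have := mul_nonneg this (neg_nonneg.2 (Real.log_nonpos (b j).le (c j).le))
        linarith) (Finset.mem_univ i)
    refine le_trans ?_ h3
    have : (1:ℝ) ≤ A i := by exact_mod_cast hi1
    have hh : Real.log (z t i) ≤ 0 := by linarith
    nlinarith
  have h4 := le_abs_self (- lg A (z t))
  simp only [abs_zero, add_zero, mul_one] at a
  simp only [lg] at h4 a
  linarith

theorem caseB' [Nonempty κ] {y : I → κ → ℝ} {A m : K → κ → ℤ} {u l : K → (κ → ℝ) → ℝ}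
    (h : Sys 𝒰 y A m u l) (hnb : ∀ k, ¬ Bd 𝒰 (fun t => - lg (A k) (y t))) (hu : ∀ k, u k 0 ≠ 0) :
    HasCurve {v : κ → ℝ | ∀ k, LV (A k) (m k) (u k) (l k) v = 0} := by
  classical
  obtain ⟨κ', _, z, N, Ψ, -, hm, hs⟩ := toric (Finset.univ : Finset (K ⊕ K ⊕ K × K)) h.ty
    (Sum.elim A (Sum.elim m fun p => m p.1 - m p.2))
  obtain ⟨E, l', hE, hE0, h', hpull, hbd⟩ := h.pull hm
  have hsA : ∀ k, 0 ≤ expoZ N (A k) ∨ expoZ N (A k) ≤ 0 := fun k => hs (Sum.inl k) (by simp)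
  have hsm : ∀ k, 0 ≤ expoZ N (m k) ∨ expoZ N (m k) ≤ 0 := fun k => hs (Sum.inr (Sum.inl k)) (by simp)
  have hsd : ∀ k j, 0 ≤ expoZ N (m k - m j) ∨ expoZ N (m k - m j) ≤ 0 :=
    fun k j => hs (Sum.inr (Sum.inr (k, j))) (by simp)
  have hsub : ∀ k j, expoZ N (m k - m j) = expoZ N (m k) - expoZ N (m j) := by
    intro k j; ext i; simp [expoZ, sub_mul, Finset.sum_sub_distrib]
  simp only [hsub, sub_nonneg, sub_nonpos] at hsd
  set A' := fun k => expoZ N (A k) with hA'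
  set m' := fun k => expoZ N (m k) with hm'
  set u' : K → (κ' → ℝ) → ℝ := fun k v => u k (Ψ v) * E k v with hu'
  have hu0 : ∀ k, u' k 0 ≠ 0 := fun k => by
    simp only [hu', hm.ch.zero]
    exact mul_ne_zero (hu k) (hE0 k).ne'
  have hneg : ∀ k, ¬ 0 ≤ m' k := by
    intro k hk
    refine hnb k ((hbd k).1 ?_)
    have c1 : Tendsto (fun t => mono (fun i => (m' k i).toNat) (z t) * u' k (z t) + l' k (z t)) 𝒰
        (𝓝 (mono (fun i => (m' k i).toNat) 0 * u' k 0 + l' k 0)) := by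
      have hz0 := (tendsto_FP.1 h'.ty).1
      exact (((analyticAt_mono _ 0).continuousAt.tendsto.comp hz0).mul
        ((h'.au k).continuousAt.tendsto.comp hz0)).add ((h'.al k).continuousAt.tendsto.comp hz0)
    refine (Dom.of_tendsto c1).congr ?_
    filter_upwards [h'.eq k, (tendsto_FP.1 h'.ty).2] with t a b
    rw [LV, exp_lg_nonneg hk b] at a
    simp only [hA', hu', hm'] at a ⊢
    linarith
  have hle : ∀ k, m' k ≤ 0 := fun k => (hsm k).resolve_left (hneg k)
  have := hm.nonempty
  let b : K → κ' → ℕ := fun k i => (- m' k i).toNat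
  have hb : ∀ k, b k ≠ 0 := by
    intro k hk
    refine hneg k fun i => ?_
    have h1 := congrFun hk i
    simp only [b, Pi.zero_apply] at h1 ⊢
    omega
  have hbb : ∀ k j, b k ≤ b j ∨ b j ≤ b k := by
    intro k j
    rcases hsd k j with h1 | h1
    · left
      intro i
      have : m' j i ≤ m' k i := h1 i
      simp only [b]; omega
    · right
      intro i
      have : m' k i ≤ m' j i := h1 i
      simp only [b]; omega
  let H : K → (κ' → ℝ) → ℝ := fun k v => u' k v + mono (b k) v * l' k v
  have key : ∀ v : κ' → ℝ, (∀ i, 0 < v i) → ∀ k, LV (A' k) (m' k) (u' k) (l' k) v = 0 ↔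
      - lg (A' k) v = H k v / mono (b k) v := by
    intro v hv k
    rw [LV, exp_lg_nonpos (hle k) hv]
    have := (mono_pos (b k) hv).ne'
    simp only [H]
    change lg (A' k) v + (mono (b k) v)⁻¹ * u' k v + l' k v = 0 ↔ _
    have e : (u' k v + mono (b k) v * l' k v) / mono (b k) v = (mono (b k) v)⁻¹ * u' k v + l' k v := by
      field_simp
    rw [e]
    constructor <;> intro hh <;> linarith
  have res := caseB h'.ty A' hsA b hb hbb H
    (fun k => (h'.au k).add ((analyticAt_mono _ 0).mul (h'.al k)))
    (fun k => by simp only [H, mono_zero_arg (hb k)]; simpa using hu0 k)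
    (fun k => by
      filter_upwards [h'.eq k, (tendsto_FP.1 h'.ty).2] with t a c
      exact (key _ c k).1 a) h'.vi
  refine res.chart hm ?_
  filter_upwards [hpull, FP_pos] with v a c d k
  rw [a k]
  exact (key v c k).2 (d k)

lemma not_Bd_of {y : I → κ → ℝ} {A m : κ → ℤ} {u l : (κ → ℝ) → ℝ} (hy : Tendsto y 𝒰 (FP κ))
    (hl : AnalyticAt ℝ l 0) (hu : ∀ᶠ v in 𝓝 0, u v = 0)
    (he : ∀ᶠ t in (𝒰 : Filter I), LV A m u l (y t) = 0) : Bd 𝒰 (fun t => - lg A (y t)) := by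
  have hz0 := (tendsto_FP.1 hy).1
  refine (Dom.of_tendsto (hl.continuousAt.tendsto.comp hz0)).congr ?_
  filter_upwards [hz0.eventually hu, he] with t a b
  rw [LV, a] at b
  simp only [Function.comp]
  linarith

theorem caseB'' [Nonempty κ] {y : I → κ → ℝ} {A m : K → κ → ℤ} {u l : K → (κ → ℝ) → ℝ}
    (h : Sys 𝒰 y A m u l) (hnb : ∀ k, ¬ Bd 𝒰 (fun t => - lg (A k) (y t))) :
    HasCurve {v : κ → ℝ | ∀ k, LV (A k) (m k) (u k) (l k) v = 0} := by
  classical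
  obtain ⟨κ', _, z, N, Ψ, -, hm, hs⟩ := LUm (LUall _) h.ty le_rfl (Finset.univ : Finset K) u
    fun k _ => h.au k
  obtain ⟨E, l', hE, hE0, h', hpull, hbd⟩ := h.pull hm
  have hN : ∀ k, NC fun v => u k (Ψ v) := by
    intro k
    refine (hs k (by simp)).resolve_left fun h0 => hnb k ((hbd k).1 ?_)
    refine not_Bd_of h'.ty (h'.al k) ?_ (h'.eq k)
    filter_upwards [h0] with v hv
    rw [hv, zero_mul]
  choose α U hU hU0 hUe using hN
  have ek : ∀ᶠ v in FP κ', ∀ k, LV (expoZ N (A k)) (expoZ N (m k)) (fun v => u k (Ψ v) * E k v) (l' k) v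
      = LV (expoZ N (A k)) (expoZ N (m k) + fun i => (α k i : ℤ)) (fun v => U k v * E k v) (l' k) v := by
    filter_upwards [FP_le (eventually_all.2 hUe), FP_pos] with v a b k
    rw [LV, LV, lg_add, Real.exp_add, ← mono_eq_exp _ b, a k]
    ring
  have h2 : Sys 𝒰 z (fun k => expoZ N (A k)) (fun k => expoZ N (m k) + fun i => (α k i : ℤ))
      (fun k v => U k v * E k v) l' :=
    ⟨h'.ty, fun k => (hU k).mul (hE k), h'.al, fun k => by
      filter_upwards [h'.ty.eventually ek, h'.eq k] with t a b
      rw [← a k, b], h'.vi⟩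
  have := hm.nonempty
  refine (caseB' h2 (fun k hk => hnb k ((hbd k).1 hk))
    fun k => mul_ne_zero (hU0 k) (hE0 k).ne').chart hm ?_
  filter_upwards [hpull, ek] with v a b c k
  rw [a k, b k]
  exact c k

theorem caseA {y : I → κ → ℝ} {A m : K → κ → ℤ} {u l : K → (κ → ℝ) → ℝ}
    (h : Sys 𝒰 y A m u l) (k0 : K) (h0 : Bd 𝒰 (fun t => - lg (A k0) (y t))) :
    ∃ (κ' : Type) (_ : Fintype κ') (z : I → κ' → ℝ) (N : κ → κ' → ℕ) (Ψ : (κ' → ℝ) → κ → ℝ),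
      MChart 𝒰 y z N Ψ ∧ ∀ᶠ v in FP κ', LV (A k0) (m k0) (u k0) (l k0) (Ψ v) = 0 := by
  classical
  obtain ⟨κ', _, z, N, Ψ, -, hm, hs⟩ := toric (Finset.univ : Finset Unit) h.ty (fun _ => A k0)
  obtain ⟨E, l', hE, hE0, h', hpull, hbd⟩ := h.pull hm
  have hA0 : expoZ N (A k0) = 0 := lg_bdd_zero h'.ty (hs () (by simp)) ((hbd k0).2 h0)
  set m' := expoZ N (m k0) with hm'
  let u' : (κ' → ℝ) → ℝ := fun v => u k0 (Ψ v) * E k0 v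
  let g : (κ' → ℝ) → ℝ := fun v => mono (fun i => (m' i).toNat) v * u' v +
    mono (fun i => (- m' i).toNat) v * l' k0 v
  have hg : AnalyticAt ℝ g 0 := ((analyticAt_mono _ 0).mul (h'.au k0)).add
    ((analyticAt_mono _ 0).mul (h'.al k0))
  have key : ∀ v : κ' → ℝ, (∀ i, 0 < v i) → (LV (expoZ N (A k0)) m' u' (l' k0) v = 0 ↔ g v = 0) := by
    intro v hv
    have e1 : m' = (fun i => ((m' i).toNat : ℤ)) - fun i => ((- m' i).toNat : ℤ) := by
      ext i; simp only [Pi.sub_apply]; omega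
    have e2 : Real.exp (lg m' v) = mono (fun i => (m' i).toNat) v / mono (fun i => (- m' i).toNat) v := by
      conv_lhs => rw [e1]
      rw [lg_sub, Real.exp_sub, ← mono_eq_exp _ hv, ← mono_eq_exp _ hv]
    have := (mono_pos (fun i => (- m' i).toNat) hv).ne'
    rw [LV, hA0, lg_zero, zero_add, e2]
    simp only [g]
    rw [← mul_right_inj' this (c := 0), mul_zero]
    apply Eq.congr_left
    field_simp
  obtain ⟨κ'', _, w, N', Ψ', -, hm2, hs2⟩ := LUm (LUall _) h'.ty le_rfl (Finset.univ : Finset Unit)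
    (fun _ => g) fun _ _ => hg
  have hg0 : ∀ᶠ v in 𝓝 0, g (Ψ' v) = 0 := by
    refine (hs2 () (by simp)).resolve_right ?_
    rintro ⟨α, hα⟩
    obtain ⟨t, a, b, c, d⟩ := ((hm2.ch.tz.eventually hα.ne).and ((h'.eq k0).and
      ((tendsto_FP.1 h'.ty).2.and hm2.ch.eq))).exists
    refine a ?_
    rw [← d]
    exact (key _ c).1 b
  refine ⟨κ'', _, w, _, _, hm.comp hm2, ?_⟩
  filter_upwards [hm2.tendsto.eventually hpull, FP_le hg0, hm2.tendsto.eventually FP_pos] with v a b c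
  rw [a k0]
  exact (key _ c).2 b

theorem Main3 (n : ℕ) : ∀ (κ : Type) [Fintype κ] [Nonempty κ] (K : Type) [Fintype K]
    (y : I → κ → ℝ) (A m : K → κ → ℤ) (u l : K → (κ → ℝ) → ℝ), Fintype.card K ≤ n →
    Sys 𝒰 y A m u l → HasCurve {v : κ → ℝ | ∀ k, LV (A k) (m k) (u k) (l k) v = 0} := by
  classical
  induction n with
  | zero =>
    intro κ _ _ K _ y A m u l hn h
    have : IsEmpty K := Fintype.card_eq_zero_iff.1 (by omega)
    exact caseB'' h fun k => isEmptyElim k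
  | succ n ih =>
    intro κ _ _ K _ y A m u l hn h
    by_cases hb : ∀ k, ¬ Bd 𝒰 (fun t => - lg (A k) (y t))
    · exact caseB'' h hb
    · push Not at hb
      obtain ⟨k0, hk0⟩ := hb
      obtain ⟨κ', _, z, N, Ψ, hm, hz⟩ := caseA h k0 hk0
      obtain ⟨E, l', hE, hE0, h', hpull, hbd⟩ := h.pull hm
      have := hm.nonempty
      have h2 : Sys 𝒰 z (fun k : {k // k ≠ k0} => expoZ N (A k)) (fun k => expoZ N (m k))
        (fun k v => u k (Ψ v) * E k v) (fun k => l' k) :=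
        ⟨h'.ty, fun k => h'.au k, fun k => h'.al k, fun k => h'.eq k,
          h'.vi.sub _ Subtype.val_injective⟩
      refine (ih κ' {k // k ≠ k0} z _ _ _ _ ?_ h2).chart hm ?_
      · rw [Fintype.card_subtype_compl]; simp; omega
      · filter_upwards [hpull, hz] with v a b c k
        by_cases hk : k = k0
        · rw [hk, b]
        · rw [a k]; exact c ⟨k, hk⟩

theorem Main2 [Nonempty κ] {y : I → κ → ℝ} (hy : Tendsto y 𝒰 (FP κ)) (A m : K → κ → ℤ)
    (u l : K → (κ → ℝ) → ℝ) (hu : ∀ k, AnalyticAt ℝ (u k) 0) (hl : ∀ k, AnalyticAt ℝ (l k) 0)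
    (he : ∀ k, ∀ᶠ t in (𝒰 : Filter I), LV (A k) (m k) (u k) (l k) (y t) = 0) :
    HasCurve {v : κ → ℝ | ∀ k, LV (A k) (m k) (u k) (l k) v = 0} := by
  classical
  obtain ⟨Q, hQ, hV⟩ := exists_VI (𝒰 := 𝒰) (fun k t => - lg (A k) (y t))
  let E : κ → ℤ := fun i => ∑ k, |m k i|
  let A' : K → κ → ℤ := fun k i => ∑ j, Q k j * A j i
  let u' : K → (κ → ℝ) → ℝ := fun k v => ∑ j, (Q k j : ℝ) * (mono (fun i => (m j i + E i).toNat) v * u j v)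
  let l' : K → (κ → ℝ) → ℝ := fun k v => ∑ j, (Q k j : ℝ) * l j v
  have lgA : ∀ k v, lg (A' k) v = ∑ j, (Q k j : ℝ) * lg (A j) v := by
    intro k v
    simp only [lg, A', Finset.mul_sum, Int.cast_sum, Finset.sum_mul]
    rw [Finset.sum_comm]
    simp [mul_assoc]
  have key : ∀ v : κ → ℝ, (∀ i, 0 < v i) → ∀ k, LV (A' k) (-E) (u' k) (l' k) v =
      ∑ j, (Q k j : ℝ) * LV (A j) (m j) (u j) (l j) v := by
    intro v hv k
    have e : ∀ j, mono (fun i => (m j i + E i).toNat) v = Real.exp (lg (m j) v) * Real.exp (lg E v) := by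
      intro j
      rw [← Real.exp_add, ← lg_add, exp_lg_nonneg _ hv]
      · rfl
      · intro i
        have h1 := Finset.single_le_sum (f := fun k => |m k i|) (fun _ _ => abs_nonneg _) (Finset.mem_univ j)
        have h2 := neg_abs_le (m j i)
        simp only [Pi.add_apply, Pi.zero_apply, E]
        omega
    simp only [LV, lgA, u', l', e, lg_neg, Real.exp_neg, mul_add, Finset.sum_add_distrib]
    congr 2
    rw [Finset.mul_sum]
    refine Finset.sum_congr rfl fun j _ => ?_
    have := (Real.exp_pos (lg E v)).ne'
    field_simp
  have hS : Sys 𝒰 y A' (fun _ => -E) u' l' := by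
    refine ⟨hy, fun k => analyticAt_sum' fun j _ => analyticAt_const.mul ((analyticAt_mono _ 0).mul (hu j)),
      fun k => analyticAt_sum' fun j _ => analyticAt_const.mul (hl j), fun k => ?_, ?_⟩
    · filter_upwards [(tendsto_FP.1 hy).2, eventually_all.2 he] with t a b
      rw [key _ a]
      simp [b]
    · convert hV using 3 with k t
      rw [lgA]
      simp
  refine (Main3 _ κ K y _ _ _ _ le_rfl hS).mono ?_
  filter_upwards [FP_pos] with v hv h
  have := hQ (fun k => LV (A k) (m k) (u k) (l k) v) fun k => by rw [← key v hv]; exact h k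
  exact fun k => congrFun this k

end E3

section F1

lemma assemble {E : Type*} [NormedAddCommGroup E] [NormedSpace ℝ E] {δ : ℝ → E} {Δ X : Set E}
    (hX : X ⊆ Δ) (h0 : (0 : E) ∈ Δ) (h1 : ∀ᶠ τ in 𝓝[>] (0:ℝ), AnalyticAt ℝ δ τ)
    (h2 : ∃ ε > 0, InjOn δ (Ioo 0 ε)) (h3 : Tendsto δ (𝓝[>] 0) (𝓝 0))
    (h4 : ∀ᶠ τ in 𝓝[>] (0:ℝ), δ τ ∈ X ∧ δ τ ≠ 0) :
    ∃ γ : ℝ → E, ContinuousOn γ (Ico (0 : ℝ) 1) ∧ InjOn γ (Ico (0 : ℝ) 1) ∧ γ 0 = 0 ∧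
      γ '' Ico (0 : ℝ) 1 ⊆ Δ ∧ AnalyticOnNhd ℝ γ (Ioo (0 : ℝ) 1) ∧ γ '' Ioo (0 : ℝ) 1 ⊆ X := by
  obtain ⟨ε, hε, hinj⟩ := h2
  obtain ⟨ε1, hε1, hs⟩ := mem_nhdsGT_iff_exists_Ioo_subset.1 (h1.and h4)
  simp only [mem_Ioi] at hε1
  set e := min ε ε1 with he
  have e0 : 0 < e := lt_min hε hε1
  have mem : ∀ t ∈ Ioo (0:ℝ) 1, e * t ∈ Ioo 0 ε ∧ e * t ∈ Ioo 0 ε1 := by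
    intro t ht
    have a : 0 < e * t := mul_pos e0 ht.1
    have b : e * t < e := by nlinarith [ht.2]
    exact ⟨⟨a, b.trans_le (min_le_left _ _)⟩, ⟨a, b.trans_le (min_le_right _ _)⟩⟩
  let γ : ℝ → E := fun t => if 0 < t then δ (e * t) else 0
  have γ0 : γ 0 = 0 := by simp [γ]
  have γp : ∀ t, 0 < t → γ t = δ (e * t) := fun t ht => by simp [γ, ht]
  have han : AnalyticOnNhd ℝ γ (Ioo 0 1) := by
    intro t ht
    have a := (hs (mem t ht).2).1
    have b : AnalyticAt ℝ (fun t : ℝ => e * t) t := analyticAt_const.mul analyticAt_id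
    refine (AnalyticAt.fun_comp (g := δ) (f := fun t : ℝ => e * t) a b).congr ?_
    filter_upwards [lt_mem_nhds ht.1] with s hs
    rw [γp s hs]
  have hXm : ∀ t ∈ Ioo (0:ℝ) 1, γ t ∈ X ∧ γ t ≠ 0 := by
    intro t ht
    rw [γp t ht.1]
    exact (hs (mem t ht).2).2
  have split : ∀ t ∈ Ico (0:ℝ) 1, t = 0 ∨ t ∈ Ioo (0:ℝ) 1 := by
    intro t ht
    rcases ht.1.eq_or_lt with h | h
    · exact Or.inl h.symm
    · exact Or.inr ⟨h, ht.2⟩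
  refine ⟨γ, ?_, ?_, γ0, ?_, han, ?_⟩
  · intro t ht
    rcases split t ht with rfl | h
    · refine ContinuousWithinAt.mono ?_ (fun s (hs : s ∈ Ico (0:ℝ) 1) => (hs.1 : s ∈ Ici (0:ℝ)))
      refine continuousWithinAt_Ioi_iff_Ici.1 ?_
      rw [ContinuousWithinAt, γ0]
      have sc : Tendsto (fun t : ℝ => e * t) (𝓝[>] 0) (𝓝[>] 0) := by
        refine tendsto_nhdsWithin_iff.2 ⟨?_, ?_⟩
        · have : Tendsto (fun t : ℝ => e * t) (𝓝 0) (𝓝 (e * 0)) := (continuous_const_mul e).tendsto 0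
          rw [mul_zero] at this
          exact this.mono_left nhdsWithin_le_nhds
        · filter_upwards [self_mem_nhdsWithin] with t ht
          exact mul_pos e0 ht
      refine (h3.comp sc).congr' ?_
      filter_upwards [self_mem_nhdsWithin] with t ht
      rw [γp t ht]; rfl
    · exact (han t h).continuousAt.continuousWithinAt
  · intro a ha b hb hab
    rcases split a ha with rfl | h <;> rcases split b hb with rfl | h'
    · rfl
    · rw [γ0] at hab
      exact absurd hab.symm (hXm b h').2
    · rw [γ0] at hab
      exact absurd hab (hXm a h).2
    · rw [γp a h.1, γp b h'.1] at hab
      have := hinj (mem a h).1 (mem b h').1 hab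
      exact mul_left_cancel₀ e0.ne' this
  · rintro _ ⟨t, ht, rfl⟩
    rcases split t ht with rfl | h
    · rw [γ0]; exact h0
    · exact hX (hXm t h).1
  · rintro _ ⟨t, ht, rfl⟩
    exact (hXm t ht).1

variable {c d : ℕ}

noncomputable def PM (c : ℕ) (lam : Fin d → ℝ) (x : (Fin d × Bool) ⊕ Fin c → ℝ) : Fin d → ℂ := fun k =>
  if (k : ℕ) < c then
    (x (Sum.inl (k, false)) : ℂ) * Complex.exp (((lam k + x (Sum.inl (k, true)) : ℝ) : ℂ) * Complex.I)
  else (x (Sum.inl (k, false)) : ℂ) + (x (Sum.inl (k, true)) : ℂ) * Complex.I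

noncomputable def XM (hcd : c ≤ d) (lam : Fin d → ℝ) (t : Fin d → ℂ) : (Fin d × Bool) ⊕ Fin c → ℝ
  | Sum.inl (k, false) => if (k : ℕ) < c then ‖t k‖ else (t k).re
  | Sum.inl (k, true) => if (k : ℕ) < c then Complex.arg (t k) - lam k else (t k).im
  | Sum.inr k => - (Real.log ‖t (Fin.castLE hcd k)‖)⁻¹

lemma PM_XM (hcd : c ≤ d) (lam : Fin d → ℝ) (t : Fin d → ℂ) : PM c lam (XM hcd lam t) = t := by
  ext k
  by_cases hk : (k : ℕ) < c
  · simp only [PM, XM, hk, if_true]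
    rw [add_sub_cancel, Complex.norm_mul_exp_arg_mul_I]
  · simp only [PM, XM, hk, if_false]
    exact Complex.re_add_im _

lemma PM_zero (lam : Fin d → ℝ) : PM c lam 0 = 0 := by
  ext k
  simp [PM]

lemma PM_norm (lam : Fin d → ℝ) (x : (Fin d × Bool) ⊕ Fin c → ℝ) (k : Fin d) (hk : (k : ℕ) < c)
    (h : 0 < x (Sum.inl (k, false))) : ‖PM c lam x k‖ = x (Sum.inl (k, false)) := by
  simp only [PM, hk, if_true]
  rw [norm_mul, Complex.norm_exp_ofReal_mul_I, mul_one, Complex.norm_real, Real.norm_of_nonneg h.le]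

lemma PM_analytic (lam : Fin d → ℝ) (x : (Fin d × Bool) ⊕ Fin c → ℝ) : AnalyticAt ℝ (PM c lam) x := by
  have hof : ∀ i, AnalyticAt ℝ (fun x : (Fin d × Bool) ⊕ Fin c → ℝ => (x i : ℂ)) x := fun i =>
    AnalyticAt.fun_comp (g := fun r : ℝ => (r : ℂ)) (f := fun x : (Fin d × Bool) ⊕ Fin c → ℝ => x i)
      (Complex.ofRealCLM.analyticAt (x i)) (analyticAt_coord i x)
  refine AnalyticAt.pi fun k => ?_
  by_cases hk : (k : ℕ) < c
  · simp only [PM, hk, if_true, Complex.ofReal_add]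
    refine (hof _).mul ?_
    have h1 : AnalyticAt ℝ (fun x : (Fin d × Bool) ⊕ Fin c → ℝ =>
      ((lam k : ℂ) + (x (Sum.inl (k, true)) : ℂ)) * Complex.I) x :=
      (analyticAt_const.add (hof _)).mul analyticAt_const
    have h2 : AnalyticAt ℝ Complex.exp (((lam k : ℂ) + (x (Sum.inl (k, true)) : ℂ)) * Complex.I) :=
      analyticAt_cexp.restrictScalars
    exact AnalyticAt.fun_comp (g := Complex.exp) (f := fun x : (Fin d × Bool) ⊕ Fin c → ℝ =>
      ((lam k : ℂ) + (x (Sum.inl (k, true)) : ℂ)) * Complex.I) h2 h1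
  · simp only [PM, hk, if_false]
    exact (hof _).add ((hof _).mul analyticAt_const)

lemma PM_inj (lam : Fin d → ℝ) (x x' : (Fin d × Bool) ⊕ Fin c → ℝ)
    (h1 : ∀ k : Fin d, (k : ℕ) < c → 0 < x (Sum.inl (k, false)) ∧ |x (Sum.inl (k, true))| < 1)
    (h1' : ∀ k : Fin d, (k : ℕ) < c → 0 < x' (Sum.inl (k, false)) ∧ |x' (Sum.inl (k, true))| < 1)
    (h : PM c lam x = PM c lam x') (j : Fin d × Bool) : x (Sum.inl j) = x' (Sum.inl j) := by
  obtain ⟨k, b⟩ := j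
  have hk := congrFun h k
  by_cases hc : (k : ℕ) < c
  · have hn : x (Sum.inl (k, false)) = x' (Sum.inl (k, false)) := by
      rw [← PM_norm lam x k hc (h1 k hc).1, ← PM_norm lam x' k hc (h1' k hc).1, hk]
    cases b
    · exact hn
    · simp only [PM, hc, if_true] at hk
      rw [hn] at hk
      have hk := mul_left_cancel₀ (Complex.ofReal_ne_zero.2 (h1' k hc).1.ne') hk
      obtain ⟨n, hn⟩ := Complex.exp_eq_exp_iff_exists_int.1 hk
      have e : ((lam k + x (Sum.inl (k, true)) : ℝ) : ℂ) = ((lam k + x' (Sum.inl (k, true)) + n * (2 * Real.pi) : ℝ) : ℂ) := by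
        apply mul_right_cancel₀ Complex.I_ne_zero
        rw [hn]; push_cast; ring
      have e := Complex.ofReal_injective e
      have a := abs_lt.1 (h1 k hc).2
      have b := abs_lt.1 (h1' k hc).2
      have hp := Real.pi_gt_three
      have hn0 : n = 0 := by
        by_contra hne
        rcases lt_or_gt_of_ne hne with h | h
        · have : (n : ℝ) ≤ -1 := by exact_mod_cast (by omega : n ≤ -1)
          nlinarith
        · have : (1 : ℝ) ≤ n := by exact_mod_cast (by omega : 1 ≤ n)
          nlinarith
      rw [hn0] at e
      simp at e
      exact e
  · simp only [PM, hc, if_false] at hk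
    have re := congrArg Complex.re hk
    have im := congrArg Complex.im hk
    simp at re im
    cases b
    · exact re
    · exact im

lemma exists_arg_lim (𝒰 : Ultrafilter (Fin d → ℂ)) : ∃ lam : Fin d → ℝ, ∀ k,
    Tendsto (fun t : Fin d → ℂ => Complex.arg (t k)) 𝒰 (𝓝 (lam k)) := by
  have : ∀ k, ∃ x, Tendsto (fun t : Fin d → ℂ => Complex.arg (t k)) 𝒰 (𝓝 x) := by
    intro k
    rcases tricho 𝒰 (fun t : Fin d → ℂ => Complex.arg (t k)) with h | h | h
    · exact h
    · obtain ⟨t, ht⟩ := (h.eventually (eventually_gt_atTop Real.pi)).exists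
      exact absurd (Complex.arg_le_pi (t k)) (not_le.2 ht)
    · obtain ⟨t, ht⟩ := (h.eventually (eventually_lt_atBot (-Real.pi))).exists
      exact absurd (Complex.neg_pi_lt_arg (t k)) (not_lt.2 ht.le)
  choose lam h using this
  exact ⟨lam, h⟩

lemma XM_tendsto (hcd : c ≤ d) {𝒰 : Ultrafilter (Fin d → ℂ)} (h0 : (𝒰 : Filter (Fin d → ℂ)) ≤ 𝓝 0)
    (hU : ∀ᶠ t in (𝒰 : Filter (Fin d → ℂ)), ∀ k : Fin c, t (Fin.castLE hcd k) ≠ 0)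
    {lam : Fin d → ℝ} (hl : ∀ k, Tendsto (fun t : Fin d → ℂ => Complex.arg (t k)) 𝒰 (𝓝 (lam k))) :
    Tendsto (XM hcd lam) 𝒰 (𝓝 0) := by
  have hk : ∀ k, Tendsto (fun t : Fin d → ℂ => t k) 𝒰 (𝓝 0) := fun k =>
    ((continuous_apply k).tendsto (0 : Fin d → ℂ)).mono_left h0
  rw [tendsto_pi_nhds]
  rintro (⟨k, _ | _⟩ | k)
  · simp only [XM, Pi.zero_apply]
    split_ifs
    · simpa using (hk k).norm
    · exact (Complex.continuous_re.tendsto 0).comp (hk k)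
  · simp only [XM, Pi.zero_apply]
    split_ifs
    · simpa using (hl k).sub_const (lam k)
    · exact (Complex.continuous_im.tendsto 0).comp (hk k)
  · simp only [XM, Pi.zero_apply]
    have h1 : Tendsto (fun t : Fin d → ℂ => ‖t (Fin.castLE hcd k)‖) 𝒰 (𝓝[>] 0) := by
      refine tendsto_nhdsWithin_iff.2 ⟨by simpa using (hk (Fin.castLE hcd k)).norm, ?_⟩
      filter_upwards [hU] with t ht
      exact norm_pos_iff.2 (ht k)
    have h2 := (Real.tendsto_log_nhdsGT_zero.comp h1).inv_tendsto_atBot.neg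
    simpa using h2

/-- clearing denominators -/
lemma clear_denom (M : Finset (Fin c → ℕ)) (a : (Fin c → ℕ) → ℝ) (N : ℕ) (hN : ∀ m ∈ M, ∀ k, m k ≤ N)
    (u L : Fin c → ℝ) (hu : ∀ k, u k ≠ 0) (hL : ∀ k, L k = - (u k)⁻¹) :
    ∑ m ∈ M, a m * ∏ k, ((-1) ^ (m k) * u k ^ (N - m k)) =
      (∏ k, u k ^ N) * ∑ m ∈ M, a m * ∏ k, L k ^ m k := by
  rw [Finset.mul_sum]
  refine Finset.sum_congr rfl fun m hm => ?_
  rw [mul_left_comm, ← Finset.prod_mul_distrib]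
  congr 1
  refine Finset.prod_congr rfl fun k _ => ?_
  rw [hL, ← pow_sub_mul_pow (u k) (hN m hm k), neg_pow (u k)⁻¹, inv_pow]
  have := pow_ne_zero (m k) (hu k)
  field_simp

end F1

section F2
variable {c d p : ℕ}

theorem core (hc : 1 ≤ c) (hcd : c ≤ d) (Δ : Set (Fin d → ℂ)) (hΔ : Δ = {z | ∀ i, ‖z i‖ < 1})
    (U : Set (Fin d → ℂ))
    (hU : U = {z ∈ Δ | ∀ k : Fin c, z (Fin.castLE hcd k) ≠ 0})
    (A : Fin p → (Fin d → ℂ) → ℝ)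
    (hA : ∀ i, ∃ (M : Finset (Fin c → ℕ))
      (coef : (Fin c → ℕ) → (Fin d → ℂ) → ℝ),
      (∀ m ∈ M, AnalyticOnNhd ℝ (coef m) Δ) ∧
      (∀ z ∈ U, A i z =
        ∑ m ∈ M, coef m z * ∏ k : Fin c, (Real.log ‖z (Fin.castLE hcd k)‖) ^ (m k)))
    (X : Set (Fin d → ℂ)) (hX : X = {z ∈ U | ∀ i, A i z = 0}) (𝒰 : Ultrafilter (Fin d → ℂ))
    (h0 : (𝒰 : Filter (Fin d → ℂ)) ≤ 𝓝 0) (hXU : ∀ᶠ t in (𝒰 : Filter (Fin d → ℂ)), t ∈ X) :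
    ∃ δ : ℝ → (Fin d → ℂ), (∀ᶠ τ in 𝓝[>] (0:ℝ), AnalyticAt ℝ δ τ) ∧
    (∃ ε > 0, InjOn δ (Ioo 0 ε)) ∧ Tendsto δ (𝓝[>] 0) (𝓝 0) ∧
    (∀ᶠ τ in 𝓝[>] (0:ℝ), δ τ ∈ X ∧ δ τ ≠ 0) := by
  classical
  choose M coef hcoef hAeq using hA
  have h0Δ : (0 : Fin d → ℂ) ∈ Δ := by rw [hΔ]; simp
  have hUt : ∀ᶠ t in (𝒰 : Filter (Fin d → ℂ)), t ∈ U := by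
    filter_upwards [hXU] with t ht
    rw [hX] at ht; exact ht.1
  have hUne : ∀ᶠ t in (𝒰 : Filter (Fin d → ℂ)), ∀ k : Fin c, t (Fin.castLE hcd k) ≠ 0 := by
    filter_upwards [hUt] with t ht
    rw [hU] at ht; exact ht.2
  obtain ⟨lam, hlam⟩ := exists_arg_lim 𝒰
  have hx := XM_tendsto hcd h0 hUne hlam
  set P := PM c lam with hP
  set x := XM hcd lam with hxd
  have hPx : ∀ t, P (x t) = t := PM_XM hcd lam
  -- degree bounds
  let N : Fin p → ℕ := fun i => ∑ m ∈ M i, ∑ k, m k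
  have hN : ∀ i, ∀ m ∈ M i, ∀ k, m k ≤ N i := by
    intro i m hm k
    have a := Finset.single_le_sum (f := m) (fun _ _ => Nat.zero_le _) (Finset.mem_univ k)
    have b := Finset.single_le_sum (f := fun m : Fin c → ℕ => ∑ k, m k) (fun _ _ => Nat.zero_le _) hm
    exact a.trans b
  let F : Fin p → ((Fin d × Bool) ⊕ Fin c → ℝ) → ℝ := fun i v => ∑ m ∈ M i, coef i m (P v) *
    ∏ k, ((-1) ^ (m k) * v (Sum.inr k) ^ (N i - m k))
  have hF : ∀ i, AnalyticAt ℝ (F i) 0 := by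
    intro i
    refine analyticAt_sum' fun m hm => ?_
    refine AnalyticAt.mul ?_ ?_
    · have h1 : AnalyticAt ℝ (coef i m) (P 0) := by
        rw [hP, PM_zero]; exact hcoef i m hm 0 h0Δ
      exact h1.fun_comp (PM_analytic lam 0)
    · exact Finset.analyticAt_fun_prod _ fun k _ => analyticAt_const.mul ((analyticAt_coord _ _).pow _)
  -- main equivalence
  have hFA : ∀ v : (Fin d × Bool) ⊕ Fin c → ℝ, P v ∈ U → (∀ k, v (Sum.inr k) ≠ 0) →
      (∀ k : Fin c, Real.log ‖P v (Fin.castLE hcd k)‖ = - (v (Sum.inr k))⁻¹) → ∀ i,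
      (F i v = 0 ↔ A i (P v) = 0) := by
    intro v hv h1 h2 i
    have e := clear_denom (M i) (fun m => coef i m (P v)) (N i) (hN i) (fun k => v (Sum.inr k))
      (fun k => Real.log ‖P v (Fin.castLE hcd k)‖) h1 h2
    have : F i v = (∏ k, v (Sum.inr k) ^ N i) * A i (P v) := by
      rw [hAeq i _ hv]; exact e
    rw [this]
    have hne : (∏ k, v (Sum.inr k) ^ N i) ≠ 0 := Finset.prod_ne_zero_iff.2 fun k _ => pow_ne_zero _ (h1 k)
    simp [hne]
  let rho : Fin c → ((Fin d × Bool) ⊕ Fin c → ℝ) → ℝ := fun k v => v (Sum.inl (Fin.castLE hcd k, false))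
  let uu : Fin c → ((Fin d × Bool) ⊕ Fin c → ℝ) → ℝ := fun k v => v (Sum.inr k)
  have lt1 : ∀ᶠ t in (𝒰 : Filter (Fin d → ℂ)), ∀ k : Fin c, 0 < rho k (x t) ∧ 0 < uu k (x t) ∧
      Real.log (rho k (x t)) = - (uu k (x t))⁻¹ := by
    filter_upwards [hUt] with t ht k
    rw [hU, hΔ] at ht
    have e1 : rho k (x t) = ‖t (Fin.castLE hcd k)‖ := by simp [rho, hxd, XM]
    have e2 : uu k (x t) = - (Real.log ‖t (Fin.castLE hcd k)‖)⁻¹ := by simp [uu, hxd, XM]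
    have a : 0 < ‖t (Fin.castLE hcd k)‖ := norm_pos_iff.2 (ht.2 k)
    have b : Real.log ‖t (Fin.castLE hcd k)‖ < 0 := Real.log_neg a (ht.1 _)
    refine ⟨by rw [e1]; exact a, ?_, ?_⟩
    · rw [e2]; exact neg_pos.2 (inv_lt_zero.2 b)
    · rw [e1, e2, inv_neg, neg_neg, inv_inv]
  obtain ⟨κ, _, z, Φ, -, hch, hs⟩ := LUall _ _ le_rfl x hx (Fin p ⊕ Fin c ⊕ Fin c) Finset.univ
    (Sum.elim F (Sum.elim rho uu)) (by
      rintro (i | k | k) -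
      · exact hF i
      · exact analyticAt_coord _ _
      · exact analyticAt_coord _ _)
  have hFz : ∀ i, ∀ᶠ v in 𝓝 0, F i (Φ v) = 0 := by
    intro i
    refine (hs (Sum.inl i) (by simp)).resolve_right ?_
    rintro ⟨α, hα⟩
    obtain ⟨t, a, b, e, f, g⟩ := ((hch.tz.eventually hα.ne).and (hXU.and (hUt.and
      (lt1.and hch.eq)))).exists
    refine a ?_
    rw [← g]
    refine (hFA (x t) ?_ (fun k => (f k).2.1.ne') ?_ i).2 ?_
    · rwa [hPx]
    · intro k
      rw [← (f k).2.2, hPx]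
      simp [rho, hxd, XM]
    · rw [hPx]
      rw [hX] at b
      exact b.2 i
  have hrho : ∀ k, ∃ α, PN α (fun v => rho k (Φ v)) := by
    intro k
    have hp : ∀ᶠ t in (𝒰 : Filter (Fin d → ℂ)), 0 < rho k (Φ (z t)) := by
      filter_upwards [lt1, hch.eq] with t a b
      rw [← b]; exact (a k).1
    rcases hs (Sum.inr (Sum.inl k)) (by simp) with h | ⟨α, hα⟩
    · obtain ⟨t, a, b⟩ := (((tendsto_FP.1 hch.tz).1.eventually h).and hp).exists
      exact absurd a b.ne'
    · exact ⟨α, NN.PN_of_chart hα hch.tz hp⟩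
  have huu : ∀ k, ∃ α, PN α (fun v => uu k (Φ v)) := by
    intro k
    have hp : ∀ᶠ t in (𝒰 : Filter (Fin d → ℂ)), 0 < uu k (Φ (z t)) := by
      filter_upwards [lt1, hch.eq] with t a b
      rw [← b]; exact (a k).2.1
    rcases hs (Sum.inr (Sum.inr k)) (by simp) with h | ⟨α, hα⟩
    · obtain ⟨t, a, b⟩ := (((tendsto_FP.1 hch.tz).1.eventually h).and hp).exists
      exact absurd a b.ne'
    · exact ⟨α, NN.PN_of_chart hα hch.tz hp⟩
  choose a W hW hW0 hWe using hrho
  choose b V hV hV0 hVe using huu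
  have hne : Nonempty κ := by
    by_contra hcon
    rw [not_nonempty_iff] at hcon
    obtain ⟨t, a, b⟩ := (lt1.and hch.eq).exists
    have := (a ⟨0, hc⟩).1
    rw [b, Subsingleton.elim (z t) 0, hch.zero] at this
    exact lt_irrefl _ this
  let L : Fin c → (κ → ℝ) → ℝ := fun k => LV (fun i => (a k i : ℤ)) (-fun i => (b k i : ℤ))
    (fun v => (V k v)⁻¹) (fun v => Real.log (W k v))
  have hL : ∀ᶠ v in FP κ, ∀ k, 0 < rho k (Φ v) ∧ 0 < uu k (Φ v) ∧
      (L k v = Real.log (rho k (Φ v)) + (uu k (Φ v))⁻¹) := by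
    have w0 : ∀ᶠ v in 𝓝 (0 : κ → ℝ), ∀ k, 0 < W k v := eventually_all.2 fun k =>
      (hW k).continuousAt.eventually (lt_mem_nhds (hW0 k))
    have v0 : ∀ᶠ v in 𝓝 (0 : κ → ℝ), ∀ k, 0 < V k v := eventually_all.2 fun k =>
      (hV k).continuousAt.eventually (lt_mem_nhds (hV0 k))
    filter_upwards [FP_le w0, FP_le v0, FP_le (eventually_all.2 hWe), FP_le (eventually_all.2 hVe),
      FP_pos] with v h1 h2 h3 h4 h5 k
    rw [h3 k, h4 k]
    refine ⟨mul_pos (mono_pos _ h5) (h1 k), mul_pos (mono_pos _ h5) (h2 k), ?_⟩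
    simp only [L, LV]
    rw [lg_neg, Real.exp_neg, ← mono_eq_exp _ h5, Real.log_mul (mono_pos _ h5).ne' (h1 k).ne',
      mono_eq_exp (a k) h5, Real.log_exp, mul_inv]
    ring
  obtain ⟨η, g1, ⟨ε, hε, g2⟩, g3, g4⟩ := Main2 hch.tz (fun k i => (a k i : ℤ)) (fun k => -fun i => (b k i : ℤ))
    (fun k v => (V k v)⁻¹) (fun k v => Real.log (W k v)) (fun k => (hV k).inv (hV0 k).ne')
    (fun k => (analyticAt_log (hW0 k)).fun_comp (hW k)) (fun k => by
      filter_upwards [hch.tz.eventually hL, lt1, hch.eq] with t h1 h2 h3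
      change L k (z t) = 0
      rw [(h1 k).2.2, ← h3, (h2 k).2.2]
      ring)
  have hη0 : Tendsto η (𝓝[>] 0) (𝓝 0) := (tendsto_FP.1 g3).1
  have hΦ0 : Tendsto Φ (𝓝 0) (𝓝 0) := by
    have := hch.an.continuousAt.tendsto; rwa [hch.zero] at this
  have hP0 : Tendsto P (𝓝 0) (𝓝 0) := by
    have := (PM_analytic (c := c) lam 0).continuousAt.tendsto; rwa [PM_zero] at this
  have hδ0 : Tendsto (fun τ => P (Φ (η τ))) (𝓝[>] 0) (𝓝 0) := hP0.comp (hΦ0.comp hη0)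
  -- the good region
  have good : ∀ᶠ τ in 𝓝[>] (0:ℝ), ∀ k : Fin c, 0 < rho k (Φ (η τ)) ∧ 0 < uu k (Φ (η τ)) ∧
      Real.log (rho k (Φ (η τ))) = - (uu k (Φ (η τ)))⁻¹ := by
    filter_upwards [g3.eventually hL, g4] with τ h1 h2 k
    refine ⟨(h1 k).1, (h1 k).2.1, ?_⟩
    have h3 : L k (η τ) = 0 := h2 k
    rw [(h1 k).2.2] at h3
    linarith
  have small : ∀ᶠ τ in 𝓝[>] (0:ℝ), ∀ k : Fin d, |Φ (η τ) (Sum.inl (k, true))| < 1 := by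
    refine eventually_all.2 fun k => ?_
    have h1 := ((tendsto_pi_nhds.1 (hΦ0.comp hη0)) (Sum.inl (k, true))).abs
    simp only [Pi.zero_apply, abs_zero] at h1
    exact h1.eventually (gt_mem_nhds one_pos)
  have toc : ∀ k : Fin d, (k : ℕ) < c → ∃ j : Fin c, k = Fin.castLE hcd j := fun k hk => ⟨⟨k, hk⟩, rfl⟩
  refine ⟨fun τ => P (Φ (η τ)), ?_, ?_, hδ0, ?_⟩
  · filter_upwards [g1, g3.eventually (FP_le hch.an.eventually_analyticAt)] with τ h1 h2
    exact (PM_analytic lam _).fun_comp (h2.fun_comp h1)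
  · obtain ⟨s, hsF, inj⟩ := hch.inj
    obtain ⟨ε1, hε1, hsub⟩ := mem_nhdsGT_iff_exists_Ioo_subset.1
      ((g3.eventually hsF).and (good.and small))
    simp only [mem_Ioi] at hε1
    refine ⟨min ε ε1, lt_min hε hε1, ?_⟩
    intro τ hτ τ' hτ' heq
    obtain ⟨m1, m2, m3⟩ := hsub ⟨hτ.1, hτ.2.trans_le (min_le_right _ _)⟩
    obtain ⟨n1, n2, n3⟩ := hsub ⟨hτ'.1, hτ'.2.trans_le (min_le_right _ _)⟩
    refine g2 ⟨hτ.1, hτ.2.trans_le (min_le_left _ _)⟩ ⟨hτ'.1, hτ'.2.trans_le (min_le_left _ _)⟩ ?_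
    refine inj m1 n1 ?_
    have hinl := PM_inj lam (Φ (η τ)) (Φ (η τ'))
      (fun k hk => ⟨by obtain ⟨j, rfl⟩ := toc k hk; exact (m2 j).1, m3 k⟩)
      (fun k hk => ⟨by obtain ⟨j, rfl⟩ := toc k hk; exact (n2 j).1, n3 k⟩) heq
    ext j
    rcases j with j | k
    · exact hinl j
    · have e1 : rho k (Φ (η τ)) = rho k (Φ (η τ')) := hinl _
      have e2 := (m2 k).2.2
      rw [e1, (n2 k).2.2] at e2
      exact (inv_injective (neg_injective e2)).symm
  · have hsm : ∀ᶠ τ in 𝓝[>] (0:ℝ), ∀ k : Fin d, ‖P (Φ (η τ)) k‖ < 1 := by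
      refine eventually_all.2 fun k => ?_
      have h1 := ((tendsto_pi_nhds.1 hδ0) k).norm
      simp only [Pi.zero_apply, norm_zero] at h1
      exact h1.eventually (gt_mem_nhds one_pos)
    filter_upwards [good, hsm, hη0.eventually (eventually_all.2 hFz)] with τ h1 h2 h3
    have hn : ∀ k : Fin c, ‖P (Φ (η τ)) (Fin.castLE hcd k)‖ = rho k (Φ (η τ)) := fun k =>
      PM_norm lam _ _ k.2 (h1 k).1
    have hUm : P (Φ (η τ)) ∈ U := by
      rw [hU, hΔ]
      refine ⟨h2, fun k => ?_⟩
      rw [← norm_pos_iff, hn]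
      exact (h1 k).1
    refine ⟨?_, ?_⟩
    · rw [hX]
      refine ⟨hUm, fun i => ?_⟩
      refine (hFA _ hUm (fun k => (h1 k).2.1.ne') (fun k => ?_) i).1 (h3 i)
      rw [hn]
      exact (h1 k).2.2
    · intro hz
      have h4 := hn ⟨0, hc⟩
      rw [hz] at h4
      simp only [Pi.zero_apply, norm_zero] at h4
      exact (h1 ⟨0, hc⟩).1.ne h4

end F2

end LRA

open Set

/-- Lemma 4.3: for log-real-analytic functions `A₁, …, A_p` on the unit polydisc `Δ^d`
(polynomials in `log|z₁|, …, log|z_c|` with real analytic coefficients), the common zero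
locus `X⁻` in `U = Δ^d ∖ {z₁⋯z_c = 0}` either avoids a small polydisc around `0`, or
contains an injective continuous curve `γ : [0,1) → Δ^d` with `γ(0) = 0`, real analytic
on `(0,1)`. -/
theorem stmt_3 (c d p : ℕ) (hc : 1 ≤ c) (hcd : c ≤ d)
    (Δ : Set (Fin d → ℂ)) (hΔ : Δ = {z | ∀ i, ‖z i‖ < 1})
    (U : Set (Fin d → ℂ))
    (hU : U = {z ∈ Δ | ∀ k : Fin c, z (Fin.castLE hcd k) ≠ 0})
    (A : Fin p → (Fin d → ℂ) → ℝ)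
    (hA : ∀ i, ∃ (M : Finset (Fin c → ℕ))
      (coef : (Fin c → ℕ) → (Fin d → ℂ) → ℝ),
      (∀ m ∈ M, AnalyticOnNhd ℝ (coef m) Δ) ∧
      (∀ z ∈ U, A i z =
        ∑ m ∈ M, coef m z * ∏ k : Fin c, (Real.log ‖z (Fin.castLE hcd k)‖) ^ (m k)))
    (X : Set (Fin d → ℂ)) (hX : X = {z ∈ U | ∀ i, A i z = 0}) :
    (∃ r ∈ Ioo (0 : ℝ) 1, ∀ z ∈ X, ¬ (∀ i, ‖z i‖ < r)) ∨
    (∃ γ : ℝ → (Fin d → ℂ), ContinuousOn γ (Ico (0 : ℝ) 1) ∧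
      InjOn γ (Ico (0 : ℝ) 1) ∧ γ 0 = 0 ∧
      γ '' Ico (0 : ℝ) 1 ⊆ Δ ∧
      AnalyticOnNhd ℝ γ (Ioo (0 : ℝ) 1) ∧
      γ '' Ioo (0 : ℝ) 1 ⊆ X) := by
  by_cases hr : ∃ r ∈ Ioo (0 : ℝ) 1, ∀ z ∈ X, ¬ (∀ i, ‖z i‖ < r)
  · exact Or.inl hr
  · right
    push Not at hr
    have hnb : (nhds (0 : Fin d → ℂ) ⊓ Filter.principal X).NeBot := by
      rw [Filter.inf_principal_neBot_iff]
      intro s hs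
      obtain ⟨e, he, hes⟩ := Metric.mem_nhds_iff.1 hs
      obtain ⟨z, hz, hzr⟩ := hr (min e (1 / 2)) ⟨lt_min he (by norm_num),
        (min_le_right _ _).trans_lt (by norm_num)⟩
      refine ⟨z, hes ?_, hz⟩
      rw [mem_ball_zero_iff, pi_norm_lt_iff he]
      exact fun i => (hzr i).trans_le (min_le_left _ _)
    obtain ⟨δ, h1, h2, h3, h4⟩ := LRA.core hc hcd Δ hΔ U hU A hA X hX
      (@Ultrafilter.of _ _ hnb) ((Ultrafilter.of_le _).trans inf_le_left)
      ((Ultrafilter.of_le (nhds (0 : Fin d → ℂ) ⊓ Filter.principal X)).trans inf_le_right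
        (Filter.mem_principal_self X))
    refine LRA.assemble (δ := δ) ?_ ?_ h1 h2 h3 h4
    · intro z hz
      rw [hX, hU] at hz
      exact hz.1.1
    · rw [hΔ]; simp
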